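/- arXiv:2403.15201 — 11 statements merged into one kernel-verified Lean document; each statement's English description precedes it below -/
import Mathlib

section
/- For every first-order formula φ(x,y) over the language of graphs expanded by finitely many unary color predicates, there exists r ∈ ℕ (depending only on φ) such that for every k ∈ ℕ there exists m ∈ ℕ with the following property: no finite graph G contains a set W of at least m vertices such that φ monadically shatters W in G and W is (r,k)-flip-breakable in G. -/
set_option autoImplicit false

open FirstOrder

/-- The first-order language of graphs expanded by `k` unary color predicates:
one binary relation symbol (adjacency) and `k` unary relation symbols (the colors). -/
def colLang (k : ℕ) : FirstOrder.Language where
  Functions := fun _ => Empty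
  Relations := fun n =>
    match n with
    | 1 => Fin k
    | 2 => Unit
    | _ => Empty

/-- Interpretation of the relation symbols of `colLang k` in a graph `G`
whose vertices are colored by `c`. -/
def colRelMap {k : ℕ} {V : Type} (G : SimpleGraph V) (c : V → Fin k) :
    ∀ n : ℕ, (colLang k).Relations n → (Fin n → V) → Prop
  | 0, r, _ => Empty.elim r
  | 1, i, x => c (x 0) = i
  | 2, _, x => G.Adj (x 0) (x 1)
  | _ + 3, r, _ => Empty.elim r

/-- The `colLang k`-structure determined by a graph `G` with coloring `c`. -/
def colStruct {k : ℕ} {V : Type} (G : SimpleGraph V) (c : V → Fin k) :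
    (colLang k).Structure V where
  funMap := fun f _ => Empty.elim f
  RelMap := fun {n} => colRelMap G c n

/-- Satisfaction of a formula `φ(x, y)` at a pair of vertices of the colored graph `(G, c)`. -/
def colSat {k : ℕ} {V : Type} (G : SimpleGraph V) (c : V → Fin k)
    (φ : (colLang k).Formula (Fin 2)) (u v : V) : Prop :=
  letI := colStruct G c
  φ.Realize ![u, v]

/-- `H` is a `k`-flip of `G`: for some partition of the vertex set into at most `k` parts
(given by `P : V → Fin k`) and some symmetric relation `F` on the parts, distinct vertices
`u, v` are adjacent in `H` iff (`uv ∈ E(G)`) XOR (`(P u, P v) ∈ F`). -/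
def IsKFlip {V : Type} (k : ℕ) (G H : SimpleGraph V) : Prop :=
  ∃ (P : V → Fin k) (F : Fin k → Fin k → Prop), Symmetric F ∧
    ∀ u v : V, u ≠ v → (H.Adj u v ↔ Xor' (G.Adj u v) (F (P u) (P v)))

/-- `φ(x,y)` shatters the vertex set `W` in the graph `G` colored by `c`: there are vertices
`a_R`, for `R ⊆ W`, such that for all `b ∈ W` and `R ⊆ W` we have `φ(a_R, b) ⟺ b ∈ R`. -/
def Shatters {k n : ℕ} (G : SimpleGraph (Fin n)) (c : Fin n → Fin k)
    (φ : (colLang k).Formula (Fin 2)) (W : Finset (Fin n)) : Prop :=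
  ∃ a : Finset (Fin n) → Fin n,
    ∀ R : Finset (Fin n), R ⊆ W → ∀ b ∈ W, (colSat G c φ (a R) b ↔ b ∈ R)

/-- `φ(x,y)` monadically shatters `W` in `G`: some coloring of `G` makes `φ` shatter `W`. -/
def MonadicallyShatters {k n : ℕ} (G : SimpleGraph (Fin n))
    (φ : (colLang k).Formula (Fin 2)) (W : Finset (Fin n)) : Prop :=
  ∃ c : Fin n → Fin k, Shatters G c φ W

/-- The set `W` is `(r, k)`-flip-breakable in `G`: there are disjoint `A, B ⊆ W`, each of size
at least `|W| / 3`, and a `k`-flip `H` of `G` such that no vertex is within distance `r` in `H`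
of both `A` and `B`. -/
def FlipBreakableSet {n : ℕ} (r k : ℕ) (G : SimpleGraph (Fin n))
    (W : Finset (Fin n)) : Prop :=
  ∃ A B : Finset (Fin n), A ⊆ W ∧ B ⊆ W ∧ Disjoint A B ∧
    W.card ≤ 3 * A.card ∧ W.card ≤ 3 * B.card ∧
    ∃ H : SimpleGraph (Fin n), IsKFlip k G H ∧
      ∀ v : Fin n,
        ¬ ((∃ a ∈ A, ∃ p : H.Walk a v, p.length ≤ r) ∧
           (∃ b ∈ B, ∃ p : H.Walk b v, p.length ≤ r))

/-- Closeness in a graph: a walk of length at most `r`. -/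
def Near {V : Type} (H : SimpleGraph V) (r : ℕ) (u v : V) : Prop :=
  ∃ p : H.Walk u v, p.length ≤ r

theorem Near.symm {V : Type} {H : SimpleGraph V} {r : ℕ} {u v : V} (h : Near H r u v) :
    Near H r v u := by
  obtain ⟨p, hp⟩ := h
  exact ⟨p.reverse, by simpa using hp⟩

theorem Near.trans {V : Type} {H : SimpleGraph V} {r s : ℕ} {u v w : V} (h : Near H r u v)
    (h' : Near H s v w) : Near H (r + s) u w := by
  obtain ⟨p, hp⟩ := h
  obtain ⟨q, hq⟩ := h'
  exact ⟨p.append q, by rw [SimpleGraph.Walk.length_append]; omega⟩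

theorem Near.mono {V : Type} {H : SimpleGraph V} {r s : ℕ} {u v : V} (h : Near H r u v)
    (hrs : r ≤ s) : Near H s u v := by
  obtain ⟨p, hp⟩ := h
  exact ⟨p, hp.trans hrs⟩

/-- Coordinates with different labels are far apart. -/
def BlockSep {V ι : Type} (H : SimpleGraph V) (r : ℕ) (p : ι → ℕ) (x : ι → V) : Prop :=
  ∀ i j, p i ≠ p j → ¬ Near H r (x i) (x j)

theorem BlockSep.mono {V ι : Type} {H : SimpleGraph V} {r s : ℕ} {p : ι → ℕ} {x : ι → V}
    (h : BlockSep H s p x) (hrs : r ≤ s) : BlockSep H r p x :=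
  fun i j hij hn => h i j hij (hn.mono hrs)

/-- `Q` is determined by the types (in `τ`) of the blocks of any `r`-separated block
decomposition of the tuple. -/
def Loc {V ι : Type} (H : SimpleGraph V) (τ : Type) (r : ℕ) (Q : (ι → V) → Prop) : Prop :=
  ∃ f : Set ι → (ι → V) → τ,
    (∀ I x x', (∀ i ∈ I, x i = x' i) → f I x = f I x') ∧
    ∀ (p : ι → ℕ) (x x' : ι → V), BlockSep H r p x → BlockSep H r p x' →
      (∀ b, f (p ⁻¹' {b}) x = f (p ⁻¹' {b}) x') → Q x → Q x'

theorem Loc.imp {V ι : Type} {H : SimpleGraph V} {τ₁ τ₂ : Type} {r₁ r₂ : ℕ}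
    {Q₁ Q₂ : (ι → V) → Prop} (h₁ : Loc H τ₁ r₁ Q₁) (h₂ : Loc H τ₂ r₂ Q₂) :
    Loc H (τ₁ × τ₂) (max r₁ r₂) (fun x => Q₁ x → Q₂ x) := by
  obtain ⟨f₁, hf₁, hQ₁⟩ := h₁
  obtain ⟨f₂, hf₂, hQ₂⟩ := h₂
  refine ⟨fun I x => (f₁ I x, f₂ I x), fun I x x' h => ?_, fun p x x' hs hs' h hQ hx' => ?_⟩
  · simp only [hf₁ I x x' h, hf₂ I x x' h]
  · have h1 : ∀ b, f₁ (p ⁻¹' {b}) x = f₁ (p ⁻¹' {b}) x' := fun b => (Prod.mk.inj (h b)).1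
    have h2 : ∀ b, f₂ (p ⁻¹' {b}) x = f₂ (p ⁻¹' {b}) x' := fun b => (Prod.mk.inj (h b)).2
    exact hQ₂ p x x' (hs.mono (le_max_right _ _)) (hs'.mono (le_max_right _ _)) h2
      (hQ (hQ₁ p x' x (hs'.mono (le_max_left _ _)) (hs.mono (le_max_left _ _))
        (fun b => (h1 b).symm) hx'))

theorem Loc.neg {V ι : Type} {H : SimpleGraph V} {τ : Type} {r : ℕ}
    {Q : (ι → V) → Prop} (h : Loc H τ r Q) : Loc H τ r (fun x => ¬ Q x) := by
  obtain ⟨f, hf, hQ⟩ := h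
  exact ⟨f, hf, fun p x x' hs hs' h hx hx' => hx (hQ p x' x hs' hs (fun b => (h b).symm) hx')⟩

theorem Loc.reindex {V ι κ : Type} {H : SimpleGraph V} {τ : Type} {r : ℕ}
    {Q : (ι → V) → Prop} (h : Loc H τ r Q) (e : ι → κ) :
    Loc H τ r (fun x : κ → V => Q (x ∘ e)) := by
  obtain ⟨f, hf, hQ⟩ := h
  refine ⟨fun I x => f (e ⁻¹' I) (x ∘ e), fun I x x' h => hf _ _ _ (fun i hi => h _ hi),
    fun p x x' hs hs' h hx => ?_⟩
  exact hQ (p ∘ e) (x ∘ e) (x' ∘ e) (fun i j hij => hs _ _ hij) (fun i j hij => hs' _ _ hij)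
    (fun b => h b) hx

open Classical in
theorem Loc.binary {V ι σ : Type} {H : SimpleGraph V} (E : V → V → Prop) (g : V → σ)
    (hE : ∀ u v u' v', ¬ Near H 1 u v → ¬ Near H 1 u' v' → g u = g u' → g v = g v' →
      E u v → E u' v') (i j : ι) :
    Loc H (Prop × Option σ × Option σ) 1 (fun x : ι → V => E (x i) (x j)) := by
  refine ⟨fun I x => ((i ∈ I ∧ j ∈ I ∧ E (x i) (x j)),
    (if i ∈ I then some (g (x i)) else none), (if j ∈ I then some (g (x j)) else none)),
    fun I x x' h => ?_, fun p x x' hs hs' h hx => ?_⟩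
  · by_cases hi : i ∈ I <;> by_cases hj : j ∈ I <;> simp [hi, hj]
    · rw [h i hi, h j hj]; simp
    · rw [h i hi]
    · rw [h j hj]
  · by_cases hij : p i = p j
    · have := h (p i)
      simp [hij] at this
      exact this.1.1 hx
    · have h1 := h (p i)
      have h2 := h (p j)
      simp at h1 h2
      exact hE _ _ _ _ (hs i j hij) (hs' i j hij) h1.2.1 h2.2.2 hx

theorem Loc.cover {V ι : Type} (H : SimpleGraph V) (r : ℕ) (S : Set V) :
    Loc H (Prop × Set ι) (4 * r) (fun x : ι → V => ∀ y ∈ S, ∃ i, Near H r (x i) y) := by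
  by_cases hc : ∃ z : ι → V, ∀ y ∈ S, ∃ i, Near H r (z i) y
  · obtain ⟨z, hz⟩ := hc
    refine ⟨fun I x =>
      ((∀ y ∈ S, ∀ y' ∈ S, Near H (2 * r) y y' → (∃ i ∈ I, Near H r (x i) y) →
          ∃ i ∈ I, Near H r (x i) y'),
        {l | ∃ y ∈ S, Near H r (z l) y ∧ ∃ i ∈ I, Near H r (x i) y}), fun I x x' h => ?_,
      fun p x x' hs hs' h hx => ?_⟩
    · have : ∀ y, (∃ i ∈ I, Near H r (x i) y) ↔ (∃ i ∈ I, Near H r (x' i) y) := by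
        intro y
        constructor
        · rintro ⟨i, hi, hn⟩
          exact ⟨i, hi, h i hi ▸ hn⟩
        · rintro ⟨i, hi, hn⟩
          exact ⟨i, hi, (h i hi).symm ▸ hn⟩
      simp only [this]
    · intro y hy
      obtain ⟨j, hj⟩ := hx y hy
      obtain ⟨l, hl⟩ := hz y hy
      obtain ⟨e1, e2⟩ := Prod.mk.inj (h (p j))
      have hl1 : l ∈ {l | ∃ y ∈ S, Near H r (z l) y ∧
          ∃ i ∈ p ⁻¹' {p j}, Near H r (x i) y} := ⟨y, hy, hl, j, rfl, hj⟩
      rw [e2] at hl1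
      obtain ⟨w, hw, hlw, hi⟩ := hl1
      have hcl : (∀ y ∈ S, ∀ y' ∈ S, Near H (2 * r) y y' →
          (∃ i ∈ p ⁻¹' {p j}, Near H r (x i) y) →
          ∃ i ∈ p ⁻¹' {p j}, Near H r (x i) y') := by
        rintro y hy y' hy' hyy ⟨i, hi, hn⟩
        obtain ⟨i', hi'⟩ := hx y' hy'
        refine ⟨i', ?_, hi'⟩
        by_contra hne
        have hi2 : p i = p j := hi
        have hne2 : ¬ p i' = p j := hne
        refine hs i i' (fun h => hne2 (h ▸ hi2)) (((hn.trans hyy).trans hi'.symm).mono (by omega))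
      rw [e1] at hcl
      obtain ⟨i, _, hn⟩ := hcl w hw y hy ((hlw.symm.trans hl).mono (by omega)) hi
      exact ⟨i, hn⟩
  · exact ⟨fun _ _ => (True, ∅), fun _ _ _ _ => rfl,
      fun p x x' _ _ _ hx => absurd ⟨x, hx⟩ hc⟩

/-- Extension of a tuple by one entry. -/
def ext1 {V ι : Type} (x : ι → V) (y : V) : Option ι → V := fun o => o.elim y x

/-- Extension of a block by the new index. -/
def extI {ι : Type} (I : Set ι) : Set (Option ι) := {o | ∀ i, o = some i → i ∈ I}

theorem Loc.ex {V ι τ : Type} [Finite ι] {H : SimpleGraph V} {r : ℕ}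
    {Q : (Option ι → V) → Prop} (h : Loc H τ r Q) :
    Loc H (Set τ × Set τ × (τ → Prop × Set ι)) (4 * r)
      (fun x : ι → V => ∃ y, Q (ext1 x y)) := by
  obtain ⟨f, hf, hQ⟩ := h
  have hcov := fun t : τ => Loc.cover (ι := ι) H r {y : V | f {none} (fun _ => y) = t}
  choose g hg hgQ using hcov
  refine ⟨fun I x => ({t | ∃ y, f (some '' I) (ext1 x y) = t},
    {t | ∃ y, (∃ i ∈ I, Near H r (x i) y) ∧ f (extI I) (ext1 x y) = t},
    fun t => g t I x), fun I x x' h => ?_, fun p x x' hs hs' h => ?_⟩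
  · have h1 : ∀ y, f (some '' I) (ext1 x y) = f (some '' I) (ext1 x' y) := by
      intro y
      apply hf
      rintro _ ⟨i, hi, rfl⟩
      exact h i hi
    have h2 : ∀ y, f (extI I) (ext1 x y) = f (extI I) (ext1 x' y) := by
      intro y
      apply hf
      rintro (_ | i) hi
      · rfl
      · exact h i (hi i rfl)
    have h3 : ∀ y, (∃ i ∈ I, Near H r (x i) y) ↔ (∃ i ∈ I, Near H r (x' i) y) := by
      intro y
      constructor
      · rintro ⟨i, hi, hn⟩
        exact ⟨i, hi, h i hi ▸ hn⟩
      · rintro ⟨i, hi, hn⟩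
        exact ⟨i, hi, (h i hi).symm ▸ hn⟩
    simp only [h1, h2, h3, hg _ I x x' h]
  · skip
    have hA : ∀ b y y', f (some '' (p ⁻¹' {b})) (ext1 x y) =
        f (some '' (p ⁻¹' {b})) (ext1 x' y') := by
      intro b y y'
      have e := (Prod.mk.inj (h b)).1
      have hm : f (some '' (p ⁻¹' {b})) (ext1 x y) ∈
          {t | ∃ y, f (some '' (p ⁻¹' {b})) (ext1 x y) = t} := ⟨y, rfl⟩
      rw [e] at hm
      obtain ⟨y2, hy2⟩ := hm
      rw [← hy2]
      apply hf
      rintro _ ⟨i, hi, rfl⟩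
      rfl
    rintro ⟨y, hy⟩
    by_cases hn : ∃ i, Near H r (x i) y
    · obtain ⟨j, hj⟩ := hn
      have e := (Prod.mk.inj (Prod.mk.inj (h (p j))).2).1
      have hm : f (extI (p ⁻¹' {p j})) (ext1 x y) ∈
          {t | ∃ y, (∃ i ∈ p ⁻¹' {p j}, Near H r (x i) y) ∧
            f (extI (p ⁻¹' {p j})) (ext1 x y) = t} := ⟨y, ⟨j, rfl, hj⟩, rfl⟩
      rw [e] at hm
      obtain ⟨y', ⟨j', hj', hn'⟩, ht⟩ := hm
      refine ⟨y', ?_⟩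
      have hj'' : p j' = p j := hj'
      have key : ∀ (x : ι → V) (y : V) (j' : ι), p j' = p j → BlockSep H (4 * r) p x →
          Near H r (x j') y → BlockSep H r (fun o : Option ι => o.elim (p j) p) (ext1 x y) := by
        intro x y j' hj' hs hn
        rintro (_ | a) (_ | b) hab hne
        · exact hab rfl
        · exact hs j' b (fun h => hab (by simpa [hj'] using h)) ((hn.trans hne).mono (by omega))
        · exact hs j' a (fun h => hab (by simpa [hj'] using h.symm))
            ((hn.trans hne.symm).mono (by omega))
        · exact hs a b hab (hne.mono (by omega))
      refine hQ (fun o : Option ι => o.elim (p j) p) _ _ (key x y j rfl hs hj)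
        (key x' y' j' hj'' hs' hn') ?_ hy
      intro b
      by_cases hb : b = p j
      · subst hb
        have : (fun o : Option ι => o.elim (p j) p) ⁻¹' {p j} = extI (p ⁻¹' {p j}) := by
          ext (_ | i) <;> simp [extI]
        rw [this, ht]
      · have : (fun o : Option ι => o.elim (p j) p) ⁻¹' {b} = some '' (p ⁻¹' {b}) := by
          ext (_ | i)
          · simp [Ne.symm hb]
          · simp
        rw [this, hA b y y']
    · skip
      have hcv : ¬ ∀ w ∈ {w : V | f {none} (fun _ => w) = f {none} (fun _ => y)},
          ∃ i, Near H r (x' i) w := by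
        intro hc
        refine hn (hgQ (f {none} (fun _ => y)) p x' x hs' hs (fun b => ?_) hc y rfl)
        have e := (Prod.mk.inj (Prod.mk.inj (h b)).2).2
        exact (congrFun e _).symm
      push Not at hcv
      obtain ⟨y', hy', hn'⟩ := hcv
      refine ⟨y', ?_⟩
      obtain ⟨N, hN⟩ : ∃ N : ℕ, ∀ i, p i ≠ N := by
        obtain ⟨N, hN⟩ := Set.Infinite.exists_notMem_finite (Set.infinite_univ (α := ℕ))
          (Set.finite_range p)
        exact ⟨N, fun i hi => hN.2 ⟨i, hi⟩⟩
      have key : ∀ (x : ι → V) (y : V), BlockSep H (4 * r) p x →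
          (¬ ∃ i, Near H r (x i) y) →
          BlockSep H r (fun o : Option ι => o.elim N p) (ext1 x y) := by
        intro x y hs hn
        rintro (_ | a) (_ | b) hab hne
        · exact hab rfl
        · exact hn ⟨b, hne.symm⟩
        · exact hn ⟨a, hne⟩
        · exact hs a b hab (hne.mono (by omega))
      refine hQ (fun o : Option ι => o.elim N p) _ _ (key x y hs hn)
        (key x' y' hs' (fun ⟨i, hi⟩ => hn' i hi)) ?_ hy
      intro b
      by_cases hb : b = N
      · subst hb
        have : (fun o : Option ι => o.elim b p) ⁻¹' {b} = {none} := by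
          ext (_ | i)
          · simp
          · simpa using hN i
        have aux : ∀ (x : ι → V) (y : V), f {none} (ext1 x y) = f {none} (fun _ => y) := by
          intro x y
          apply hf
          rintro _ rfl
          rfl
        rw [this, aux, aux]
        exact hy'.symm
      · have : (fun o : Option ι => o.elim N p) ⁻¹' {b} = some '' (p ⁻¹' {b}) := by
          ext (_ | i)
          · simp [Ne.symm hb]
          · simp
        rw [this, hA b y y']

theorem term_var {k n : ℕ} {V : Type} (t : (colLang k).Term (Fin 2 ⊕ Fin n)) :
    ∃ i, ∀ (G : SimpleGraph V) (c : V → Fin k) (x : Fin 2 ⊕ Fin n → V),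
      (letI := colStruct G c; t.realize x) = x i := by
  cases t with
  | var i => exact ⟨i, fun _ _ _ => rfl⟩
  | func f _ => exact Empty.elim f

/-- Satisfaction of a bounded formula as a relation on tuples. -/
def bSat {k n : ℕ} {V : Type} (G : SimpleGraph V) (c : V → Fin k)
    (ψ : (colLang k).BoundedFormula (Fin 2) n) (x : Fin 2 ⊕ Fin n → V) : Prop :=
  letI := colStruct G c
  ψ.Realize (x ∘ Sum.inl) (x ∘ Sum.inr)

/-- `H` is the flip of `G` along `P`, `F`. -/
def FlipBy {V : Type} {k : ℕ} (G H : SimpleGraph V) (P : V → Fin k)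
    (F : Fin k → Fin k → Prop) : Prop :=
  ∀ u v : V, u ≠ v → (H.Adj u v ↔ Xor' (G.Adj u v) (F (P u) (P v)))

theorem not_near {V : Type} {H : SimpleGraph V} {u v : V} (h : ¬ Near H 1 u v) :
    u ≠ v ∧ ¬ H.Adj u v := by
  constructor
  · rintro rfl
    exact h ⟨SimpleGraph.Walk.nil, by simp⟩
  · intro ha
    exact h ⟨ha.toWalk, by simp⟩

theorem formula_loc {k₀ n : ℕ} (ψ : (colLang k₀).BoundedFormula (Fin 2) n) :
    ∃ r : ℕ, ∀ k : ℕ, ∃ τ : Type, Finite τ ∧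
      ∀ (V : Type) (G H : SimpleGraph V) (c : V → Fin k₀) (P : V → Fin k)
        (F : Fin k → Fin k → Prop), FlipBy G H P F → Loc H τ r (bSat G c ψ) := by
  induction ψ with
  | falsum =>
    exact ⟨0, fun k => ⟨Unit, inferInstance, fun V G H c P F _ =>
      ⟨fun _ _ => (), fun _ _ _ _ => rfl, fun _ _ _ _ _ _ h => h⟩⟩⟩
  | equal t₁ t₂ =>
    refine ⟨1, fun k => ⟨Prop × Option Unit × Option Unit, inferInstance,
      fun V G H c P F _ => ?_⟩⟩
    obtain ⟨i, hi⟩ := term_var (V := V) t₁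
    obtain ⟨j, hj⟩ := term_var (V := V) t₂
    have e : bSat G c (FirstOrder.Language.BoundedFormula.equal t₁ t₂) =
        fun x => x i = x j := by
      funext x
      rw [← hi G c x, ← hj G c x]
      simp only [bSat, FirstOrder.Language.BoundedFormula.Realize, Sum.elim_comp_inl_inr]
    rw [e]
    refine Loc.binary (fun u v => u = v) (fun _ => ()) ?_ i j
    intro u v u' v' h _ _ _ huv
    exact absurd huv (not_near h).1
  | @rel n l R ts =>
    refine ⟨1, fun k => ⟨Prop × Option (Fin k₀ × Fin k) × Option (Fin k₀ × Fin k),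
      inferInstance, fun V G H c P F hF => ?_⟩⟩
    have hv := fun a => term_var (V := V) (ts a)
    choose i hi using hv
    have e : bSat G c (FirstOrder.Language.BoundedFormula.rel R ts) =
        fun x => colRelMap G c l R (fun a => x (i a)) := by
      funext x
      simp only [← hi _ G c x]
      simp only [bSat, FirstOrder.Language.BoundedFormula.Realize, Sum.elim_comp_inl_inr]
      rfl
    rw [e]
    match l, R, i with
    | 0, R, _ => exact Empty.elim R
    | 1, R, i =>
      refine Loc.binary (fun u v => c u = R) (fun u => (c u, P u)) ?_ (i 0) (i 0)
      intro u v u' v' _ _ h _ hu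
      rw [← hu]
      exact (Prod.mk.inj h).1.symm
    | 2, R, i =>
      refine Loc.binary (fun u v => G.Adj u v) (fun u => (c u, P u)) ?_ (i 0) (i 1)
      intro u v u' v' h h' hu hv ha
      have h1 := hF u v (not_near h).1
      have h2 := hF u' v' (not_near h').1
      have n1 := (not_near h).2
      have n2 := (not_near h').2
      rw [← (Prod.mk.inj hu).2, ← (Prod.mk.inj hv).2] at h2
      simp only [Xor', xor_def] at h1 h2
      tauto
    | _ + 3, R, _ => exact Empty.elim R
  | imp ψ₁ ψ₂ ih₁ ih₂ =>
    obtain ⟨r₁, h₁⟩ := ih₁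
    obtain ⟨r₂, h₂⟩ := ih₂
    refine ⟨max r₁ r₂, fun k => ?_⟩
    obtain ⟨τ₁, _, h₁⟩ := h₁ k
    obtain ⟨τ₂, _, h₂⟩ := h₂ k
    exact ⟨τ₁ × τ₂, inferInstance, fun V G H c P F hF =>
      (h₁ V G H c P F hF).imp (h₂ V G H c P F hF)⟩
  | @all n ψ ih =>
    obtain ⟨r, h⟩ := ih
    refine ⟨4 * r, fun k => ?_⟩
    obtain ⟨τ, _, h⟩ := h k
    refine ⟨Set τ × Set τ × (τ → Prop × Set (Fin 2 ⊕ Fin n)), inferInstance,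
      fun V G H c P F hF => ?_⟩
    have h1 := (((h V G H c P F hF).neg.reindex
      (Sum.elim (fun a => some (Sum.inl a))
        (Fin.snoc (α := fun _ => Option (Fin 2 ⊕ Fin n)) (fun a => some (Sum.inr a))
          none))).ex).neg
    convert h1 using 1
    funext x
    simp only [not_exists, not_not]
    apply propext
    apply forall_congr'
    intro y
    apply iff_of_eq
    simp only [bSat]
    congr 1
    funext a
    refine Fin.lastCases ?_ (fun a => ?_) a
    · simp [ext1]
    · simp [ext1]

theorem pigeon {V τ : Type} [Finite τ] (A : Finset V) (f : V → τ) (h : Nat.card τ < A.card) :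
    ∃ a ∈ A, ∃ b ∈ A, a ≠ b ∧ f a = f b := by
  classical
  have := Fintype.ofFinite τ
  refine Finset.exists_ne_map_eq_of_card_lt_of_maps_to (t := Finset.univ) ?_ (by simp)
  rwa [Finset.card_univ, ← Nat.card_eq_fintype_card]

/-- For every first-order formula `φ(x,y)` over the language of graphs with
finitely many unary color predicates there is a radius `r` (depending only on `φ`) such that
for every `k` there is `m` such that no finite graph `G` contains a set `W` of at least `m`
vertices that is both monadically shattered by `φ` and `(r, k)`-flip-breakable in `G`. -/
theorem no_large_shattered_flipBreakable_set (k₀ : ℕ) (φ : (colLang k₀).Formula (Fin 2)) :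
    ∃ r : ℕ, ∀ k : ℕ, ∃ m : ℕ,
      ∀ (n : ℕ) (G : SimpleGraph (Fin n)) (W : Finset (Fin n)), m ≤ W.card →
        ¬ (MonadicallyShatters G φ W ∧ FlipBreakableSet r k G W) := by
  obtain ⟨r, hr⟩ := formula_loc φ
  refine ⟨r, fun k => ?_⟩
  obtain ⟨τ, _, hτ⟩ := hr k
  refine ⟨3 * Nat.card τ + 1, ?_⟩
  rintro n G W hW ⟨⟨c, a, ha⟩, A, B, hA, hB, hAB, hAc, hBc, H, ⟨P, F, _, hF⟩, hd⟩
  have hloc := (hτ _ G H c P F hF).reindex (Sum.elim id Fin.elim0 : Fin 2 ⊕ Fin 0 → Fin 2)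
  have e : (fun x : Fin 2 → Fin n => bSat G c φ
      (x ∘ (Sum.elim id Fin.elim0 : Fin 2 ⊕ Fin 0 → Fin 2))) =
      fun x => colSat G c φ (x 0) (x 1) := by
    funext x
    simp only [bSat, colSat, FirstOrder.Language.Formula.Realize]
    congr 1
    · funext i
      fin_cases i <;> rfl
    · exact Subsingleton.elim _ _
  rw [e] at hloc
  obtain ⟨f, hf, hQ⟩ := hloc
  have key : ∀ u b b' : Fin n, ¬ Near H r b u → ¬ Near H r b' u →
      f {1} (fun _ => b) = f {1} (fun _ => b') → colSat G c φ u b → colSat G c φ u b' := by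
    intro u b b' hb hb' ht hs
    have sep : ∀ b, ¬ Near H r b u → BlockSep H r (fun i : Fin 2 => (i : ℕ)) ![u, b] := by
      intro b hb i j hij hn
      fin_cases i <;> fin_cases j
      · exact hij rfl
      · exact hb hn.symm
      · exact hb hn
      · exact hij rfl
    refine hQ (fun i : Fin 2 => (i : ℕ)) ![u, b] ![u, b'] (sep b hb) (sep b' hb') ?_ hs
    intro l
    by_cases hl : l = 1
    · subst hl
      have e1 : (fun i : Fin 2 => (i : ℕ)) ⁻¹' {1} = {1} := by
        ext i
        fin_cases i <;> simp
      rw [e1, hf {1} ![u, b] (fun _ => b) (by simp), hf {1} ![u, b'] (fun _ => b') (by simp), ht]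
    · apply hf
      intro i hi
      fin_cases i
      · rfl
      · exact absurd (Eq.symm hi) hl
  obtain ⟨a₁, ha₁, a₂, ha₂, hane, hat⟩ := pigeon A (fun b => f {1} (fun _ => b)) (by omega)
  obtain ⟨b₁, hb₁, b₂, hb₂, hbne, hbt⟩ := pigeon B (fun b => f {1} (fun _ => b)) (by omega)
  have hR : ({a₁, b₁} : Finset (Fin n)) ⊆ W := by
    intro z hz
    simp only [Finset.mem_insert, Finset.mem_singleton] at hz
    rcases hz with rfl | rfl
    · exact hA ha₁
    · exact hB hb₁
  have hsh := ha _ hR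
  have hdis : ∀ z, z ∈ A → z ∈ B → False := fun z h1 h2 => Finset.disjoint_left.mp hAB h1 h2
  by_cases hnA : ∃ z ∈ A, ∃ p : H.Walk z (a {a₁, b₁}), p.length ≤ r
  · have hnB : ∀ z ∈ B, ¬ Near H r z (a {a₁, b₁}) := fun z hz hn => hd _ ⟨hnA, z, hz, hn⟩
    have h1 := key _ b₁ b₂ (hnB _ hb₁) (hnB _ hb₂) hbt ((hsh b₁ (hB hb₁)).2 (by simp))
    have h2 := (hsh b₂ (hB hb₂)).1 h1
    simp only [Finset.mem_insert, Finset.mem_singleton] at h2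
    rcases h2 with h2 | h2
    · exact hdis a₁ ha₁ (h2 ▸ hb₂)
    · exact hbne h2.symm
  · have hnA' : ∀ z ∈ A, ¬ Near H r z (a {a₁, b₁}) := fun z hz hn => hnA ⟨z, hz, hn⟩
    have h1 := key _ a₁ a₂ (hnA' _ ha₁) (hnA' _ ha₂) hat ((hsh a₁ (hA ha₁)).2 (by simp))
    have h2 := (hsh a₂ (hA ha₂)).1 h1
    simp only [Finset.mem_insert, Finset.mem_singleton] at h2
    rcases h2 with h2 | h2
    · exact hane h2.symm
    · exact hdis a₂ ha₂ (h2 ▸ hb₁)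
end

section
/- A class of finite graphs is nowhere dense if and only if it is deletion-breakable. -/
set_option autoImplicit false

/-- A class of finite graphs, given as a predicate singling out, for each `n`,
the graphs on vertex set `Fin n` that belong to the class. -/
abbrev GraphClass : Type := ∀ n : ℕ, SimpleGraph (Fin n) → Prop

/-- The vertex set of the `r`-subdivision of the complete graph `K_N`: the `N` principal
vertices, and `r` subdivision vertices for each edge of `K_N`. -/
abbrev SubVert (r N : ℕ) : Type := Fin N ⊕ ({p : Fin N × Fin N // p.1 < p.2} × Fin r)

/-- The `r`-subdivision of the complete graph `K_N`: each edge of `K_N` is replaced by a path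
with `r` internal vertices (for `r = 0` this is `K_N` itself). -/
def subdivClique (r N : ℕ) : SimpleGraph (SubVert r N) :=
  SimpleGraph.fromRel fun u v =>
    match u, v with
    | Sum.inl i, Sum.inl j => r = 0 ∧ i ≠ j
    | Sum.inl i, Sum.inr (e, t) => (i = e.1.1 ∧ (t : ℕ) = 0) ∨ (i = e.1.2 ∧ (t : ℕ) + 1 = r)
    | Sum.inr (e, t), Sum.inr (e', t') => e = e' ∧ (t' : ℕ) = (t : ℕ) + 1
    | _, _ => False

/-- `G` contains a copy of `X` as a (not necessarily induced) subgraph. -/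
def ContainsSubgraph {α : Type} {n : ℕ} (X : SimpleGraph α) (G : SimpleGraph (Fin n)) : Prop :=
  ∃ f : α → Fin n, Function.Injective f ∧ ∀ u v : α, X.Adj u v → G.Adj (f u) (f v)

/-- A graph class `C` is nowhere dense: for every `r` there is `N` such that no graph in `C`
contains the `r`-subdivision of `K_N` as a subgraph. -/
def NowhereDense (C : GraphClass) : Prop :=
  ∀ r : ℕ, ∃ N : ℕ, ∀ (n : ℕ) (G : SimpleGraph (Fin n)), C n G →
    ¬ ContainsSubgraph (subdivClique r N) G

/-- A graph class `C` is deletion-breakable: for every radius `r` there are `Nf : ℕ → ℕ` and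
`k : ℕ` such that for all `m`, every `W ⊆ V(G)` with `|W| ≥ Nf m` in a graph `G ∈ C` admits a
set `S` of at most `k` vertices and subsets `A, B ⊆ W ∖ S` of size at least `m` such that every
path from `A` to `B` in `G − S` has length greater than `r` (i.e. `dist_{G−S}(A,B) > r`). -/
def DeletionBreakable (C : GraphClass) : Prop :=
  ∀ r : ℕ, ∃ (Nf : ℕ → ℕ) (k : ℕ),
    ∀ (m n : ℕ) (G : SimpleGraph (Fin n)), C n G →
      ∀ W : Finset (Fin n), Nf m ≤ W.card →
        ∃ S : Finset (Fin n), S.card ≤ k ∧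
          ∃ A B : Finset (Fin n), A ⊆ W \ S ∧ B ⊆ W \ S ∧ m ≤ A.card ∧ m ≤ B.card ∧
            ∀ a ∈ A, ∀ b ∈ B, ∀ p : G.Walk a b, (∀ x ∈ p.support, x ∉ S) → r < p.length

open Classical in
lemma nd_thin {α β : Type} (U : α → Finset β) (D T : ℕ) : ∀ (q : ℕ) (A : Finset α) (Z : Finset β),
    (∀ a ∈ A, (U a).card ≤ D) → (∀ x, (A.filter (fun a => x ∈ U a)).card ≤ T) →
    (Z.card + q * D) * T + q ≤ A.card →
    ∃ A' ⊆ A, A'.card = q ∧ (∀ a ∈ A', Disjoint (U a) Z) ∧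
      ∀ a ∈ A', ∀ b ∈ A', a ≠ b → Disjoint (U a) (U b) := by
  intro q
  induction q with
  | zero => intro A Z _ _ _; exact ⟨∅, by simp, by simp, by simp, by simp⟩
  | succ q ih =>
    intro A Z hD hT hc
    have hbad : (A.filter (fun a => ¬ Disjoint (U a) Z)).card ≤ Z.card * T := by
      have : A.filter (fun a => ¬ Disjoint (U a) Z) ⊆ Z.biUnion (fun x => A.filter (fun a => x ∈ U a)) := by
        intro a ha
        rw [Finset.mem_filter] at ha
        obtain ⟨x, hx, hz⟩ := Finset.not_disjoint_iff.1 ha.2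
        exact Finset.mem_biUnion.2 ⟨x, hz, Finset.mem_filter.2 ⟨ha.1, hx⟩⟩
      exact (Finset.card_le_card this).trans (Finset.card_biUnion_le_card_mul _ _ _ (fun x _ => hT x))
    have hex : ∃ a ∈ A, Disjoint (U a) Z := by
      by_contra! h
      rw [Finset.filter_true_of_mem h] at hbad
      nlinarith [Nat.zero_le ((q+1)*D*T)]
    obtain ⟨a, ha, haZ⟩ := hex
    obtain ⟨A', hA', hq, h1, h2⟩ := ih (A.erase a) (Z ∪ U a)
      (fun b hb => hD b (Finset.mem_of_mem_erase hb))
      (fun x => (Finset.card_le_card (Finset.filter_subset_filter _ (Finset.erase_subset _ _))).trans (hT x))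
      (by
        rw [Finset.card_erase_of_mem ha]
        have h3 : (Z ∪ U a).card ≤ Z.card + D := (Finset.card_union_le _ _).trans (by have := hD a ha; omega)
        have h4 : ((Z ∪ U a).card + q * D) * T ≤ (Z.card + (q+1) * D) * T :=
          Nat.mul_le_mul_right _ (by nlinarith)
        omega)
    have haA : a ∉ A' := fun h => by simpa using hA' h
    refine ⟨insert a A', ?_, by rw [Finset.card_insert_of_notMem haA, hq], ?_, ?_⟩
    · exact Finset.insert_subset ha (hA'.trans (Finset.erase_subset _ _))
    · intro b hb
      rcases Finset.mem_insert.1 hb with rfl | hb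
      · exact haZ
      · exact (h1 b hb).mono_right Finset.subset_union_left
    · intro b hb c hc hbc
      rcases Finset.mem_insert.1 hb with rfl | hb' <;> rcases Finset.mem_insert.1 hc with rfl | hc'
      · exact absurd rfl hbc
      · exact ((h1 c (by assumption)).mono_right Finset.subset_union_right).symm
      · exact (h1 b (by assumption)).mono_right Finset.subset_union_right
      · exact h2 b hb' c hc' hbc

lemma nd_endhom (c : ℕ) : ∀ L : ℕ, ∃ T : ℕ, ∀ (col : ℕ → ℕ → ℕ),
    (∀ i j, col i j < c) → ∀ A : Finset ℕ, T ≤ A.card →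
    ∃ B ⊆ A, B.card = L ∧ ∃ h : ℕ → ℕ, (∀ x, h x < c + 1) ∧ ∀ x ∈ B, ∀ y ∈ B, x < y → col x y = h x := by
  intro L
  induction L with
  | zero => exact ⟨0, fun col _ A _ => ⟨∅, by simp, by simp, fun _ => 0, by simp, by simp⟩⟩
  | succ L ih =>
    obtain ⟨T, hT⟩ := ih
    refine ⟨c * T + 2, fun col hcol A hA => ?_⟩
    have hne : A.Nonempty := Finset.card_pos.1 (by omega)
    set x := A.min' hne with hx
    have hxA : x ∈ A := A.min'_mem hne
    obtain ⟨k, hk, hk2⟩ := Finset.exists_lt_card_fiber_of_mul_lt_card_of_maps_to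
      (s := A.erase x) (t := Finset.range c) (f := fun y => col x y) (n := T)
      (fun y _ => Finset.mem_range.2 (hcol x y))
      (by rw [Finset.card_erase_of_mem hxA, Finset.card_range]; omega)
    obtain ⟨B, hB, hBc, h, hh, hB2⟩ := hT col hcol _ hk2.le
    have hBx : ∀ y ∈ B, x < y ∧ y ∈ A ∧ col x y = k := by
      intro y hy
      have := hB hy
      simp only [Finset.mem_filter, Finset.mem_erase] at this
      exact ⟨lt_of_le_of_ne (A.min'_le y this.1.2) (Ne.symm this.1.1), this.1.2, this.2⟩
    have hxB : x ∉ B := fun h => lt_irrefl _ (hBx x h).1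
    refine ⟨insert x B, Finset.insert_subset hxA (fun y hy => (hBx y hy).2.1),
      by rw [Finset.card_insert_of_notMem hxB, hBc], Function.update h x k, ?_, ?_⟩
    · intro y
      by_cases hy : y = x
      · subst hy; simp at hk ⊢; omega
      · rw [Function.update_of_ne hy]; exact hh y
    · intro y hy z hz hyz
      rcases Finset.mem_insert.1 hy with rfl | hy
      · rcases Finset.mem_insert.1 hz with rfl | hz
        · exact absurd hyz (lt_irrefl _)
        · simpa using (hBx z hz).2.2
      · have hyx := (hBx y hy).1
        rcases Finset.mem_insert.1 hz with rfl | hz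
        · omega
        · rw [Function.update_of_ne hyx.ne']; exact hB2 y hy z hz hyz

lemma nd_ramsey (c t : ℕ) (hc : 0 < c) : ∃ T : ℕ, ∀ (col : Fin T → Fin T → ℕ),
    (∀ i j, col i j < c) → ∃ (g : Fin t → Fin T) (l : ℕ), StrictMono g ∧
      ∀ i j, i < j → col (g i) (g j) = l := by
  obtain ⟨T, hT⟩ := nd_endhom c ((c+1) * t + 1)
  refine ⟨T, fun col hcol => ?_⟩
  obtain ⟨B, hB, hBc, h, hh, hB2⟩ := hT
    (fun i j => if hij : i < T ∧ j < T then col ⟨i, hij.1⟩ ⟨j, hij.2⟩ else 0)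
    (by intro i j; split_ifs; exacts [hcol _ _, hc]) (Finset.range T) (by simp)
  obtain ⟨k, hk, hk2⟩ := Finset.exists_lt_card_fiber_of_mul_lt_card_of_maps_to
      (s := B) (t := Finset.range (c+1)) (f := h) (n := t)
      (fun y _ => Finset.mem_range.2 (hh y))
      (by rw [hBc, Finset.card_range]; omega)
  obtain ⟨B', hB', hB'c⟩ := Finset.exists_subset_card_eq hk2.le
  have hmem : ∀ i, B'.orderEmbOfFin hB'c i ∈ B ∧ h (B'.orderEmbOfFin hB'c i) = k := fun i => by
    have := hB' (B'.orderEmbOfFin_mem hB'c i)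
    simpa using this
  have hlt : ∀ i, B'.orderEmbOfFin hB'c i < T := fun i => Finset.mem_range.1 (hB (hmem i).1)
  refine ⟨fun i => ⟨B'.orderEmbOfFin hB'c i, hlt i⟩, k, ?_, ?_⟩
  · intro i j hij
    exact Fin.mk_lt_mk.2 ((B'.orderEmbOfFin hB'c).strictMono hij)
  · intro i j hij
    have := hB2 _ (hmem i).1 _ (hmem j).1 ((B'.orderEmbOfFin hB'c).strictMono hij)
    rw [dif_pos ⟨hlt i, hlt j⟩, (hmem i).2] at this
    exact this

lemma nd_contains {n N l : ℕ} (G : SimpleGraph (Fin n)) (s : Fin N → Fin n)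
    (hs : Function.Injective s) (p : ∀ i j, G.Walk (s i) (s j))
    (hp : ∀ i j, i < j → (p i j).IsPath ∧ (p i j).length = l + 1)
    (U : Fin N × Fin N → Finset (Fin n))
    (hU : ∀ i j, i < j → ∀ x ∈ (p i j).support, x = s i ∨ x = s j ∨ x ∈ U (i, j))
    (hUd : ∀ e e', e ≠ e' → Disjoint (U e) (U e')) (hUs : ∀ e k, s k ∉ U e) :
    ContainsSubgraph (subdivClique l N) G := by
  have hInner : ∀ i j, i < j → ∀ k, k < l → (p i j).getVert (k+1) ∈ U (i, j) := by
    intro i j hij k hk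
    obtain ⟨h1, h2⟩ := hp i j hij
    rcases hU i j hij _ ((p i j).getVert_mem_support (k+1)) with h | h | h
    · have := (h1.getVert_eq_start_iff (i := k+1) (by omega)).1 h
      omega
    · have := (h1.getVert_eq_end_iff (i := k+1) (by omega)).1 h
      omega
    · exact h
  let f : SubVert l N → Fin n := fun u => match u with
    | Sum.inl i => s i
    | Sum.inr (e, t) => (p e.1.1 e.1.2).getVert (t + 1)
  have hadj0 : ∀ i j, i < j → ∀ k, k < l + 1 → G.Adj ((p i j).getVert k) ((p i j).getVert (k+1)) := by
    intro i j hij k hk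
    exact (p i j).adj_getVert_succ (by rw [(hp i j hij).2]; exact hk)
  refine ⟨f, ?_, ?_⟩
  · rintro (i | ⟨⟨⟨i, j⟩, hij⟩, t⟩) (i' | ⟨⟨⟨i', j'⟩, hij'⟩, t'⟩) h
    · exact congrArg _ (hs h)
    · exact absurd (hInner i' j' hij' t' t'.2) (by rw [← show s i = (p i' j').getVert (t'+1) from h]; exact hUs _ _)
    · exact absurd (hInner i j hij t t.2) (by rw [show (p i j).getVert (t+1) = s i' from h]; exact hUs _ _)
    · have h1 := hInner i j hij t t.2
      have h2 := hInner i' j' hij' t' t'.2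
      rw [← show (p i j).getVert (t+1) = (p i' j').getVert (t'+1) from h] at h2
      by_cases he : (i, j) = (i', j')
      · obtain ⟨rfl, rfl⟩ := Prod.mk.inj he
        have := (hp i j hij).1.getVert_injOn (by simp [(hp i j hij).2])
          (by simp [(hp i j hij).2]) (show (p i j).getVert (t+1) = (p i j).getVert (t'+1) from h)
        have ht : t = t' := by ext; omega
        rw [ht]
      · exact absurd h2 (Finset.disjoint_left.1 (hUd _ _ he) h1)
  · have key : ∀ u v : SubVert l N, (match u, v with
        | Sum.inl i, Sum.inl j => l = 0 ∧ i ≠ j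
        | Sum.inl i, Sum.inr (e, t) => (i = e.1.1 ∧ (t : ℕ) = 0) ∨ (i = e.1.2 ∧ (t : ℕ) + 1 = l)
        | Sum.inr (e, t), Sum.inr (e', t') => e = e' ∧ (t' : ℕ) = (t : ℕ) + 1
        | _, _ => False) → G.Adj (f u) (f v) := by
      rintro (i | ⟨⟨⟨i, j⟩, hij⟩, t⟩) (i' | ⟨⟨⟨i', j'⟩, hij'⟩, t'⟩) h
      · obtain ⟨rfl, hne⟩ := h
        have base : ∀ i j, i < j → G.Adj (s i) (s j) := fun i j hij => by
          have := hadj0 i j hij 0 (by omega)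
          rw [(p i j).getVert_zero, (p i j).getVert_of_length_le (by rw [(hp i j hij).2])] at this
          exact this
        rcases lt_or_gt_of_ne hne with h | h
        · exact base _ _ h
        · exact (base _ _ h).symm
      · rcases h with ⟨h1, h2⟩ | ⟨h1, h2⟩
        · dsimp only at h1
          subst h1
          have := hadj0 i j' hij' 0 (by omega)
          rw [(p i j').getVert_zero] at this
          show G.Adj (s i) ((p i j').getVert (t'+1))
          rw [h2]; exact this
        · dsimp only at h1
          subst h1
          have := hadj0 i' i hij' l (by omega)
          rw [(p i' i).getVert_of_length_le (i := l+1) (by rw [(hp i' i hij').2])] at this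
          show G.Adj (s i) ((p i' i).getVert (t'+1))
          rw [h2]; exact this.symm
      · exact h.elim
      · obtain ⟨h1, h2⟩ := h
        obtain ⟨rfl, rfl⟩ := Prod.mk.inj (Subtype.mk.inj h1)
        show G.Adj ((p i j).getVert (t+1)) ((p i j).getVert (t'+1))
        rw [h2]
        exact hadj0 i j hij (t+1) (by omega)
    intro u v huv
    rw [subdivClique, SimpleGraph.fromRel_adj] at huv
    rcases u with (i | ⟨e, t⟩) <;> rcases v with (i' | ⟨e', t'⟩) <;> rcases huv.2 with h | h
    · exact key (Sum.inl i) (Sum.inl i') h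
    · exact (key (Sum.inl i') (Sum.inl i) h).symm
    · exact key (Sum.inl i) (Sum.inr (e', t')) h
    · exact (key (Sum.inr (e', t')) (Sum.inl i) h).symm
    · exact key (Sum.inr (e, t)) (Sum.inl i') h
    · exact (key (Sum.inl i') (Sum.inr (e, t)) h).symm
    · exact key (Sum.inr (e, t)) (Sum.inr (e', t')) h
    · exact (key (Sum.inr (e', t')) (Sum.inr (e, t)) h).symm

/-- A fan of walks of length at most `r` from `v` to all vertices of `A`. -/
def NDFan {n : ℕ} (G : SimpleGraph (Fin n)) (r : ℕ) (v : Fin n) (A : Finset (Fin n))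
    (L : Fin n → Finset (Fin n)) : Prop :=
  (∀ a ∈ A, (L a).card ≤ r ∧ ∃ w : G.Walk v a, w.length ≤ r ∧ ∀ x ∈ w.support, x = v ∨ x ∈ L a) ∧
  ∀ a ∈ A, ∀ b ∈ A, a ≠ b → Disjoint (L a) (L b)

def NDNear {n : ℕ} (G : SimpleGraph (Fin n)) (S : Finset (Fin n)) (d : ℕ) (x a : Fin n) : Prop :=
  ∃ w : G.Walk x a, w.length ≤ d ∧ ∀ y ∈ w.support, y ∉ S

open Classical in
lemma nd_ball (q : ℕ) : ∀ d : ℕ, ∃ b : ℕ, ∀ (n : ℕ) (G : SimpleGraph (Fin n)) (S A : Finset (Fin n)),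
    (∃ v, v ∉ S ∧ ∃ A' ⊆ A, q ≤ A'.card ∧ v ∉ A' ∧ ∃ L, NDFan G d v A' L) ∨
    ∀ x, (A.filter (fun a => NDNear G S d x a)).card ≤ b := by
  intro d
  induction d with
  | zero =>
    refine ⟨1, fun n G S A => Or.inr fun x => ?_⟩
    refine Finset.card_le_one.2 fun a ha b hb => ?_
    have : ∀ a ∈ (A.filter (fun a => NDNear G S 0 x a)), x = a := by
      intro a ha
      obtain ⟨w, hw, -⟩ := (Finset.mem_filter.1 ha).2
      exact SimpleGraph.Walk.eq_of_length_eq_zero (Nat.le_zero.1 hw)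
    rw [← this a ha, ← this b hb]
  | succ d ih =>
    obtain ⟨b, hb⟩ := ih
    refine ⟨(0 + (q+1) * (d+1)) * b + (q+1), fun n G S A => ?_⟩
    rcases hb n G S A with ⟨v, hv, A', hA', hq, hvA, L, hL⟩ | hball
    · refine Or.inl ⟨v, hv, A', hA', hq, hvA, L, fun a ha => ?_, hL.2⟩
      obtain ⟨h1, w, hw, h2⟩ := hL.1 a ha
      exact ⟨by omega, w, by omega, h2⟩
    by_cases hall : ∀ x, (A.filter (fun a => NDNear G S (d+1) x a)).card ≤ (0 + (q+1) * (d+1)) * b + (q+1)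
    · exact Or.inr hall
    left
    push Not at hall
    obtain ⟨v, hv⟩ := hall
    have hch : ∀ a, ∃ L : Finset (Fin n), NDNear G S (d+1) v a → (L.card ≤ d + 1 ∧ v ∉ L ∧
        (∃ w : G.Walk v a, w.length ≤ d+1 ∧ ∀ x ∈ w.support, x = v ∨ x ∈ L) ∧
        ∀ x ∈ L, NDNear G S d x a) := by
      intro a
      by_cases h : NDNear G S (d+1) v a
      · obtain ⟨w, hw, hwS⟩ := h
        refine ⟨w.support.toFinset.erase v, fun _ => ⟨?_, by simp, ⟨w, hw, ?_⟩, ?_⟩⟩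
        · rw [Finset.card_erase_of_mem (by simp)]
          have := w.support.toFinset_card_le
          rw [w.length_support] at this
          omega
        · intro x hx
          by_cases hxv : x = v
          · exact Or.inl hxv
          · exact Or.inr (by simp [hxv, hx])
        · intro x hx
          simp only [Finset.mem_erase, List.mem_toFinset] at hx
          refine ⟨w.dropUntil x hx.2, ?_, fun y hy => hwS y (w.support_dropUntil_subset_support hx.2 hy)⟩
          have h1 := congrArg SimpleGraph.Walk.length (w.take_spec hx.2)
          rw [SimpleGraph.Walk.length_append] at h1
          have h2 : (w.takeUntil x hx.2).length ≠ 0 := fun h0 =>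
            hx.1 (SimpleGraph.Walk.eq_of_length_eq_zero h0).symm
          omega
      · exact ⟨∅, fun h' => absurd h' h⟩
    choose L hL using hch
    obtain ⟨A', hA', hq, -, hdis⟩ := nd_thin L (d+1) b (q+1) (A.filter (fun a => NDNear G S (d+1) v a)) (∅ : Finset (Fin n))
      (fun a ha => (hL a (Finset.mem_filter.1 ha).2).1)
      (fun x => by
        refine (Finset.card_le_card ?_).trans (hball x)
        intro a ha
        simp only [Finset.mem_filter] at ha ⊢
        exact ⟨ha.1.1, (hL a ha.1.2).2.2.2 x ha.2⟩)
      (by rw [Finset.card_empty]; exact hv.le)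
    have hmem : ∀ a ∈ A', a ∈ A ∧ NDNear G S (d+1) v a := fun a ha => Finset.mem_filter.1 (hA' ha)
    refine ⟨v, ?_, A'.erase v, fun a ha => (hmem a (Finset.mem_of_mem_erase ha)).1, ?_, by simp, L, ?_, ?_⟩
    · obtain ⟨a, ha⟩ : A'.Nonempty := Finset.card_pos.1 (by omega)
      obtain ⟨w, -, hw⟩ := (hmem a ha).2
      exact hw v w.start_mem_support
    · have := Finset.pred_card_le_card_erase (s := A') (a := v)
      omega
    · intro a ha
      have := hL a (hmem a (Finset.mem_of_mem_erase ha)).2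
      exact ⟨this.1, this.2.2.1⟩
    · intro a ha b hb hab
      exact hdis a (Finset.mem_of_mem_erase ha) b (Finset.mem_of_mem_erase hb) hab

def NDBroken {n : ℕ} (G : SimpleGraph (Fin n)) (r m : ℕ) (W S : Finset (Fin n)) : Prop :=
  ∃ A B : Finset (Fin n), A ⊆ W \ S ∧ B ⊆ W \ S ∧ m ≤ A.card ∧ m ≤ B.card ∧
            ∀ a ∈ A, ∀ b ∈ B, ∀ p : G.Walk a b, (∀ x ∈ p.support, x ∉ S) → r < p.length

open Classical in
lemma nd_step (r m q : ℕ) : ∃ F : ℕ, ∀ (n : ℕ) (G : SimpleGraph (Fin n)) (S A : Finset (Fin n)),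
    Disjoint A S → F ≤ A.card → NDBroken G r m A S ∨
    (∃ v, v ∉ S ∧ ∃ A' ⊆ A, q ≤ A'.card ∧ v ∉ A' ∧ ∃ L, NDFan G r v A' L) := by
  obtain ⟨b, hb⟩ := nd_ball q r
  refine ⟨m * b + m, fun n G S A hAS hA => ?_⟩
  rcases hb n G S A with h | h
  · exact Or.inr h
  left
  obtain ⟨A0, hA0, hA0c⟩ := Finset.exists_subset_card_eq (show m ≤ A.card by omega)
  have hbad : (A0.biUnion (fun x => A.filter (fun a => NDNear G S r x a))).card ≤ m * b := by
    rw [← hA0c]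
    exact Finset.card_biUnion_le_card_mul _ _ _ (fun x _ => h x)
  refine ⟨A0, A \ (A0.biUnion (fun x => A.filter (fun a => NDNear G S r x a))), ?_, ?_, hA0c.ge, ?_, ?_⟩
  · rw [Finset.sdiff_eq_self_of_disjoint hAS]; exact hA0
  · rw [Finset.sdiff_eq_self_of_disjoint hAS]; exact Finset.sdiff_subset
  · have := Finset.le_card_sdiff (A0.biUnion (fun x => A.filter (fun a => NDNear G S r x a))) A
    omega
  · intro x hx a ha p hp
    by_contra hlt
    rw [Finset.mem_sdiff] at ha
    exact ha.2 (Finset.mem_biUnion.2 ⟨x, hx, Finset.mem_filter.2 ⟨ha.1, p, by omega, hp⟩⟩)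

lemma nd_main (r m : ℕ) : ∀ T q : ℕ, ∃ N : ℕ, ∀ (n : ℕ) (G : SimpleGraph (Fin n)) (W : Finset (Fin n)),
    N ≤ W.card → (∃ S : Finset (Fin n), S.card ≤ T ∧ NDBroken G r m W S) ∨
    ∃ S : Finset (Fin n), S.card = T ∧ ∃ A ⊆ W, Disjoint A S ∧ q ≤ A.card ∧
      ∃ L : Fin n → Fin n → Finset (Fin n), ∀ v ∈ S, NDFan G r v A (L v) := by
  intro T
  induction T with
  | zero =>
    intro q
    exact ⟨q, fun n G W hW => Or.inr ⟨∅, rfl, W, subset_rfl, by simp, hW, fun _ _ => ∅, by simp⟩⟩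
  | succ T ih =>
    intro q
    obtain ⟨F, hF⟩ := nd_step r m q
    obtain ⟨N, hN⟩ := ih F
    refine ⟨N, fun n G W hW => ?_⟩
    rcases hN n G W hW with ⟨S, hS, h⟩ | ⟨S, hS, A, hA, hAS, hAc, L, hL⟩
    · exact Or.inl ⟨S, by omega, h⟩
    rcases hF n G S A hAS hAc with ⟨A0, B0, h1, h2, h3⟩ | ⟨v, hv, A', hA', hq, hvA, L', hL'⟩
    · exact Or.inl ⟨S, by omega, A0, B0, h1.trans (Finset.sdiff_subset_sdiff hA subset_rfl),
        h2.trans (Finset.sdiff_subset_sdiff hA subset_rfl), h3⟩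
    · refine Or.inr ⟨insert v S, by rw [Finset.card_insert_of_notMem hv, hS], A', hA'.trans hA, ?_, hq,
        Function.update L v L', ?_⟩
      · rw [Finset.disjoint_insert_right]
        exact ⟨hvA, Finset.disjoint_of_subset_left hA' hAS⟩
      · intro u hu
        by_cases huv : u = v
        · subst huv; simpa using hL'
        · rw [Function.update_of_ne huv]
          have := hL u (by simpa [huv] using hu)
          exact ⟨fun a ha => this.1 a (hA' ha), fun a ha b hb => this.2 a (hA' ha) b (hA' hb)⟩

open Classical in
/-- Disjoint connections between all pairs of hubs. -/
lemma nd_connect {n : ℕ} (G : SimpleGraph (Fin n)) (r T : ℕ) (S A : Finset (Fin n))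
    (L : Fin n → Fin n → Finset (Fin n)) (hS : S.card = T)
    (hA : (T + T * T * (T * r)) * T + T * T ≤ A.card) (hL : ∀ v ∈ S, NDFan G r v A (L v)) :
    ∃ (s : Fin T → Fin n) (p : ∀ i j, G.Walk (s i) (s j)) (U : Fin T × Fin T → Finset (Fin n)),
      Function.Injective s ∧ (∀ i j, (p i j).IsPath ∧ (p i j).length ≤ 2 * r) ∧
      (∀ i j, ∀ x ∈ (p i j).support, x = s i ∨ x = s j ∨ x ∈ U (i, j)) ∧
      (∀ e e', e ≠ e' → Disjoint (U e) (U e')) ∧ ∀ e k, s k ∉ U e := by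
  obtain ⟨A', hA', hq, hZ, hdis⟩ := nd_thin (fun a => S.biUnion (fun v => L v a)) (T * r) T (T * T) A S
    (fun a ha => by
      rw [← hS]
      exact Finset.card_biUnion_le_card_mul _ _ _ (fun v hv => ((hL v hv).1 a ha).1))
    (fun x => by
      have : A.filter (fun a => x ∈ S.biUnion (fun v => L v a)) ⊆ S.biUnion (fun v => A.filter (fun a => x ∈ L v a)) := by
        intro a ha
        simp only [Finset.mem_filter, Finset.mem_biUnion] at ha ⊢
        obtain ⟨ha, v, hv, hx⟩ := ha
        exact ⟨v, hv, ha, hx⟩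
      have h2 : (S.biUnion (fun v => A.filter (fun a => x ∈ L v a))).card ≤ S.card * 1 := by
        refine Finset.card_biUnion_le_card_mul _ _ 1 ?_
        intro v hv
        refine Finset.card_le_one.2 fun a ha b hb => ?_
        rw [Finset.mem_filter] at ha hb
        by_contra hab
        exact Finset.disjoint_left.1 ((hL v hv).2 a ha.1 b hb.1 hab) ha.2 hb.2
      have h3 := Finset.card_le_card this
      rw [mul_one, hS] at h2
      convert Nat.le_trans h3 h2)
    (by rw [hS]; exact hA)
  let eS : Fin T ≃ S := (S.equivFinOfCardEq hS).symm
  let eA : Fin T × Fin T ≃ A' := finProdFinEquiv.trans (A'.equivFinOfCardEq hq).symm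
  have hw : ∀ i j, ∃ p : G.Walk (eS i : Fin n) (eS j : Fin n), (p.IsPath ∧ p.length ≤ 2 * r) ∧
      ∀ x ∈ p.support, x = eS i ∨ x = eS j ∨ x ∈ S.biUnion (fun v => L v (eA (i, j))) := by
    intro i j
    have ha : (eA (i, j) : Fin n) ∈ A := hA' (eA (i,j)).2
    obtain ⟨-, w1, h1, h1'⟩ := (hL _ (eS i).2).1 _ ha
    obtain ⟨-, w2, h2, h2'⟩ := (hL _ (eS j).2).1 _ ha
    refine ⟨(w1.append w2.reverse).bypass, ⟨SimpleGraph.Walk.bypass_isPath _, ?_⟩, ?_⟩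
    · refine (SimpleGraph.Walk.length_bypass_le_length _).trans ?_
      rw [SimpleGraph.Walk.length_append, SimpleGraph.Walk.length_reverse]; omega
    · intro x hx
      have := SimpleGraph.Walk.support_bypass_subset_support _ hx
      rw [SimpleGraph.Walk.mem_support_append_iff, SimpleGraph.Walk.support_reverse, List.mem_reverse] at this
      rcases this with h | h
      · rcases h1' x h with h | h
        · exact Or.inl h
        · exact Or.inr (Or.inr (Finset.mem_biUnion.2 ⟨_, (eS i).2, h⟩))
      · rcases h2' x h with h | h
        · exact Or.inr (Or.inl h)
        · exact Or.inr (Or.inr (Finset.mem_biUnion.2 ⟨_, (eS j).2, h⟩))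
  choose p hp hp2 using hw
  refine ⟨fun i => eS i, p, fun e => S.biUnion (fun v => L v (eA e)),
    Subtype.val_injective.comp eS.injective, hp, hp2, ?_, ?_⟩
  · intro e e' hee
    exact hdis _ (eA e).2 _ (eA e').2 (fun h => hee (eA.injective (Subtype.ext h)))
  · intro e k hk
    exact Finset.disjoint_left.1 (hZ _ (eA e).2) hk (eS k).2

lemma nd_forward (C : GraphClass) (hC : NowhereDense C) : DeletionBreakable C := by
  intro r
  choose N hN using hC
  obtain ⟨T, hT⟩ := nd_ramsey (2 * r + 1) ((Finset.range (2 * r + 1)).sup N + 2) (by omega)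
  choose Nf hNf using fun m => nd_main r m T ((T + T * T * (T * r)) * T + T * T)
  refine ⟨Nf, T, fun m n G hG W hW => ?_⟩
  rcases hNf m n G W hW with h | ⟨S, hS, A, -, -, hA, L, hL⟩
  · exact h
  exfalso
  obtain ⟨s, p, U, hs, hp, hpU, hUd, hUs⟩ := nd_connect G r T S A L hS hA hL
  obtain ⟨g, l, hg, hgl⟩ := hT (fun i j => (p i j).length) (fun i j => by have := (hp i j).2; omega)
  have hl0 : l ≠ 0 := by
    intro h0
    have h1 : (⟨0, by omega⟩ : Fin ((Finset.range (2 * r + 1)).sup N + 2)) < ⟨1, by omega⟩ := by simp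
    have h2 := hgl _ _ h1
    rw [h0] at h2
    exact (hg h1).ne (hs (SimpleGraph.Walk.eq_of_length_eq_zero h2))
  have hl1 : l ≤ 2 * r := by
    have h1 : (⟨0, by omega⟩ : Fin ((Finset.range (2 * r + 1)).sup N + 2)) < ⟨1, by omega⟩ := by simp
    rw [← hgl _ _ h1]
    exact (hp _ _).2
  obtain ⟨l, rfl⟩ := Nat.exists_eq_succ_of_ne_zero hl0
  have hle : N l ≤ (Finset.range (2 * r + 1)).sup N + 2 := by
    have := Finset.le_sup (f := N) (Finset.mem_range.2 (show l < 2 * r + 1 by omega))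
    omega
  let g' : Fin (N l) → Fin T := fun i => g (Fin.castLE hle i)
  have hg' : StrictMono g' := fun i j hij => hg (by simpa using hij)
  refine hN l n G hG (nd_contains G (fun i => s (g' i)) (hs.comp hg'.injective)
    (fun i j => p (g' i) (g' j)) ?_ (fun e => U (g' e.1, g' e.2)) ?_ ?_ ?_)
  · intro i j hij
    exact ⟨(hp _ _).1, hgl _ _ (by simpa using hij)⟩
  · intro i j _ x hx
    exact hpU _ _ x hx
  · intro e e' hee
    refine hUd _ _ fun h => hee ?_
    have := Prod.mk.inj h
    exact Prod.ext (hg'.injective this.1) (hg'.injective this.2)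
  · intro e k
    exact hUs _ _

/-- The walk along a subdivided edge. -/
lemma nd_edge_walk {n r N : ℕ} (G : SimpleGraph (Fin n)) (f : SubVert r N → Fin n)
    (hf : ∀ u v, (subdivClique r N).Adj u v → G.Adj (f u) (f v))
    (e : {p : Fin N × Fin N // p.1 < p.2}) :
    ∃ w : G.Walk (f (Sum.inl e.1.1)) (f (Sum.inl e.1.2)), w.length ≤ r + 1 ∧
      ∀ x ∈ w.support, x = f (Sum.inl e.1.1) ∨ x = f (Sum.inl e.1.2) ∨ ∃ t, x = f (Sum.inr (e, t)) := by
  have hne : e.1.1 ≠ e.1.2 := e.2.ne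
  rcases Nat.eq_zero_or_pos r with hr | hr
  · have h : G.Adj (f (Sum.inl e.1.1)) (f (Sum.inl e.1.2)) := by
      apply hf
      rw [subdivClique, SimpleGraph.fromRel_adj]
      exact ⟨fun h => hne (Sum.inl.inj h), Or.inl ⟨hr, hne⟩⟩
    refine ⟨SimpleGraph.Walk.cons h SimpleGraph.Walk.nil, by simp, ?_⟩
    intro x hx
    simp at hx
    tauto
  · have key : ∀ k (hk : k < r), ∃ w : G.Walk (f (Sum.inl e.1.1)) (f (Sum.inr (e, ⟨k, hk⟩))), w.length ≤ k + 1 ∧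
      ∀ x ∈ w.support, x = f (Sum.inl e.1.1) ∨ ∃ t, x = f (Sum.inr (e, t)) := by
      intro k
      induction k with
      | zero =>
        intro hk
        have h : G.Adj (f (Sum.inl e.1.1)) (f (Sum.inr (e, ⟨0, hk⟩))) := by
          apply hf
          rw [subdivClique, SimpleGraph.fromRel_adj]
          exact ⟨by simp, Or.inl (Or.inl ⟨rfl, rfl⟩)⟩
        refine ⟨SimpleGraph.Walk.cons h SimpleGraph.Walk.nil, by simp, ?_⟩
        intro x hx
        simp at hx
        rcases hx with h | h
        · exact Or.inl h
        · exact Or.inr ⟨_, h⟩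
      | succ k ih =>
        intro hk
        obtain ⟨w, hw, hw2⟩ := ih (by omega)
        have h : G.Adj (f (Sum.inr (e, ⟨k, by omega⟩))) (f (Sum.inr (e, ⟨k+1, hk⟩))) := by
          apply hf
          rw [subdivClique, SimpleGraph.fromRel_adj]
          exact ⟨by simp, Or.inl ⟨rfl, rfl⟩⟩
        refine ⟨w.concat h, by simpa using hw, ?_⟩
        intro x hx
        simp [SimpleGraph.Walk.support_concat] at hx
        rcases hx with h | h
        · exact hw2 x h
        · exact Or.inr ⟨_, h⟩
    obtain ⟨w, hw, hw2⟩ := key (r - 1) (by omega)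
    have h : G.Adj (f (Sum.inr (e, ⟨r - 1, by omega⟩))) (f (Sum.inl e.1.2)) := by
      apply SimpleGraph.Adj.symm
      apply hf
      rw [subdivClique, SimpleGraph.fromRel_adj]
      exact ⟨by simp, Or.inl (Or.inr ⟨rfl, by simp; omega⟩)⟩
    refine ⟨w.concat h, by simp; omega, ?_⟩
    intro x hx
    simp [SimpleGraph.Walk.support_concat] at hx
    rcases hx with h | h
    · rcases hw2 x h with h | h
      · exact Or.inl h
      · exact Or.inr (Or.inr h)
    · exact Or.inr (Or.inl h)

lemma nd_backward (C : GraphClass) (hC : DeletionBreakable C) : NowhereDense C := by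
  classical
  intro r
  obtain ⟨Nf, k, hk⟩ := hC (r + 1)
  refine ⟨Nf (k + 1), fun n G hG hcon => ?_⟩
  obtain ⟨f, hinj, hf⟩ := hcon
  obtain ⟨S, hS, A, B, hA, hB, hAc, hBc, hsep⟩ := hk (k+1) n G hG
    (Finset.univ.image (fun i => f (Sum.inl i)))
    (by rw [Finset.card_image_of_injective _ (fun i j h => Sum.inl_injective (hinj h))]; simp)
  obtain ⟨a, ha⟩ : A.Nonempty := Finset.card_pos.1 (by omega)
  have hpr : ∀ x ∈ (Finset.univ.image (fun i => f (Sum.inl i))) \ S, ∃ i, x = f (Sum.inl i) ∧ x ∉ S := by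
    intro x hx
    simp only [Finset.mem_sdiff, Finset.mem_image, Finset.mem_univ, true_and] at hx
    obtain ⟨⟨i, hi⟩, h⟩ := hx
    exact ⟨i, hi.symm, h⟩
  obtain ⟨i, hi, haS⟩ := hpr a (hA ha)
  have hex : ∀ b ∈ B, ∃ s ∈ S, ∃ j, b = f (Sum.inl j) ∧ ∃ e t, s = f (Sum.inr (e, t)) ∧
      ((e.1.1 = i ∧ e.1.2 = j) ∨ (e.1.1 = j ∧ e.1.2 = i)) := by
    intro b hb
    obtain ⟨j, hj, hbS⟩ := hpr b (hB hb)
    have hij : i ≠ j := by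
      rintro rfl
      subst hi; subst hj
      have := hsep _ ha _ hb SimpleGraph.Walk.nil (by simpa using haS)
      simp at this
    by_contra hno
    push Not at hno
    subst hi; subst hj
    rcases lt_or_gt_of_ne hij with h | h
    · obtain ⟨w, hw, hw2⟩ := nd_edge_walk G f hf ⟨(i, j), h⟩
      refine absurd (hsep _ ha _ hb w ?_) (by omega)
      intro x hx hxS
      rcases hw2 x hx with h' | h' | ⟨t, h'⟩
      · exact haS (h' ▸ hxS)
      · exact hbS (h' ▸ hxS)
      · exact (hno x hxS j rfl _ t h').1 rfl rfl
    · obtain ⟨w, hw, hw2⟩ := nd_edge_walk G f hf ⟨(j, i), h⟩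
      refine absurd (hsep _ ha _ hb w.reverse ?_) (by rw [SimpleGraph.Walk.length_reverse]; omega)
      intro x hx hxS
      rw [SimpleGraph.Walk.support_reverse, List.mem_reverse] at hx
      rcases hw2 x hx with h' | h' | ⟨t, h'⟩
      · exact hbS (h' ▸ hxS)
      · exact haS (h' ▸ hxS)
      · exact (hno x hxS j rfl _ t h').2 rfl rfl
  choose! φ hφS hφ using hex
  have hcard : B.card ≤ S.card := by
    refine Finset.card_le_card_of_injOn φ hφS ?_
    intro b hb b' hb' hbb
    obtain ⟨j, hj, e, t, he, h⟩ := hφ b hb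
    obtain ⟨j', hj', e', t', he', h'⟩ := hφ b' hb'
    rw [he, he'] at hbb
    have := hinj hbb
    simp only [Sum.inr.injEq, Prod.mk.injEq] at this
    obtain ⟨rfl, rfl⟩ := this
    have hjj : j = j' := by
      rcases h with ⟨h1, h2⟩ | ⟨h1, h2⟩ <;> rcases h' with ⟨h3, h4⟩ | ⟨h3, h4⟩
      · rw [← h2, h4]
      · rw [← h2, h4, ← h1, h3]
      · rw [← h1, h3, ← h2, h4]
      · rw [← h1, h3]
    rw [hj, hj', hjj]
  omega

/-- A class of finite graphs is nowhere dense if and only if it is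
deletion-breakable. -/
theorem nowhereDense_iff_deletionBreakable (C : GraphClass) :
    NowhereDense C ↔ DeletionBreakable C := by
  exact ⟨nd_forward C, nd_backward C⟩
end

section
/- Let k, m ∈ ℕ, let G be a finite graph of rankwidth at most k, and let W ⊆ V(G) with |W| ≥ 4m. Then there exist disjoint sets A, B ⊆ W with |A|, |B| ≥ m and a (2^k + 2^(2^k))-flip H of G such that no vertex of A lies in the same connected component of H as a vertex of B. -/
set_option autoImplicit false

open scoped Classical in
/-- The cut-rank of the bipartition `(X, Xᶜ)` of the vertices of `G`: the rank over `GF(2)` of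
the `X × Xᶜ` adjacency matrix. -/
noncomputable def cutRank {V : Type} [Fintype V] (G : SimpleGraph V) (X : Set V) : ℕ :=
  (Matrix.of fun (x : X) (y : ↥Xᶜ) =>
    if G.Adj x.1 y.1 then (1 : ZMod 2) else 0).rank

/-- `G` has rankwidth at most `k`: there is a tree whose leaves are exactly the vertices of `G`
and whose internal nodes have degree at most `3`, such that for every tree edge the bipartition
of the leaves given by its two sides has cut-rank at most `k`. -/
def RankwidthLE {V : Type} [Fintype V] (G : SimpleGraph V) (k : ℕ) : Prop :=
  ∃ (m : ℕ) (T : SimpleGraph (Fin m)) (leaf : V → Fin m),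
    T.IsTree ∧ Function.Injective leaf ∧
    (∀ t : Fin m, (Set.ncard (T.neighborSet t) ≤ 1 ↔ t ∈ Set.range leaf)) ∧
    (∀ t : Fin m, t ∉ Set.range leaf → Set.ncard (T.neighborSet t) ≤ 3) ∧
    (∀ a b : Fin m, T.Adj a b →
      cutRank G {v : V | (T.deleteEdges {s(a, b)}).Reachable (leaf v) a} ≤ k)

namespace RWBreak

lemma exists_code {α M : Type} [AddCommGroup M] [Module (ZMod 2) M] [Finite M] (k : ℕ)
    (f : α → M) (h : Module.finrank (ZMod 2) (Submodule.span (ZMod 2) (Set.range f)) ≤ k) :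
    ∃ c : α → Fin (2 ^ k), ∀ x y, c x = c y → f x = f y := by
  classical
  let S := Submodule.span (ZMod 2) (Set.range f)
  have : Fintype S := Fintype.ofFinite _
  have hc : Fintype.card S ≤ Fintype.card (Fin (2 ^ k)) := by
    rw [Module.card_eq_pow_finrank (K := ZMod 2) (V := S), ZMod.card, Fintype.card_fin]
    exact Nat.pow_le_pow_right (by norm_num) h
  obtain ⟨e⟩ := Function.Embedding.nonempty_of_card_le hc
  refine ⟨fun x => e ⟨f x, Submodule.subset_span ⟨x, rfl⟩⟩, fun x y hxy => ?_⟩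
  have := e.injective hxy
  exact congrArg Subtype.val this

lemma exists_flip {V : Type} [Fintype V] (G : SimpleGraph V) (X : Set V) (k : ℕ)
    (h : cutRank G X ≤ k) :
    ∃ H : SimpleGraph V, IsKFlip (2 ^ k + 2 ^ 2 ^ k) G H ∧
      ∀ a ∈ X, ∀ b ∉ X, ¬ H.Reachable a b := by
  classical
  unfold cutRank at h
  set M : Matrix X ↥Xᶜ (ZMod 2) := Matrix.of fun (x : X) (y : ↥Xᶜ) =>
    if G.Adj x.1 y.1 then (1 : ZMod 2) else 0 with hM
  have hMM : ∀ (x : X) (y : ↥Xᶜ), M x y = if G.Adj x.1 y.1 then (1 : ZMod 2) else 0 :=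
    fun x y => rfl
  have h' : M.rank ≤ k := by convert h
  obtain ⟨r, hr⟩ := exists_code k M.row (by rwa [← Matrix.rank_eq_finrank_span_row])
  obtain ⟨c, hc⟩ := exists_code k M.col (by rwa [← Matrix.rank_eq_finrank_span_cols])
  have hle : 2 ^ k ≤ 2 ^ 2 ^ k :=
    Nat.pow_le_pow_right (by norm_num) (Nat.lt_two_pow_self).le
  let P : V → Fin (2 ^ k + 2 ^ 2 ^ k) := fun v =>
    if hv : v ∈ X then Fin.castAdd _ (r ⟨v, hv⟩)
    else Fin.natAdd _ (Fin.castLE hle (c ⟨v, hv⟩))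
  have hP1 : ∀ u v, P u = P v → (u ∈ X ↔ v ∈ X) := by
    intro u v huv
    by_cases hu : u ∈ X <;> by_cases hv : v ∈ X <;> simp [P, hu, hv, Fin.ext_iff] at huv ⊢
    · have := (r ⟨u, hu⟩).2; omega
    · have := (r ⟨v, hv⟩).2; omega
  have hPr : ∀ u v (hu : u ∈ X) (hv : v ∈ X), P u = P v → r ⟨u, hu⟩ = r ⟨v, hv⟩ := by
    intro u v hu hv huv
    simpa [P, hu, hv, Fin.ext_iff] using huv
  have hPc : ∀ u v (hu : u ∉ X) (hv : v ∉ X), P u = P v → c ⟨u, hu⟩ = c ⟨v, hv⟩ := by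
    intro u v hu hv huv
    simpa [P, hu, hv, Fin.ext_iff] using huv
  have key : ∀ u v u' v', u ∈ X → v ∉ X → P u = P u' → P v = P v' →
      (G.Adj u v ↔ G.Adj u' v') := by
    intro u v u' v' hu hv h1 h2
    have hu' := (hP1 _ _ h1).1 hu
    have hv' : v' ∉ X := fun h => hv ((hP1 _ _ h2).2 h)
    have e1 := congrFun (hr _ _ (hPr u u' hu hu' h1)) ⟨v, hv⟩
    have e2 := congrFun (hc _ _ (hPc v v' hv hv' h2)) ⟨u', hu'⟩
    simp only [Matrix.row, Matrix.col, Matrix.transpose_apply, hMM] at e1 e2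
    have e := e1.trans e2
    by_cases p : G.Adj u v <;> by_cases q : G.Adj u' v' <;> simp_all
  let F : Fin (2 ^ k + 2 ^ 2 ^ k) → Fin (2 ^ k + 2 ^ 2 ^ k) → Prop := fun i j =>
    ∃ u v, P u = i ∧ P v = j ∧ (u ∈ X ↔ v ∉ X) ∧ G.Adj u v
  have hF : Symmetric F := by
    rintro i j ⟨u, v, h1, h2, h3, h4⟩
    exact ⟨v, u, h2, h1, by tauto, h4.symm⟩
  have hFk : ∀ u v, u ∈ X → v ∉ X → (F (P u) (P v) ↔ G.Adj u v) := by
    intro u v hu hv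
    constructor
    · rintro ⟨u', v', h1, h2, h3, h4⟩
      exact (key u v u' v' hu hv h1.symm h2.symm).2 h4
    · intro h
      exact ⟨u, v, rfl, rfl, by tauto, h⟩
  let H : SimpleGraph V :=
    { Adj := fun u v => u ≠ v ∧ Xor' (G.Adj u v) (F (P u) (P v))
      symm := by
        refine ⟨fun u v ⟨h1, h2⟩ => ⟨h1.symm, ?_⟩⟩
        have e : F (P u) (P v) ↔ F (P v) (P u) := ⟨fun h => hF h, fun h => hF h⟩
        rw [G.adj_comm, ← e]
        exact h2
      loopless := ⟨fun u h => h.1 rfl⟩ }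
  refine ⟨H, ⟨P, F, hF, fun u v huv => ⟨fun h => h.2, fun h => ⟨huv, h⟩⟩⟩, ?_⟩
  have step : ∀ u v, H.Adj u v → u ∈ X → v ∈ X := by
    rintro u v ⟨_, h2⟩ hu
    by_contra hv
    have := hFk u v hu hv
    unfold Xor' Xor at h2
    exact h2.elim (fun q => q.2 (this.2 q.1)) (fun q => q.2 (this.1 q.1))
  rintro a ha b hb ⟨p⟩
  induction p with
  | nil => exact hb ha
  | cons hadj p ih => exact ih (step _ _ hadj ha) hb

variable {N : Type} (T : SimpleGraph N)

/-- the side of `b` after deleting the edge `ab`. -/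
def side (a b : N) : Set N := {x | (T.deleteEdges {s(a, b)}).Reachable x b}

variable {T}

lemma reach_del {a b x y : N} (p : T.Walk x y) (h : s(a, b) ∉ p.edges) :
    (T.deleteEdges {s(a, b)}).Reachable x y :=
  ⟨p.toDeleteEdge _ h⟩

lemma not_reach (hT : T.IsTree) {a b : N} (h : T.Adj a b) :
    ¬ (T.deleteEdges {s(a, b)}).Reachable a b := by
  have := (SimpleGraph.isAcyclic_iff_forall_adj_isBridge.1 hT.isAcyclic) h
  rw [SimpleGraph.isBridge_iff] at this
  first
    | exact this.2
    | exact this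

lemma side_cover (hT : T.IsTree) {b x : N} (h : x ≠ b) : ∃ c, T.Adj b c ∧ x ∈ side T b c := by
  classical
  obtain ⟨p, hp⟩ := (hT.connected.preconnected b x).exists_isPath
  cases p with
  | nil => exact absurd rfl h
  | @cons _ c _ hadj q =>
    refine ⟨c, hadj, ?_⟩
    rw [SimpleGraph.Walk.cons_isPath_iff] at hp
    exact (reach_del q (fun he => hp.2 (q.fst_mem_support_of_mem_edges he))).symm

lemma side_compl (hT : T.IsTree) {a b : N} (h : T.Adj a b) : side T b a = (side T a b)ᶜ := by
  classical
  ext x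
  simp only [side, Set.mem_setOf_eq, Set.mem_compl_iff]
  rw [show s(b, a) = s(a, b) from Sym2.eq_swap]
  constructor
  · intro h1 h2
    exact not_reach hT h (h1.symm.trans h2)
  · intro h1
    obtain ⟨p, hp⟩ := (hT.connected.preconnected b x).exists_isPath
    cases p with
    | nil => exact absurd (SimpleGraph.Reachable.refl _) h1
    | @cons _ c _ hadj q =>
      rw [SimpleGraph.Walk.cons_isPath_iff] at hp
      have hq : s(a, b) ∉ q.edges := fun he => hp.2 (q.snd_mem_support_of_mem_edges he)
      by_cases hc : c = a
      · subst hc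
        exact (reach_del q hq).symm
      · exfalso
        apply h1
        refine (reach_del (SimpleGraph.Walk.cons hadj q) ?_).symm
        rw [SimpleGraph.Walk.edges_cons, List.mem_cons]
        rintro (he | he)
        · rcases Sym2.eq_iff.1 he with ⟨h2, h3⟩ | ⟨h2, h3⟩
          · exact h.ne h2
          · exact hc h2.symm
        · exact hq he

lemma side_ssubset (hT : T.IsTree) {a b c : N} (hab : T.Adj a b) (hbc : T.Adj b c) (hca : c ≠ a) :
    side T b c ⊂ side T a b := by
  classical
  have hb : b ∉ side T b c := not_reach hT hbc
  refine ⟨fun x hx => ?_, fun h => hb (h (SimpleGraph.Reachable.refl _))⟩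
  obtain ⟨p⟩ := hx
  have hbp : b ∉ p.support := fun hm => hb ⟨p.dropUntil b hm⟩
  have h1 : (T.deleteEdges {s(a, b)}).Reachable x c := by
    refine reach_del (p.mapLe (SimpleGraph.deleteEdges_le _)) ?_
    intro he
    have := SimpleGraph.Walk.snd_mem_support_of_mem_edges _ he
    apply hbp
    simpa using this
  refine h1.trans (SimpleGraph.Adj.reachable ?_)
  rw [SimpleGraph.deleteEdges_adj]
  refine ⟨hbc.symm, ?_⟩
  simp only [Set.mem_singleton_iff, Sym2.eq_iff]
  rintro (⟨h2, _⟩ | ⟨_, h3⟩)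
  · exact hca h2
  · exact hab.ne h3.symm

open scoped Classical in
lemma exists_balanced {N V : Type} [Fintype N] {T : SimpleGraph N} (hT : T.IsTree) (leaf : V → N)
    (hinj : Function.Injective leaf)
    (h1 : ∀ t, Set.ncard (T.neighborSet t) ≤ 1 ↔ t ∈ Set.range leaf)
    (h3 : ∀ t, t ∉ Set.range leaf → Set.ncard (T.neighborSet t) ≤ 3)
    (W : Finset V) (m : ℕ) (hm : 0 < m) (hW : 4 * m ≤ W.card) :
    ∃ a b, T.Adj a b ∧ m ≤ (W.filter (fun v => leaf v ∈ side T b a)).card ∧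
      m ≤ (W.filter (fun v => leaf v ∉ side T b a)).card := by
  by_contra! hcon
  let w : N → N → ℕ := fun a b => (W.filter (fun v => leaf v ∈ side T a b)).card
  have hlight : ∀ a b, T.Adj a b → w a b < m ∨ w b a < m := by
    intro a b hab
    by_cases h : m ≤ w b a
    · left
      have := hcon a b hab h
      simp only [w]
      rw [side_compl hT hab.symm]
      simpa only [Set.mem_compl_iff] using this
    · right; omega
  -- an edge exists
  have hedge : ∃ p : N × N, T.Adj p.1 p.2 ∧ w p.2 p.1 < m := by
    obtain ⟨u, hu, v, hv, huv⟩ := Finset.one_lt_card.1 (show 1 < W.card by omega)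
    obtain ⟨c, hc, _⟩ := side_cover hT (hinj.ne huv)
    rcases hlight _ _ hc with h | h
    · exact ⟨(c, leaf v), hc.symm, h⟩
    · exact ⟨(leaf v, c), hc, h⟩
  obtain ⟨⟨a, b⟩, ⟨hab, hw⟩, hmin⟩ := (Set.toFinite {p : N × N | T.Adj p.1 p.2 ∧
    w p.2 p.1 < m}).exists_minimalFor (fun p => (side T p.1 p.2).ncard) _ hedge
  simp only at hab hw hmin
  have hall : ∀ c, T.Adj b c → w b c < m := by
    intro c hc
    by_cases hca : c = a
    · subst hca; exact hw
    · rcases hlight _ _ hc with h | h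
      · exact h
      · exfalso
        have hlt := Set.ncard_lt_ncard (side_ssubset hT hab hc hca) (Set.toFinite _)
        have := hmin (j := (b, c)) ⟨hc, h⟩ hlt.le
        simp only at this
        omega
  have hsub : W ⊆ (W.filter (fun v => leaf v = b)) ∪
      (T.neighborSet b).toFinset.biUnion (fun c => W.filter (fun v => leaf v ∈ side T b c)) := by
    intro v hv
    by_cases hvb : leaf v = b
    · simp [hv, hvb]
    · obtain ⟨c, hc, hx⟩ := side_cover hT hvb
      simp only [Finset.mem_union, Finset.mem_biUnion, Finset.mem_filter, Set.mem_toFinset]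
      exact Or.inr ⟨c, hc, hv, hx⟩
  have hcard := (Finset.card_le_card hsub).trans (Finset.card_union_le _ _)
  have hbi : ((T.neighborSet b).toFinset.biUnion
      (fun c => W.filter (fun v => leaf v ∈ side T b c))).card ≤
      (T.neighborSet b).toFinset.card * (m - 1) := by
    apply Finset.card_biUnion_le_card_mul
    intro c hc
    have := hall c (by simpa using hc)
    simp only [w] at this
    omega
  rw [← Set.ncard_eq_toFinset_card'] at hbi
  by_cases hb : b ∈ Set.range leaf
  · have hd := (h1 b).2 hb
    have h5 : (W.filter (fun v => leaf v = b)).card ≤ 1 := by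
      rw [Finset.card_le_one]
      intro x hx y hy
      simp only [Finset.mem_filter] at hx hy
      exact hinj (hx.2.trans hy.2.symm)
    have := Nat.mul_le_mul_right (m - 1) hd
    omega
  · have hd := h3 b hb
    have h5 : (W.filter (fun v => leaf v = b)).card = 0 := by
      rw [Finset.card_eq_zero, Finset.filter_eq_empty_iff]
      intro x _ hx
      exact hb ⟨x, hx⟩
    have := Nat.mul_le_mul_right (m - 1) hd
    omega

end RWBreak

/-- Let `G` be a finite graph of rankwidth at most `k` and `W ⊆ V(G)` with
`|W| ≥ 4m`.  Then there are disjoint `A, B ⊆ W` with `|A|, |B| ≥ m` and a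
`(2^k + 2^(2^k))`-flip `H` of `G` such that no vertex of `A` lies in the same connected
component of `H` as a vertex of `B`. -/
theorem rankwidth_distInfty_break (k m n : ℕ) (G : SimpleGraph (Fin n))
    (hG : RankwidthLE G k) (W : Finset (Fin n)) (hW : 4 * m ≤ W.card) :
    ∃ A B : Finset (Fin n), A ⊆ W ∧ B ⊆ W ∧ Disjoint A B ∧ m ≤ A.card ∧ m ≤ B.card ∧
      ∃ H : SimpleGraph (Fin n), IsKFlip (2 ^ k + 2 ^ 2 ^ k) G H ∧
        ∀ a ∈ A, ∀ b ∈ B, ¬ H.Reachable a b := by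
  classical
  rcases Nat.eq_zero_or_pos m with rfl | hm
  · refine ⟨∅, ∅, by simp, by simp, by simp, by simp, by simp, G, ?_, by simp⟩
    refine ⟨fun _ => ⟨0, by positivity⟩, fun _ _ => False, fun _ _ h => h, ?_⟩
    intro u v _
    simp [Xor', Xor]
  · obtain ⟨N, T, leaf, hT, hinj, h1, h3, hcut⟩ := hG
    obtain ⟨a, b, hab, hA, hB⟩ := RWBreak.exists_balanced hT leaf hinj h1 h3 W m hm hW
    obtain ⟨H, hH, hsep⟩ := RWBreak.exists_flip G _ k (hcut a b hab)
    have hmem : ∀ v, leaf v ∈ RWBreak.side T b a ↔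
        v ∈ {v | (T.deleteEdges {s(a, b)}).Reachable (leaf v) a} := by
      intro v
      simp only [RWBreak.side, Set.mem_setOf_eq]
      rw [show s(b, a) = s(a, b) from Sym2.eq_swap]
    refine ⟨W.filter (fun v => leaf v ∈ RWBreak.side T b a),
      W.filter (fun v => leaf v ∉ RWBreak.side T b a), Finset.filter_subset _ _,
      Finset.filter_subset _ _, Finset.disjoint_filter_filter_not _ _ _, by convert hA,
      by convert hB, H, hH, ?_⟩
    intro x hx y hy
    simp only [Finset.mem_filter] at hx hy
    exact hsep x ((hmem x).1 hx.2) y (fun h => hy.2 ((hmem y).2 h))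
end

section
/- A class of finite graphs has bounded treewidth if and only if it is distance-∞ deletion-breakable. -/
set_option autoImplicit false

/-- `G` has treewidth at most `k`: there is a tree decomposition (a finite tree `T` with bags
`B t ⊆ V(G)`) covering all vertices and edges, in which each vertex's bags induce a connected
(nonempty) subtree, and all bags have size at most `k + 1`. -/
def TreewidthLE {V : Type} (G : SimpleGraph V) (k : ℕ) : Prop :=
  ∃ (m : ℕ) (T : SimpleGraph (Fin m)) (B : Fin m → Finset V),
    T.IsTree ∧
    (∀ v : V, ∃ t : Fin m, v ∈ B t) ∧
    (∀ u v : V, G.Adj u v → ∃ t : Fin m, u ∈ B t ∧ v ∈ B t) ∧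
    (∀ v : V, (T.induce {t : Fin m | v ∈ B t}).Connected) ∧
    (∀ t : Fin m, (B t).card ≤ k + 1)

/-- A graph class `C` is distance-∞ deletion-breakable: there are `N : ℕ → ℕ` and `k : ℕ`
such that for all `m`, every `W ⊆ V(G)` with `|W| ≥ N m` in a graph `G ∈ C` admits a set `S`
of at most `k` vertices and subsets `A, B ⊆ W ∖ S` of size at least `m` such that no vertex
of `A` lies in the same connected component of `G − S` as a vertex of `B`. -/
def DistInftyDeletionBreakable (C : GraphClass) : Prop :=
  ∃ (N : ℕ → ℕ) (k : ℕ),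
    ∀ (m n : ℕ) (G : SimpleGraph (Fin n)), C n G →
      ∀ W : Finset (Fin n), N m ≤ W.card →
        ∃ S : Finset (Fin n), S.card ≤ k ∧
          ∃ A B : Finset (Fin n), A ⊆ W \ S ∧ B ⊆ W \ S ∧ m ≤ A.card ∧ m ≤ B.card ∧
            ∀ a ∈ A, ∀ b ∈ B, ¬ ∃ p : G.Walk a b, ∀ x ∈ p.support, x ∉ S

section Helpers

/-- The disjoint union of two trees joined by an edge is a tree. -/
theorem glueTree {ι κ : Type} [Finite ι] [Finite κ] {T : SimpleGraph ι} {T' : SimpleGraph κ}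
    (h : T.IsTree) (h' : T'.IsTree) (r : ι) (r' : κ) :
    (T.sum T' ⊔ SimpleGraph.edge (Sum.inl r) (Sum.inr r')).IsTree := by
  have hc : (T.sum T' ⊔ SimpleGraph.edge (Sum.inl r) (Sum.inr r')).Connected :=
    h.connected.sum_sup_edge h'.connected
  rw [SimpleGraph.isTree_iff_connected_and_card] at h h' ⊢
  refine ⟨hc, le_antisymm ?_ hc.card_vert_le_card_edgeSet_add_one⟩
  have e1 : Nat.card (T.sum T').edgeSet = Nat.card T.edgeSet + Nat.card T'.edgeSet := by
    rw [Nat.card_congr SimpleGraph.edgeSetSumEquiv, Nat.card_sum]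
  have e2 : Nat.card (T.sum T' ⊔ SimpleGraph.edge (Sum.inl r) (Sum.inr r')).edgeSet
      ≤ Nat.card (T.sum T').edgeSet + 1 := by
    rw [SimpleGraph.edgeSet_sup, Nat.card_coe_set_eq, Nat.card_coe_set_eq]
    refine (Set.ncard_union_le _ _).trans ?_
    gcongr
    refine (Set.ncard_le_ncard (t := {s(Sum.inl r, Sum.inr r')}) ?_ (Set.toFinite _)).trans
      (by simp)
    simp [SimpleGraph.edge]
  rw [Nat.card_sum]
  omega

/-- A tree decomposition of `G[U]` with bags of size at most `K` and some bag containing `R`. -/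
def RootedTD {V : Type} (G : SimpleGraph V) (K : ℕ) (U R : Finset V) : Prop :=
  ∃ (ι : Type) (_ : Finite ι) (T : SimpleGraph ι) (B : ι → Finset V) (r : ι),
    T.IsTree ∧ (∀ t, B t ⊆ U) ∧ (∀ v ∈ U, ∃ t, v ∈ B t) ∧
    (∀ u ∈ U, ∀ v ∈ U, G.Adj u v → ∃ t, u ∈ B t ∧ v ∈ B t) ∧
    (∀ v s t, v ∈ B s → v ∈ B t → ∃ p : T.Walk s t, ∀ x ∈ p.support, v ∈ B x) ∧
    (∀ t, (B t).card ≤ K) ∧ R ⊆ B r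

theorem RootedTD.single {V : Type} (G : SimpleGraph V) (K : ℕ) (U R : Finset V)
    (hR : R ⊆ U) (hK : U.card ≤ K) : RootedTD G K U R := by
  refine ⟨Unit, inferInstance, ⊥, fun _ => U, (), .of_subsingleton, fun _ => subset_rfl,
    fun v hv => ⟨(), hv⟩, fun u hu v hv _ => ⟨(), hu, hv⟩, ?_, fun _ => hK, hR⟩
  intro v s t hs ht
  exact ⟨SimpleGraph.Walk.nil, fun x _ => hs⟩

theorem RootedTD.glue {V : Type} [DecidableEq V] {G : SimpleGraph V} {K : ℕ}
    {U R U' R' : Finset V}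
    (h : RootedTD G K U R) (h' : RootedTD G K U' R')
    (hi : U ∩ U' ⊆ R) (hi' : U ∩ U' ⊆ R')
    (hadj : ∀ u ∈ U, ∀ v ∈ U', G.Adj u v → u ∈ U' ∨ v ∈ U) :
    RootedTD G K (U ∪ U') R := by
  obtain ⟨ι, _, T, B, r, hT, hBU, hcov, hedge, hconn, hcard, hr⟩ := h
  obtain ⟨κ, _, T', B', r', hT', hBU', hcov', hedge', hconn', hcard', hr'⟩ := h'
  let TT := T.sum T' ⊔ SimpleGraph.edge (Sum.inl r) (Sum.inr r')
  let BB : ι ⊕ κ → Finset V := Sum.elim B B'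
  have hl : ∀ v s t, v ∈ B s → v ∈ B t →
      ∃ p : TT.Walk (Sum.inl s) (Sum.inl t), ∀ x ∈ p.support, v ∈ BB x := by
    intro v s t hs ht
    obtain ⟨p, hp⟩ := hconn v s t hs ht
    let φ : T →g TT := ⟨Sum.inl, fun {a b} hab => Or.inl (by simpa using hab)⟩
    refine ⟨p.map φ, ?_⟩
    intro x hx
    have hx : x ∈ (p.map φ).support := hx
    rw [SimpleGraph.Walk.support_map] at hx
    obtain ⟨y, hy, rfl⟩ := List.mem_map.1 hx
    exact hp y hy
  have hrr : ∀ v s t, v ∈ B' s → v ∈ B' t →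
      ∃ p : TT.Walk (Sum.inr s) (Sum.inr t), ∀ x ∈ p.support, v ∈ BB x := by
    intro v s t hs ht
    obtain ⟨p, hp⟩ := hconn' v s t hs ht
    let φ : T' →g TT := ⟨Sum.inr, fun {a b} hab => Or.inl (by simpa using hab)⟩
    refine ⟨p.map φ, ?_⟩
    intro x hx
    have hx : x ∈ (p.map φ).support := hx
    rw [SimpleGraph.Walk.support_map] at hx
    obtain ⟨y, hy, rfl⟩ := List.mem_map.1 hx
    exact hp y hy
  have hlr : ∀ v s t, v ∈ B s → v ∈ B' t →
      ∃ p : TT.Walk (Sum.inl s) (Sum.inr t), ∀ x ∈ p.support, v ∈ BB x := by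
    intro v s t hs ht
    have hv : v ∈ U ∩ U' := Finset.mem_inter.2 ⟨hBU _ hs, hBU' _ ht⟩
    obtain ⟨p, hp⟩ := hl v s r hs (hr (hi hv))
    obtain ⟨q, hq⟩ := hrr v r' t (hr' (hi' hv)) ht
    have ha : TT.Adj (Sum.inl r) (Sum.inr r') := by
      simp [TT, SimpleGraph.edge_adj]
    refine ⟨p.append (SimpleGraph.Walk.cons ha q), ?_⟩
    intro x hx
    rw [SimpleGraph.Walk.mem_support_append_iff, SimpleGraph.Walk.support_cons,
      List.mem_cons] at hx
    rcases hx with hx | rfl | hx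
    · exact hp x hx
    · exact hr (hi hv)
    · exact hq x hx
  refine ⟨ι ⊕ κ, inferInstance, TT, BB, Sum.inl r, glueTree hT hT' r r', ?_, ?_, ?_, ?_, ?_, hr⟩
  · rintro (t | t)
    · exact (hBU t).trans Finset.subset_union_left
    · exact (hBU' t).trans Finset.subset_union_right
  · intro v hv
    rcases Finset.mem_union.1 hv with hv | hv
    · obtain ⟨t, ht⟩ := hcov v hv
      exact ⟨Sum.inl t, ht⟩
    · obtain ⟨t, ht⟩ := hcov' v hv
      exact ⟨Sum.inr t, ht⟩
  · have key : ∀ u ∈ U ∪ U', ∀ v ∈ U ∪ U', G.Adj u v →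
        (u ∈ U ∧ v ∈ U) ∨ (u ∈ U' ∧ v ∈ U') := by
      intro u hu v hv huv
      rw [Finset.mem_union] at hu hv
      rcases hu with hu | hu <;> rcases hv with hv | hv
      · exact Or.inl ⟨hu, hv⟩
      · rcases hadj u hu v hv huv with h | h
        · exact Or.inr ⟨h, hv⟩
        · exact Or.inl ⟨hu, h⟩
      · rcases hadj v hv u hu huv.symm with h | h
        · exact Or.inr ⟨hu, h⟩
        · exact Or.inl ⟨h, hv⟩
      · exact Or.inr ⟨hu, hv⟩
    intro u hu v hv huv
    rcases key u hu v hv huv with ⟨a, b⟩ | ⟨a, b⟩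
    · obtain ⟨t, ht⟩ := hedge u a v b huv
      exact ⟨Sum.inl t, ht⟩
    · obtain ⟨t, ht⟩ := hedge' u a v b huv
      exact ⟨Sum.inr t, ht⟩
  · rintro v (s | s) (t | t) hs ht
    · exact hl v s t hs ht
    · exact hlr v s t hs ht
    · obtain ⟨p, hp⟩ := hlr v t s ht hs
      exact ⟨p.reverse, fun x hx => hp x (by simpa using hx)⟩
    · exact hrr v s t hs ht
  · rintro (t | t)
    · exact hcard t
    · exact hcard' t

theorem RootedTD.mono {V : Type} {G : SimpleGraph V} {K : ℕ} {U R R' : Finset V}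
    (h : RootedTD G K U R) (hR : R' ⊆ R) : RootedTD G K U R' := by
  obtain ⟨ι, i, T, B, r, a, b, c, d, e, f, g⟩ := h
  exact ⟨ι, i, T, B, r, a, b, c, d, e, f, hR.trans g⟩

theorem RootedTD.treewidthLE {V : Type} [Fintype V] {G : SimpleGraph V} {K : ℕ} {R : Finset V}
    (h : RootedTD G (K + 1) Finset.univ R) : TreewidthLE G K := by
  obtain ⟨ι, _, T, B, r, hT, -, hcov, hedge, hconn, hcard, -⟩ := h
  obtain ⟨m, ⟨e⟩⟩ := Finite.exists_equiv_fin ι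
  let f : T ≃g T.map e.toEmbedding := SimpleGraph.Iso.map e T
  refine ⟨m, T.map e.toEmbedding, fun t => B (e.symm t), f.isTree_iff.1 hT, ?_, ?_, ?_, ?_⟩
  · intro v
    obtain ⟨t, ht⟩ := hcov v (Finset.mem_univ _)
    exact ⟨e t, by simpa using ht⟩
  · intro u v huv
    obtain ⟨t, ht⟩ := hedge u (Finset.mem_univ _) v (Finset.mem_univ _) huv
    exact ⟨e t, by simpa using ht⟩
  · intro v
    obtain ⟨t, ht⟩ := hcov v (Finset.mem_univ _)
    have : Nonempty {t : Fin m | v ∈ B (e.symm t)} := ⟨⟨e t, by simpa using ht⟩⟩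
    refine ⟨?_⟩
    have key : ∀ s t : ι, v ∈ B s → v ∈ B t → ∃ p : (T.map e.toEmbedding).Walk (e s) (e t),
        ∀ x ∈ p.support, x ∈ {t : Fin m | v ∈ B (e.symm t)} := by
      intro s t hs ht
      obtain ⟨p, hp⟩ := hconn v s t hs ht
      refine ⟨p.map f.toHom, ?_⟩
      intro x hx
      replace hx : x ∈ (p.map f.toHom).support := hx
      rw [SimpleGraph.Walk.support_map] at hx
      obtain ⟨y, hy, rfl⟩ := List.mem_map.1 hx
      have : e.symm (f.toHom y) = y := e.symm_apply_apply y
      rw [Set.mem_setOf_eq, this]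
      exact hp y hy
    rintro ⟨s, hs⟩ ⟨t, ht⟩
    obtain ⟨s, rfl⟩ := e.surjective s
    obtain ⟨t, rfl⟩ := e.surjective t
    obtain ⟨p, hp⟩ := key s t (by simpa using hs) (by simpa using ht)
    exact ⟨p.induce _ hp⟩
  · intro t
    exact hcard _

open Classical in
theorem exists_rootedTD {n : ℕ} (G : SimpleGraph (Fin n)) (N k : ℕ)
    (hbr : ∀ W : Finset (Fin n), N ≤ W.card →
        ∃ S : Finset (Fin n), S.card ≤ k ∧
          ∃ A B : Finset (Fin n), A ⊆ W \ S ∧ B ⊆ W \ S ∧ k + 1 ≤ A.card ∧ k + 1 ≤ B.card ∧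
            ∀ a ∈ A, ∀ b ∈ B, ¬ ∃ p : G.Walk a b, ∀ x ∈ p.support, x ∉ S) :
    ∀ (c : ℕ) (U W : Finset (Fin n)), U.card = c → W ⊆ U → W.card ≤ N →
      RootedTD G (N + k + 1) U W := by
  intro c
  induction c using Nat.strong_induction_on with
  | _ c ih =>
  intro U W hU hWU hWN
  by_cases hUN : U.card ≤ N
  · exact RootedTD.single G _ U W hWU (by omega)
  obtain ⟨X, hWX, hXU, hX⟩ := Finset.exists_subsuperset_card_eq hWU hWN (by omega)
  obtain ⟨S, hS, A, B, hA, hB, hAc, hBc, hsep⟩ := hbr X hX.ge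
  set S' := S ∩ U with hS'
  have hS'c : S'.card ≤ k := (Finset.card_le_card Finset.inter_subset_left).trans hS
  let U₁ := (U \ S).filter fun v => ∃ a ∈ A, ∃ p : G.Walk a v, ∀ x ∈ p.support, x ∉ S
  let U₂ := (U \ S).filter fun v => ¬ ∃ a ∈ A, ∃ p : G.Walk a v, ∀ x ∈ p.support, x ∉ S
  have hnoadj : ∀ u ∈ U₁, ∀ v ∈ U₂, ¬ G.Adj u v := by
    intro u hu v hv huv
    obtain ⟨hu1, a, ha, p, hp⟩ := Finset.mem_filter.1 hu
    obtain ⟨hv1, hv2⟩ := Finset.mem_filter.1 hv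
    refine hv2 ⟨a, ha, p.concat huv, ?_⟩
    intro x hx
    rw [SimpleGraph.Walk.support_concat] at hx
    have hx : x ∈ p.support ∨ x = v := by simpa using hx
    rcases hx with hx | rfl
    · exact hp x hx
    · exact (Finset.mem_sdiff.1 hv1).2
  have hA1 : A ⊆ U₁ := by
    intro a ha
    have h1 := Finset.mem_sdiff.1 (hA ha)
    refine Finset.mem_filter.2 ⟨Finset.mem_sdiff.2 ⟨hXU h1.1, h1.2⟩, a, ha, .nil, ?_⟩
    intro x hx
    have : x = a := by simpa using hx
    subst this
    exact h1.2
  have hB2 : B ⊆ U₂ := by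
    intro b hb
    have h1 := Finset.mem_sdiff.1 (hB hb)
    refine Finset.mem_filter.2 ⟨Finset.mem_sdiff.2 ⟨hXU h1.1, h1.2⟩, ?_⟩
    rintro ⟨a, ha, hp⟩
    exact hsep a ha b hb hp
  have hpart : ∀ v ∈ U, v ∈ S' ∨ v ∈ U₁ ∨ v ∈ U₂ := by
    intro v hv
    by_cases hvS : v ∈ S
    · exact Or.inl (Finset.mem_inter.2 ⟨hvS, hv⟩)
    · have hvd := Finset.mem_sdiff.2 ⟨hv, hvS⟩
      by_cases hp : ∃ a ∈ A, ∃ p : G.Walk a v, ∀ x ∈ p.support, x ∉ S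
      · exact Or.inr (Or.inl (Finset.mem_filter.2 ⟨hvd, hp⟩))
      · exact Or.inr (Or.inr (Finset.mem_filter.2 ⟨hvd, hp⟩))
  have hd12 : ∀ v ∈ U₁, v ∉ U₂ := by
    intro v h1 h2
    exact (Finset.mem_filter.1 h2).2 (Finset.mem_filter.1 h1).2
  have h1U : ∀ v ∈ U₁, v ∈ U ∧ v ∉ S' := by
    intro v h1
    have := Finset.mem_sdiff.1 (Finset.mem_filter.1 h1).1
    exact ⟨this.1, fun h => this.2 (Finset.mem_inter.1 h).1⟩
  have h2U : ∀ v ∈ U₂, v ∈ U ∧ v ∉ S' := by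
    intro v h1
    have := Finset.mem_sdiff.1 (Finset.mem_filter.1 h1).1
    exact ⟨this.1, fun h => this.2 (Finset.mem_inter.1 h).1⟩
  have hSU : ∀ v ∈ S', v ∈ U := fun v hv => (Finset.mem_inter.1 hv).2
  clear_value U₁ U₂ S'
  have hAX : A ⊆ X := fun a ha => (Finset.mem_sdiff.1 (hA ha)).1
  have hBX : B ⊆ X := fun a ha => (Finset.mem_sdiff.1 (hB ha)).1
  have hXA : (X \ A).card + A.card = X.card := Finset.card_sdiff_add_card_eq_card hAX
  have hXB : (X \ B).card + B.card = X.card := Finset.card_sdiff_add_card_eq_card hBX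
  obtain ⟨a, ha⟩ : A.Nonempty := Finset.card_pos.1 (by omega)
  obtain ⟨b, hb⟩ : B.Nonempty := Finset.card_pos.1 (by omega)
  have D1 : RootedTD G (N + k + 1) (U₁ ∪ S') ((X ∩ U₁) ∪ S') := by
    refine ih _ ?_ _ _ rfl ?_ ?_
    · rw [← hU]
      refine Finset.card_lt_card ((Finset.ssubset_iff_of_subset ?_).2 ⟨b, ?_, ?_⟩)
      · grind
      · exact (h2U b (hB2 hb)).1
      · grind
    · grind
    · have : X ∩ U₁ ⊆ X \ B := by
        intro v hv
        grind
      have := Finset.card_le_card this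
      have := Finset.card_union_le (X ∩ U₁) S'
      omega
  have D2 : RootedTD G (N + k + 1) (U₂ ∪ S') ((X ∩ U₂) ∪ S') := by
    refine ih _ ?_ _ _ rfl ?_ ?_
    · rw [← hU]
      refine Finset.card_lt_card ((Finset.ssubset_iff_of_subset ?_).2 ⟨a, ?_, ?_⟩)
      · grind
      · exact (h1U a (hA1 ha)).1
      · grind
    · grind
    · have : X ∩ U₂ ⊆ X \ A := by
        intro v hv
        grind
      have := Finset.card_le_card this
      have := Finset.card_union_le (X ∩ U₂) S'
      omega
  have D0 : RootedTD G (N + k + 1) (X ∪ S') (X ∪ S') := by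
    refine RootedTD.single G _ _ _ subset_rfl ?_
    have := Finset.card_union_le X S'
    omega
  have D01 : RootedTD G (N + k + 1) ((X ∪ S') ∪ (U₁ ∪ S')) (X ∪ S') := by
    refine D0.glue D1 Finset.inter_subset_left ?_ ?_
    · grind
    · intro u hu v hv huv
      have := hnoadj v
      have := huv.symm
      grind
  have D : RootedTD G (N + k + 1) (((X ∪ S') ∪ (U₁ ∪ S')) ∪ (U₂ ∪ S')) (X ∪ S') := by
    refine D01.glue D2 ?_ ?_ ?_
    · grind
    · grind
    · intro u hu v hv huv
      have := hnoadj u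
      grind
  have hUU : ((X ∪ S') ∪ (U₁ ∪ S')) ∪ (U₂ ∪ S') = U := by
    ext v
    have := @hXU v
    have := hpart v
    grind
  rw [hUU] at D
  exact D.mono (hWX.trans Finset.subset_union_left)

open Classical in
/-- Either an equivalence relation splits a finite set into two large closed parts,
or one of its classes is very large. -/
theorem exists_split {α : Type} (r : α → α → Prop) (X : Finset α)
    (hrefl : ∀ x ∈ X, r x x) (hsymm : ∀ x y, r x y → r y x)
    (htrans : ∀ x y z, r x y → r y z → r x z) (m : ℕ) (hm : 0 < m) (hX : m ≤ X.card) :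
    (∃ A B : Finset α, A ⊆ X ∧ B ⊆ X ∧ m ≤ A.card ∧ m ≤ B.card ∧ ∀ a ∈ A, ∀ b ∈ B, ¬ r a b) ∨
    ∃ c ∈ X, X.card < (X.filter fun x => r c x).card + 2 * m := by
  let P := X.powerset.filter fun A => m ≤ A.card ∧ ∀ a ∈ A, ∀ b ∈ X, r a b → b ∈ A
  have hP : P.Nonempty := ⟨X, by simpa [P, hX] using fun _ _ b hb _ => hb⟩
  obtain ⟨A, hAP, hmin⟩ := Finset.exists_min_image P Finset.card hP
  obtain ⟨hAX, hAm, hAcl⟩ : A ⊆ X ∧ m ≤ A.card ∧ ∀ a ∈ A, ∀ b ∈ X, r a b → b ∈ A := by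
    simpa [P] using hAP
  have hc : (X \ A).card + A.card = X.card := Finset.card_sdiff_add_card_eq_card hAX
  by_cases hB : m ≤ (X \ A).card
  · left
    refine ⟨A, X \ A, hAX, Finset.sdiff_subset, hAm, hB, ?_⟩
    intro a ha b hb hab
    exact (Finset.mem_sdiff.1 hb).2 (hAcl a ha b (Finset.mem_sdiff.1 hb).1 hab)
  · right
    obtain ⟨c, hcA⟩ : A.Nonempty := Finset.card_pos.1 (by omega)
    refine ⟨c, hAX hcA, ?_⟩
    set C := X.filter fun x => r c x with hC
    have hCA : C ⊆ A := by
      intro x hx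
      obtain ⟨h1, h2⟩ := Finset.mem_filter.1 hx
      exact hAcl c hcA x h1 h2
    have hcC : c ∈ C := Finset.mem_filter.2 ⟨hAX hcA, hrefl c (hAX hcA)⟩
    have hd : (A \ C).card + C.card = A.card := Finset.card_sdiff_add_card_eq_card hCA
    have hCpos : 0 < C.card := Finset.card_pos.2 ⟨c, hcC⟩
    have : ¬ m ≤ (A \ C).card := by
      intro hmc
      have hmem : A \ C ∈ P := by
        refine Finset.mem_filter.2 ⟨Finset.mem_powerset.2 (Finset.sdiff_subset.trans hAX), hmc, ?_⟩
        intro a ha b hb hab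
        obtain ⟨ha1, ha2⟩ := Finset.mem_sdiff.1 ha
        refine Finset.mem_sdiff.2 ⟨hAcl a ha1 b hb hab, fun hbC => ha2 ?_⟩
        exact Finset.mem_filter.2 ⟨hAX ha1,
          htrans _ _ _ (Finset.mem_filter.1 hbC).2 (hsymm _ _ hab)⟩
      have := hmin _ hmem
      omega
    omega

/-- Following a walk in `G` that avoids the bag at `t`, all bags stay on one side of `t`. -/
theorem side_of_walk {V ι : Type} {G : SimpleGraph V} {T : SimpleGraph ι} {B : ι → Finset V}
    (hedge : ∀ u v : V, G.Adj u v → ∃ t, u ∈ B t ∧ v ∈ B t)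
    (hconn : ∀ v s t, v ∈ B s → v ∈ B t → ∃ p : T.Walk s t, ∀ x ∈ p.support, v ∈ B x)
    (t t' : ι) {u w : V} (p : G.Walk u w) (hp : ∀ x ∈ p.support, x ∉ B t)
    (hu : ∃ s, u ∈ B s ∧ ∃ q : T.Walk t' s, t ∉ q.support) :
    ∀ s, w ∈ B s → ∃ q : T.Walk t' s, t ∉ q.support := by
  have ext1 : ∀ v, v ∉ B t → (∃ s, v ∈ B s ∧ ∃ q : T.Walk t' s, t ∉ q.support) →
      ∀ s, v ∈ B s → ∃ q : T.Walk t' s, t ∉ q.support := by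
    rintro v hv ⟨s, hs, q, hq⟩ s' hs'
    obtain ⟨p, hp⟩ := hconn v s s' hs hs'
    refine ⟨q.append p, ?_⟩
    rw [SimpleGraph.Walk.mem_support_append_iff]
    rintro (h | h)
    · exact hq h
    · exact hv (hp t h)
  induction p with
  | nil => exact ext1 _ (hp _ (by simp)) hu
  | cons hadj p ih =>
    refine ih (fun x hx => hp x (by simp [hx])) ?_
    obtain ⟨s, hs1, hs2⟩ := hedge _ _ hadj
    exact ⟨s, hs2, ext1 _ (hp _ (by simp)) hu s hs1⟩

/-- A map sending each vertex of a finite tree to a neighbour flips some edge. -/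
theorem exists_flip {ι : Type} [Fintype ι] {T : SimpleGraph ι} (hT : T.IsTree) (f : ι → ι)
    (hf : ∀ t, T.Adj t (f t)) : ∃ t, f (f t) = t := by
  classical
  have hc := hT.card_edgeFinset
  obtain ⟨x, -, y, -, hxy, he⟩ := Finset.exists_ne_map_eq_of_card_lt_of_maps_to
    (s := (Finset.univ : Finset ι)) (t := T.edgeFinset) (f := fun t => s(t, f t))
    (by rw [Finset.card_univ]; omega) (by intro t _; simpa using hf t)
  refine ⟨x, ?_⟩
  rcases Sym2.eq_iff.1 he with ⟨h, -⟩ | ⟨h1, h2⟩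
  · exact absurd h hxy
  · rw [h2, h1]

open Classical in
theorem breakable_of_treewidthLE {n k m : ℕ} (G : SimpleGraph (Fin n)) (h : TreewidthLE G k)
    (W : Finset (Fin n)) (hW : 2 * (k + 1) + 4 * m ≤ W.card) :
    ∃ S : Finset (Fin n), S.card ≤ k + 1 ∧
      ∃ A B : Finset (Fin n), A ⊆ W \ S ∧ B ⊆ W \ S ∧ m ≤ A.card ∧ m ≤ B.card ∧
        ∀ a ∈ A, ∀ b ∈ B, ¬ ∃ p : G.Walk a b, ∀ x ∈ p.support, x ∉ S := by
  rcases Nat.eq_zero_or_pos m with rfl | hm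
  · exact ⟨∅, by simp, ∅, ∅, by simp⟩
  obtain ⟨M, T, B, hT, hcov, hedge, hconn', hcard⟩ := h
  have hconn : ∀ v s t, v ∈ B s → v ∈ B t → ∃ p : T.Walk s t, ∀ x ∈ p.support, v ∈ B x := by
    intro v s t hs ht
    obtain ⟨p⟩ := (hconn' v).preconnected ⟨s, hs⟩ ⟨t, ht⟩
    refine ⟨p.map (SimpleGraph.Embedding.induce _).toHom, ?_⟩
    intro x hx
    replace hx : x ∈ (p.map (SimpleGraph.Embedding.induce _).toHom).support := hx
    rw [SimpleGraph.Walk.support_map] at hx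
    obtain ⟨y, hy, rfl⟩ := List.mem_map.1 hx
    exact y.2
  by_contra hcon
  have hbig : ∀ t, ∃ c ∈ W \ B t, (W \ B t).card <
      ((W \ B t).filter fun x => ∃ p : G.Walk c x, ∀ y ∈ p.support, y ∉ B t).card + 2 * m := by
    intro t
    have h1 := Finset.le_card_sdiff (B t) W
    have h2 := hcard t
    have hs := exists_split (fun a b => ∃ p : G.Walk a b, ∀ y ∈ p.support, y ∉ B t) (W \ B t)
      ?_ ?_ ?_ m hm (by omega)
    · rcases hs with h | h
      · exact absurd ⟨B t, hcard t, h⟩ hcon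
      · exact h
    · intro x hx
      refine ⟨.nil, fun y hy => ?_⟩
      have : y = x := by simpa using hy
      subst this
      exact (Finset.mem_sdiff.1 hx).2
    · rintro x y ⟨p, hp⟩
      exact ⟨p.reverse, fun z hz => hp z (by simpa using hz)⟩
    · rintro x y z ⟨p, hp⟩ ⟨q, hq⟩
      refine ⟨p.append q, fun w hw => ?_⟩
      rcases (SimpleGraph.Walk.mem_support_append_iff ..).1 hw with h | h
      · exact hp w h
      · exact hq w h
  choose c hcW hcbig using hbig
  have hnext : ∀ t, ∃ t', T.Adj t t' ∧ ∃ s, c t ∈ B s ∧ ∃ q : T.Walk t' s, t ∉ q.support := by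
    intro t
    obtain ⟨s, hs⟩ := hcov (c t)
    have hne : t ≠ s := by
      rintro rfl
      exact (Finset.mem_sdiff.1 (hcW t)).2 hs
    obtain ⟨p, hp⟩ := hT.connected.exists_isPath t s
    cases p with
    | nil => exact absurd rfl hne
    | cons hadj q =>
      exact ⟨_, hadj, s, hs, q, ((SimpleGraph.Walk.cons_isPath_iff _ _).1 hp).2⟩
  choose f hfadj hfside using hnext
  obtain ⟨t, ht⟩ := exists_flip hT f hfadj
  have hbound : ∀ t, W.card <
      ((W \ B t).filter fun x => ∃ p : G.Walk (c t) x, ∀ y ∈ p.support, y ∉ B t).card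
        + 2 * m + (k + 1) := by
    intro t
    have h1 := Finset.le_card_sdiff (B t) W
    have h2 := hcard t
    have h3 := hcbig t
    omega
  have hb1 := hbound t
  have hb2 := hbound (f t)
  obtain ⟨v, hv⟩ : (((W \ B t).filter fun x => ∃ p : G.Walk (c t) x, ∀ y ∈ p.support, y ∉ B t) ∩
      ((W \ B (f t)).filter fun x =>
        ∃ p : G.Walk (c (f t)) x, ∀ y ∈ p.support, y ∉ B (f t))).Nonempty := by
    rw [Finset.nonempty_iff_ne_empty]
    intro hemp
    have hd := Finset.card_union_of_disjoint (Finset.disjoint_iff_inter_eq_empty.2 hemp)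
    have hsub := Finset.card_le_card (Finset.union_subset
      ((Finset.filter_subset (fun x => ∃ p : G.Walk (c t) x, ∀ y ∈ p.support, y ∉ B t)
        (W \ B t)).trans Finset.sdiff_subset)
      ((Finset.filter_subset (fun x => ∃ p : G.Walk (c (f t)) x, ∀ y ∈ p.support, y ∉ B (f t))
        (W \ B (f t))).trans Finset.sdiff_subset))
    omega
  obtain ⟨hv1, hv2⟩ := Finset.mem_inter.1 hv
  obtain ⟨-, p1, hp1⟩ := Finset.mem_filter.1 hv1
  obtain ⟨-, p2, hp2⟩ := Finset.mem_filter.1 hv2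
  obtain ⟨s, hs⟩ := hcov v
  obtain ⟨q1, hq1⟩ := side_of_walk hedge hconn t (f t) p1 hp1 (hfside t) s hs
  obtain ⟨q2, hq2⟩ := side_of_walk hedge hconn (f t) (f (f t)) p2 hp2 (hfside (f t)) s hs
  have hbridge := SimpleGraph.isAcyclic_iff_forall_adj_isBridge.1 hT.isAcyclic
    (hfadj (f t))
  rw [SimpleGraph.isBridge_iff_forall_walk_mem_edges] at hbridge
  have hmem := hbridge (q1.append q2.reverse)
  rw [SimpleGraph.Walk.edges_append, List.mem_append, SimpleGraph.Walk.edges_reverse,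
    List.mem_reverse] at hmem
  rcases hmem with hmem | hmem
  · have := SimpleGraph.Walk.snd_mem_support_of_mem_edges _ hmem
    rw [ht] at this
    exact hq1 this
  · exact hq2 (SimpleGraph.Walk.fst_mem_support_of_mem_edges _ hmem)

end Helpers

/-- A class of finite graphs has bounded treewidth if and only if it is
distance-∞ deletion-breakable. -/
theorem boundedTreewidth_iff_distInftyDeletionBreakable (C : GraphClass) :
    (∃ k : ℕ, ∀ (n : ℕ) (G : SimpleGraph (Fin n)), C n G → TreewidthLE G k) ↔
      DistInftyDeletionBreakable C := by
  constructor
  · rintro ⟨k, hk⟩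
    exact ⟨fun m => 2 * (k + 1) + 4 * m, k + 1, fun m n G hG W hW =>
      breakable_of_treewidthLE G (hk n G hG) W hW⟩
  · rintro ⟨N, k, h⟩
    refine ⟨N (k + 1) + k, fun n G hG => ?_⟩
    exact (exists_rootedTD G (N (k + 1)) k (fun W hW => h (k + 1) n G hG W hW) _
      Finset.univ ∅ rfl (by simp) (by simp)).treewidthLE
end

section
/- A class of finite graphs has bounded treedepth if and only if it is distance-∞ deletion-flat. -/
set_option autoImplicit false

/-- `u` and `w` are joined by a walk of `G` all of whose vertices lie in `s`
(i.e. they lie in the same connected component of the induced subgraph `G[s]`). -/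
def ReachIn {V : Type} (G : SimpleGraph V) (s : Set V) (u w : V) : Prop :=
  ∃ p : G.Walk u w, ∀ x ∈ p.support, x ∈ s

/-- `TdLE G k s` says that the subgraph of `G` induced on `s` has treedepth at most `k`,
following the recursion: the empty graph has treedepth `0` (so `K_1` has treedepth `1`), and
for `k + 1` either `s` is empty or there is `v ∈ s` such that every connected component of
`G[s] − v` has treedepth at most `k`. -/
def TdLE {V : Type} (G : SimpleGraph V) : ℕ → Set V → Prop
  | 0, s => s = ∅
  | k + 1, s => s = ∅ ∨ ∃ v ∈ s, ∀ u ∈ s, u ≠ v →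
      TdLE G k {w : V | ReachIn G (s \ {v}) u w}

/-- A graph class `C` is distance-∞ deletion-flat: there are `N : ℕ → ℕ` and `k : ℕ` such
that for all `m`, every `W ⊆ V(G)` with `|W| ≥ N m` in a graph `G ∈ C` admits a set `S` of at
most `k` vertices and a subset `W* ⊆ W ∖ S` of size at least `m` whose vertices lie in
pairwise distinct connected components of `G − S`. -/
def DistInftyDeletionFlat (C : GraphClass) : Prop :=
  ∃ (N : ℕ → ℕ) (k : ℕ),
    ∀ (m n : ℕ) (G : SimpleGraph (Fin n)), C n G →
      ∀ W : Finset (Fin n), N m ≤ W.card →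
        ∃ S : Finset (Fin n), S.card ≤ k ∧
          ∃ Wstar : Finset (Fin n), Wstar ⊆ W \ S ∧ m ≤ Wstar.card ∧
            ∀ u ∈ Wstar, ∀ v ∈ Wstar, u ≠ v → ¬ ReachIn G {x : Fin n | x ∉ S} u v

theorem reachIn_refl {V : Type} {G : SimpleGraph V} {s : Set V} {u : V} (h : u ∈ s) :
    ReachIn G s u u := ⟨SimpleGraph.Walk.nil, by simpa using h⟩

theorem reachIn_trans {V : Type} {G : SimpleGraph V} {s : Set V} {u v w : V}
    (h : ReachIn G s u v) (h' : ReachIn G s v w) : ReachIn G s u w := by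
  obtain ⟨p, hp⟩ := h
  obtain ⟨q, hq⟩ := h'
  refine ⟨p.append q, fun x hx => ?_⟩
  rw [SimpleGraph.Walk.mem_support_append_iff] at hx
  exact hx.elim (hp x) (hq x)

theorem reachIn_symm {V : Type} {G : SimpleGraph V} {s : Set V} {u v : V}
    (h : ReachIn G s u v) : ReachIn G s v u := by
  obtain ⟨p, hp⟩ := h
  exact ⟨p.reverse, fun x hx => hp x (by simpa using hx)⟩

theorem reachIn_mono {V : Type} {G : SimpleGraph V} {s t : Set V} {u v : V} (hst : s ⊆ t)
    (h : ReachIn G s u v) : ReachIn G t u v := by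
  obtain ⟨p, hp⟩ := h
  exact ⟨p, fun x hx => hst (hp x hx)⟩

theorem reachIn_left {V : Type} {G : SimpleGraph V} {s : Set V} {u v : V}
    (h : ReachIn G s u v) : u ∈ s := by
  obtain ⟨p, hp⟩ := h
  exact hp _ p.start_mem_support

theorem reachIn_right {V : Type} {G : SimpleGraph V} {s : Set V} {u v : V}
    (h : ReachIn G s u v) : v ∈ s := reachIn_left (reachIn_symm h)

/-- Every vertex of a walk inside `s` is reachable inside `s` from its start. -/
theorem reachIn_of_mem_support {V : Type} {G : SimpleGraph V} {s : Set V} {u v : V}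
    (p : G.Walk u v) (hp : ∀ x ∈ p.support, x ∈ s) : ∀ x ∈ p.support, ReachIn G s u x := by
  classical
  intro x hx
  exact ⟨p.takeUntil x hx, fun y hy => hp y (p.support_takeUntil_subset_support hx hy)⟩

/-- Relativise a walk to the component that contains it. -/
theorem reachIn_comp {V : Type} {G : SimpleGraph V} {s t : Set V} {a u v : V}
    (hts : t ⊆ s) (ha : ReachIn G s a u) (h : ReachIn G t u v) :
    ReachIn G ({w | ReachIn G s a w} ∩ t) u v := by
  obtain ⟨p, hp⟩ := h
  exact ⟨p, fun x hx => ⟨reachIn_trans ha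
    (reachIn_of_mem_support p (fun y hy => hts (hp y hy)) x hx), hp x hx⟩⟩

/-- The bound used for classes of bounded treedepth. -/
def flatBound (m : ℕ) : ℕ → ℕ
  | 0 => 1
  | k + 1 => m * flatBound m k + 2

theorem flat_of_tdLE {V : Type} (G : SimpleGraph V) [DecidableEq V] (m : ℕ) (k : ℕ) :
    ∀ (s : Set V), TdLE G k s → ∀ W : Finset V, (∀ w ∈ W, w ∈ s) → flatBound m k ≤ W.card →
      ∃ S : Finset V, S.card ≤ k ∧ ∃ Wstar : Finset V, Wstar ⊆ W \ S ∧ m ≤ Wstar.card ∧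
        ∀ u ∈ Wstar, ∀ v ∈ Wstar, u ≠ v → ¬ ReachIn G (s \ (S : Set V)) u v := by
  classical
  induction k with
  | zero =>
    intro s hs W hW hc
    have hs' : s = ∅ := hs
    subst hs'
    simp only [flatBound] at hc
    obtain ⟨w, hw⟩ := Finset.card_pos.1 hc
    exact absurd (hW w hw) (by simp)
  | succ k ih =>
    intro s hs W hW hc
    simp only [flatBound] at hc
    rcases hs with hs | ⟨v, hv, hcomp⟩
    · subst hs
      obtain ⟨w, hw⟩ := Finset.card_pos.1 (by omega : 0 < W.card)
      exact absurd (hW w hw) (by simp)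
    · have hc' : m * flatBound m k < (W.erase v).card := by
        have := Finset.pred_card_le_card_erase (s := W) (a := v)
        omega
      let f : V → Set V := fun u => {w | ReachIn G (s \ {v}) u w}
      by_cases him : m ≤ ((W.erase v).image f).card
      · obtain ⟨T, hT, hinj⟩ := Finset.exists_subset_injOn_image_eq_of_surjOn (W.erase v)
          ((W.erase v).image f) (f := f) (by intro x hx; simpa using hx)
        refine ⟨{v}, by simp, T, ?_, ?_, ?_⟩
        · intro x hx
          have := Finset.mem_erase.1 (Finset.mem_coe.1 (hT hx))
          simp [this.1, this.2]
        · have := Finset.card_image_of_injOn hinj.1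
          rw [hinj.2] at this
          omega
        · intro a ha b hb hab hr
          apply hab
          apply hinj.1 ha hb
          have hr' : ReachIn G (s \ {v}) a b := by simpa using hr
          ext w
          exact ⟨fun h => reachIn_trans (reachIn_symm hr') h, fun h => reachIn_trans hr' h⟩
      · push Not at him
        obtain ⟨y, hy, hlt⟩ := Finset.exists_lt_card_fiber_of_mul_lt_card_of_maps_to
          (s := W.erase v) (t := (W.erase v).image f) (f := f) (n := flatBound m k)
          (fun a ha => Finset.mem_image_of_mem f ha)
          (lt_of_le_of_lt (Nat.mul_le_mul_right _ him.le) hc')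
        obtain ⟨u, hu, rfl⟩ := Finset.mem_image.1 hy
        have hu' := Finset.mem_erase.1 hu
        obtain ⟨S, hS, T, hT, hm, hnr⟩ := ih (f u) (hcomp u (hW u hu'.2) hu'.1)
          ((W.erase v).filter (fun x => f x = f u)) (by
            intro w hw
            have hw' := Finset.mem_filter.1 hw
            have hwe := Finset.mem_erase.1 hw'.1
            rw [← hw'.2]
            exact reachIn_refl ⟨hW w hwe.2, by simpa using hwe.1⟩) hlt.le
        refine ⟨insert v S, (Finset.card_insert_le _ _).trans (by omega), T, ?_, hm, ?_⟩
        · intro x hx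
          have := hT hx
          simp only [Finset.mem_sdiff, Finset.mem_filter, Finset.mem_erase] at this
          simp [this]
        · intro a ha b hb hab hr
          apply hnr a ha b hb hab
          have h1 := hT ha
          simp only [Finset.mem_sdiff, Finset.mem_filter, Finset.mem_erase] at h1
          have h2 : a ∈ f u := by
            rw [← h1.1.2]
            exact reachIn_refl ⟨hW a h1.1.1.2, by simpa using h1.1.1.1⟩
          have h3 := reachIn_comp (s := s \ {v}) (a := u) (by
            intro x hx
            simp only [Finset.coe_insert, Set.mem_sdiff, Set.mem_insert_iff, not_or] at hx
            exact ⟨hx.1, by simpa using hx.2.1⟩) h2 hr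
          refine reachIn_mono ?_ h3
          rintro x ⟨hx1, hx2⟩
          refine ⟨hx1, fun h => hx2.2 (by simp at h; simp [h])⟩

/-- Depth-first search: short paths give small treedepth. -/
theorem tdLE_of_paths {V : Type} (G : SimpleGraph V) (j : ℕ) :
    ∀ (s : Set V) (v : V), (∀ u ∈ s, ReachIn G s v u) → v ∈ s →
      (∀ (w : V) (p : G.Walk v w), p.IsPath → (∀ x ∈ p.support, x ∈ s) → p.length < j) →
      TdLE G j s := by
  classical
  induction j with
  | zero =>
    intro s v _ hv hp
    exact absurd (hp v SimpleGraph.Walk.nil (by simp) (by simpa using hv)) (by simp)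
  | succ j ih =>
    intro s v hconn hv hp
    refine Or.inr ⟨v, hv, fun u hu huv => ?_⟩
    obtain ⟨p, hps⟩ := hconn u hu
    have hq := p.bypass_isPath
    have hqs : ∀ x ∈ p.bypass.support, x ∈ s := fun x hx => hps x (p.support_bypass_subset_support hx)
    generalize p.bypass = q at hq hqs
    cases q with
    | nil => exact absurd rfl huv
    | @cons _ v' _ hadj r =>
      rw [SimpleGraph.Walk.cons_isPath_iff] at hq
      have hr : ReachIn G (s \ {v}) u v' := reachIn_symm ⟨r, fun x hx =>
        ⟨hqs x (by simp [hx]), fun h => hq.2 (by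
          have : x = v := h
          exact this ▸ hx)⟩⟩
      apply ih _ v'
      · intro w hw
        have := reachIn_comp (t := s \ {v}) (Set.Subset.refl _) hr
          (reachIn_trans (reachIn_symm hr) hw)
        exact reachIn_mono Set.inter_subset_left this
      · exact hr
      · intro w t ht hts
        have h1 := hp w (SimpleGraph.Walk.cons hadj t)
          ((SimpleGraph.Walk.cons_isPath_iff _ _).2
            ⟨ht, fun h => (reachIn_right (hts v h)).2 rfl⟩) (by
            intro x hx
            simp only [SimpleGraph.Walk.support_cons, List.mem_cons] at hx
            rcases hx with rfl | hx
            · exact hv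
            · exact (reachIn_right (hts x hx)).1)
        simp only [SimpleGraph.Walk.length_cons] at h1
        omega

theorem reachIn_getVert {V : Type} {G : SimpleGraph V} {A : Set V} {a b : V} (p : G.Walk a b)
    (i j : ℕ) (hij : i ≤ j) (hj : j ≤ p.length)
    (h : ∀ t, i ≤ t → t ≤ j → p.getVert t ∈ A) : ReachIn G A (p.getVert i) (p.getVert j) := by
  induction j, hij using Nat.le_induction with
  | base => exact reachIn_refl (h i le_rfl le_rfl)
  | succ j hij ih =>
    refine reachIn_trans (ih (by omega) fun t h1 h2 => h t h1 (by omega)) ?_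
    refine ⟨(p.adj_getVert_succ (i := j) (by omega)).toWalk, ?_⟩
    intro x hx
    simp at hx
    rcases hx with rfl | rfl
    · exact h j hij (by omega)
    · exact h (j+1) (by omega) le_rfl

theorem path_separation {V : Type} [DecidableEq V] {G : SimpleGraph V} {a b : V}
    (p : G.Walk a b) (hp : p.IsPath) (S T : Finset V) (hT : ∀ w ∈ T, w ∈ p.support ∧ w ∉ S)
    (hsep : ∀ u ∈ T, ∀ v ∈ T, u ≠ v → ¬ ReachIn G {x | x ∉ S} u v) : T.card ≤ S.card + 1 := by
  classical
  by_contra hcon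
  push Not at hcon
  have hidx : ∀ w : V, ∃ i, w ∈ T → p.getVert i = w ∧ i ≤ p.length := by
    intro w
    by_cases hw : w ∈ T
    · obtain ⟨i, hi⟩ := SimpleGraph.Walk.mem_support_iff_exists_getVert.1 (hT w hw).1
      exact ⟨i, fun _ => hi⟩
    · exact ⟨0, fun h => absurd h hw⟩
  choose idx hidx using hidx
  let c : ℕ → Finset ℕ := fun i => (Finset.range i).filter (fun t => p.getVert t ∈ S)
  have hc : ∀ i ≤ p.length, (c i).card ≤ S.card := by
    intro i hi
    apply Finset.card_le_card_of_injOn p.getVert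
    · intro t ht
      exact (Finset.mem_filter.1 ht).2
    · intro t ht t' ht' h
      have h1 := Finset.mem_range.1 (Finset.mem_filter.1 ht).1
      have h2 := Finset.mem_range.1 (Finset.mem_filter.1 ht').1
      exact hp.getVert_injOn (by simp; omega) (by simp; omega) h
  obtain ⟨u, hu, w, hw, huw, heq⟩ := Finset.exists_ne_map_eq_of_card_lt_of_maps_to
    (s := T) (t := Finset.range (S.card + 1)) (f := fun w => (c (idx w)).card)
    (by simpa using hcon) (by
      intro w hw
      have := hc _ (hidx w hw).2
      simp
      omega)
  have key : ∀ u ∈ T, ∀ w ∈ T, u ≠ w → (c (idx u)).card = (c (idx w)).card →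
      idx u ≤ idx w → False := by
    intro u hu w hw huw heq hle
    have hsub : c (idx u) ⊆ c (idx w) := by
      intro t ht
      simp only [c, Finset.mem_filter, Finset.mem_range] at ht ⊢
      exact ⟨by omega, ht.2⟩
    have hceq := Finset.eq_of_subset_of_card_le hsub heq.ge
    apply hsep u hu w hw huw
    have := reachIn_getVert (A := {x | x ∉ S}) p (idx u) (idx w) hle (hidx w hw).2 (by
      intro t h1 h2 h3
      rcases h2.lt_or_eq with h2 | rfl
      · have : t ∈ c (idx w) := by
          simp only [c, Finset.mem_filter, Finset.mem_range]
          exact ⟨h2, h3⟩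
        rw [← hceq] at this
        simp only [c, Finset.mem_filter, Finset.mem_range] at this
        omega
      · rw [(hidx w hw).1] at h3
        exact (hT w hw).2 h3)
    rwa [(hidx u hu).1, (hidx w hw).1] at this
  rcases le_total (idx u) (idx w) with h | h
  · exact key u hu w hw huw heq h
  · exact key w hw u hu huw.symm heq.symm h

/-- A class of finite graphs has bounded treedepth if and only if it is
distance-∞ deletion-flat. -/
theorem boundedTreedepth_iff_distInftyDeletionFlat (C : GraphClass) :
    (∃ k : ℕ, ∀ (n : ℕ) (G : SimpleGraph (Fin n)), C n G → TdLE G k Set.univ) ↔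
      DistInftyDeletionFlat C := by
  constructor
  · rintro ⟨k, hk⟩
    refine ⟨fun m => flatBound m k, k, fun m n G hG W hW => ?_⟩
    obtain ⟨S, hS, T, hT, hm, h⟩ := flat_of_tdLE G m k Set.univ (hk n G hG) W (by simp) hW
    refine ⟨S, hS, T, hT, hm, fun u hu v hv huv hr => h u hu v hv huv (reachIn_mono ?_ hr)⟩
    intro x hx
    exact ⟨trivial, by simpa using hx⟩
  · rintro ⟨N, k, hN⟩
    refine ⟨N (k + 2) + 1, fun n G hG => ?_⟩
    rcases Set.eq_empty_or_nonempty (Set.univ : Set (Fin n)) with he | ⟨v, hv⟩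
    · exact Or.inl he
    refine Or.inr ⟨v, hv, fun u hu huv => ?_⟩
    have hu' : ReachIn G (Set.univ \ {v}) u u := reachIn_refl ⟨hu, by simpa using huv⟩
    apply tdLE_of_paths G _ _ u
    · intro w hw
      exact reachIn_mono Set.inter_subset_left
        (reachIn_comp (t := Set.univ \ {v}) (Set.Subset.refl _) hu' hw)
    · exact hu'
    · intro w p hp _
      by_contra hcon
      push Not at hcon
      have hcard : p.support.toFinset.card = p.length + 1 := by
        rw [List.toFinset_card_of_nodup hp.support_nodup, SimpleGraph.Walk.length_support]
      obtain ⟨S, hS, T, hT, hm, h⟩ := hN (k + 2) n G hG p.support.toFinset (by omega)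
      have := path_separation p hp S T (by
        intro x hx
        simpa using hT hx) h
      omega
end

section
/- For every k ∈ ℕ, every finite graph G of flipdepth at most k, and every set W ⊆ V(G), there exist a subset W* ⊆ W with |W*| ≥ |W|^(1/2^k) and a 4^k-flip H of G such that the vertices of W* lie in pairwise distinct connected components of H. -/
set_option autoImplicit false

/-- `FlipdepthLE k V G` says that `G` has flipdepth at most `k`, following the recursion:
the one-vertex graph `K_1` has flipdepth `0`, and for `k + 1`, `G` is a `2`-flip of a
disjoint union of (arbitrarily many) graphs each of flipdepth at most `k`. -/
def FlipdepthLE : ℕ → (V : Type) → SimpleGraph V → Prop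
  | 0, V, _ => ∃ v : V, ∀ u : V, u = v
  | k + 1, V, G =>
      ∃ (H : SimpleGraph V) (P : V → Fin 2) (F : Fin 2 → Fin 2 → Prop),
        Symmetric F ∧
        (∀ u v : V, u ≠ v → (G.Adj u v ↔ Xor' (H.Adj u v) (F (P u) (P v)))) ∧
        ∃ (ι : Type) (part : V → ι),
          (∀ u v : V, H.Adj u v → part u = part v) ∧
          ∀ i : ι, FlipdepthLE k {x : V // part x = i} (H.induce {x : V | part x = i})


lemma reach_const {V ι : Type} (H : SimpleGraph V) (f : V → ι)
    (h : ∀ u v, H.Adj u v → f u = f v) {u v : V} (r : H.Reachable u v) : f u = f v := by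
  obtain ⟨p⟩ := r
  induction p with
  | nil => rfl
  | cons a _ ih => exact (h _ _ a).trans ih

lemma reach_sub {V : Type} (p : V → Prop) (H : SimpleGraph V) (K : SimpleGraph {x : V // p x})
    (h : ∀ u v, H.Adj u v → ∀ hu : p u, ∃ hv : p v, K.Adj ⟨u, hu⟩ ⟨v, hv⟩) {u v : V}
    (r : H.Reachable u v) : ∀ hu : p u, ∃ hv : p v, K.Reachable ⟨u, hu⟩ ⟨v, hv⟩ := by
  obtain ⟨q⟩ := r
  induction q with
  | nil => exact fun hu => ⟨hu, SimpleGraph.Reachable.refl _⟩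
  | cons a _ ih =>
    intro hu
    obtain ⟨hv, hk⟩ := h _ _ a hu
    obtain ⟨hw, hr⟩ := ih hv
    exact ⟨hw, hk.reachable.trans hr⟩

/-- The graph obtained by flipping `G` along a labelling. -/
def flipGraph {V α : Type} (G : SimpleGraph V) (P : V → α) (F : α → α → Prop)
    (hF : Symmetric F) : SimpleGraph V where
  Adj u v := u ≠ v ∧ Xor' (G.Adj u v) (F (P u) (P v))
  symm := ⟨fun u v h => by
    refine ⟨h.1.symm, ?_⟩
    have h1 : F (P u) (P v) ↔ F (P v) (P u) := ⟨fun h => hF h, fun h => hF h⟩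
    rw [G.adj_comm, ← h1]
    exact h.2⟩
  loopless := ⟨fun u h => h.1 rfl⟩

lemma isKFlip_flipGraph {V α : Type} (k : ℕ) (e : α ↪ Fin k) (G : SimpleGraph V) (P : V → α)
    (F : α → α → Prop) (hF : Symmetric F) : IsKFlip k G (flipGraph G P F hF) := by
  refine ⟨fun v => e (P v), fun a b => ∃ x y, e x = a ∧ e y = b ∧ F x y, ?_, ?_⟩
  · rintro a b ⟨x, y, hx, hy, h⟩
    exact ⟨y, x, hy, hx, hF h⟩
  · intro u v huv
    have : (∃ x y, e x = e (P u) ∧ e y = e (P v) ∧ F x y) ↔ F (P u) (P v) := by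
      constructor
      · rintro ⟨x, y, hx, hy, h⟩
        rwa [e.injective hx, e.injective hy] at h
      · exact fun h => ⟨_, _, rfl, rfl, h⟩
    beta_reduce
    rw [this]
    simp [flipGraph, huv]

lemma flip_main (k : ℕ) : ∀ (V : Type) (G : SimpleGraph V), FlipdepthLE k V G → ∀ W : Finset V,
    ∃ Wstar : Finset V, Wstar ⊆ W ∧ W.card ≤ Wstar.card ^ (2 ^ k) ∧
      ∃ H : SimpleGraph V, IsKFlip (4 ^ k) G H ∧
        ∀ u ∈ Wstar, ∀ v ∈ Wstar, u ≠ v → ¬ H.Reachable u v := by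
  classical
  induction k with
  | zero =>
    rintro V G ⟨v₀, hv⟩ W
    refine ⟨W, subset_rfl, by simp, G, ⟨fun _ => 0, fun _ _ => False, fun _ _ h => h, ?_⟩, ?_⟩
    · intro u v _
      simp [Xor', Xor]
    · intro u _ v _ huv
      exact absurd ((hv u).trans (hv v).symm) huv
  | succ k ih =>
    rintro V G ⟨H, P, F, hF, hGH, ι, part, hpart, hdep⟩ W
    by_cases hW : W.card ≤ (W.image part).card ^ 2
    · obtain ⟨S, hSW, hinj, hS⟩ : ∃ S ⊆ W, Set.InjOn part S ∧ S.image part = W.image part := by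
        obtain ⟨S, h1, h2, h3⟩ := Finset.exists_subset_injOn_image_eq_of_surjOn W
          (W.image part) (f := part) (by intro x hx; simpa using hx)
        exact ⟨S, by exact_mod_cast h1, h2, by exact_mod_cast h3⟩
      refine ⟨S, hSW, ?_, flipGraph G P F hF, ?_, ?_⟩
      · rw [← hS, Finset.card_image_of_injOn hinj] at hW
        refine hW.trans ?_
        rcases Nat.eq_zero_or_pos S.card with h0 | h0
        · simp [h0]
        · exact Nat.pow_le_pow_right h0 (by rw [pow_succ]; have := Nat.one_le_two_pow (n := k); omega)
      · refine isKFlip_flipGraph _ (Fin.castLEEmb ?_) _ _ _ _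
        rw [pow_succ]
        have := Nat.one_le_pow k 4 (by norm_num)
        omega
      · intro u hu v hv huv hr
        refine huv (hinj hu hv (reach_const _ part ?_ hr))
        rintro x y ⟨hxy, hx⟩
        apply hpart
        rw [hGH x y hxy] at hx
        simp only [Xor', Xor] at hx
        tauto
    · push Not at hW
      have hne : W.Nonempty := by
        rw [← Finset.card_pos]; omega
      obtain ⟨i, -, hi⟩ := Finset.exists_max_image (W.image part)
        (fun i => (W.filter (fun x => part x = i)).card) (hne.image part)
      have hle := Finset.card_le_mul_card_image (f := part) W
        (W.filter (fun x => part x = i)).card hi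
      have hsq : W.card ≤ (W.filter (fun x => part x = i)).card ^ 2 := by
        by_contra hc
        push Not at hc
        generalize (W.filter (fun x => part x = i)).card = f at *
        generalize (W.image part).card = m at *
        generalize W.card = w at *
        have h1 : w ^ 2 ≤ (f * m) ^ 2 := Nat.pow_le_pow_left hle 2
        have h2 : f ^ 2 * m ^ 2 < w * w := Nat.mul_lt_mul'' hc hW
        nlinarith
      obtain ⟨S, hSW, hcard, K, ⟨Q, E, hE, hK⟩, hsep⟩ :=
        ih _ _ (hdep i) (W.subtype (fun x => part x = i))
      rw [Finset.card_subtype] at hcard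
      have hpos : 0 < 4 ^ k := by positivity
      let L : V → Fin (4 ^ k) × Fin 2 × Fin 2 := fun v =>
        if h : part v = i then (Q ⟨v, h⟩, P v, 1) else (⟨0, hpos⟩, P v, 0)
      let R : Fin (4 ^ k) × Fin 2 × Fin 2 → Fin (4 ^ k) × Fin 2 × Fin 2 → Prop := fun a b =>
        Xor' (F a.2.1 b.2.1) (a.2.2 = 1 ∧ b.2.2 = 1 ∧ E a.1 b.1)
      have hR : Symmetric R := by
        intro a b h
        have h1 : F a.2.1 b.2.1 ↔ F b.2.1 a.2.1 := ⟨fun h => hF h, fun h => hF h⟩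
        have h2 : E a.1 b.1 ↔ E b.1 a.1 := ⟨fun h => hE h, fun h => hE h⟩
        simp only [R, Xor', Xor] at h ⊢
        tauto
      refine ⟨S.map (Function.Embedding.subtype _), ?_, ?_, flipGraph G L R hR, ?_, ?_⟩
      · intro x hx
        simp only [Finset.mem_map, Function.Embedding.subtype_apply] at hx
        obtain ⟨y, hy, rfl⟩ := hx
        exact Finset.mem_subtype.1 (hSW hy)
      · rw [Finset.card_map, pow_succ, pow_mul]
        exact hsq.trans (Nat.pow_le_pow_left hcard 2)
      · refine isKFlip_flipGraph _ (Equiv.toEmbedding ?_) _ _ _ _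
        refine Fintype.equivFinOfCardEq ?_
        simp [pow_succ]
      · intro u hu v hv huv hr
        simp only [Finset.mem_map, Function.Embedding.subtype_apply] at hu hv
        obtain ⟨u, hu, rfl⟩ := hu
        obtain ⟨v, hv, rfl⟩ := hv
        refine hsep u hu v hv (fun h => huv (by rw [h])) ?_
        refine (reach_sub (fun x => part x = i) (flipGraph G L R hR) K ?_ hr u.2).2
        rintro x y ⟨hxy, hx⟩ hxi
        rw [hGH x y hxy] at hx
        by_cases hyi : part y = i
        · refine ⟨hyi, ?_⟩
          rw [hK ⟨x, hxi⟩ ⟨y, hyi⟩ (by simpa using hxy)]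
          simp only [L, R, hxi, hyi, dite_true, true_and, Xor', Xor, SimpleGraph.comap_adj,
            Function.Embedding.subtype_apply, SimpleGraph.induce] at hx ⊢
          tauto
        · exfalso
          have := hpart x y
          simp only [L, R, hxi, hyi, dite_true, dite_false, Xor', Xor] at hx
          have h3 : ¬ H.Adj x y := fun h => hyi ((this h).symm.trans hxi)
          simp [h3] at hx

/-- For every `k`, every finite graph `G` of flipdepth at most `k`, and
every `W ⊆ V(G)`, there are `W* ⊆ W` with `|W*| ≥ |W| ^ (1 / 2^k)` and a `4^k`-flip `H` of
`G` such that the vertices of `W*` lie in pairwise distinct connected components of `H`. -/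
theorem flipdepth_distInfty_flat (k n : ℕ) (G : SimpleGraph (Fin n))
    (hG : FlipdepthLE k (Fin n) G) (W : Finset (Fin n)) :
    ∃ Wstar : Finset (Fin n), Wstar ⊆ W ∧
      (W.card : ℝ) ^ ((1 : ℝ) / 2 ^ k) ≤ (Wstar.card : ℝ) ∧
      ∃ H : SimpleGraph (Fin n), IsKFlip (4 ^ k) G H ∧
        ∀ u ∈ Wstar, ∀ v ∈ Wstar, u ≠ v → ¬ H.Reachable u v := by
  obtain ⟨S, h1, h2, h3⟩ := flip_main k (Fin n) G hG W
  refine ⟨S, h1, ?_, h3⟩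
  have h : (W.card : ℝ) ≤ (S.card : ℝ) ^ (2 ^ k) := by exact_mod_cast h2
  calc (W.card : ℝ) ^ ((1 : ℝ) / 2 ^ k)
      ≤ ((S.card : ℝ) ^ (2 ^ k)) ^ ((1 : ℝ) / 2 ^ k) :=
        Real.rpow_le_rpow (by positivity) h (by positivity)
    _ = S.card := by
        have := Real.pow_rpow_inv_natCast (x := (S.card : ℝ)) (n := 2 ^ k) (by positivity)
          (by positivity)
        rw [one_div]
        exact_mod_cast this
end

section
/- For every k ≥ 1, every k-flip of a finite path graph has at most 8k + 1 connected components. -/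
set_option autoImplicit false

theorem exists_avoid {n : ℕ} (A : Finset (Fin n)) (hA : 4 < A.card) (x y z w : ℕ) :
    ∃ a ∈ A, a.val ≠ x ∧ a.val ≠ y ∧ a.val ≠ z ∧ a.val ≠ w := by
  have h1 : (A.image Fin.val).card = A.card :=
    Finset.card_image_of_injective _ Fin.val_injective
  have h2 : ({x, y, z, w} : Finset ℕ).card ≤ 4 := Finset.card_le_four
  obtain ⟨e, he, hne⟩ := Finset.exists_mem_notMem_of_card_lt_card
    (s := ({x, y, z, w} : Finset ℕ)) (t := A.image Fin.val) (by omega)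
  obtain ⟨a, ha, rfl⟩ := Finset.mem_image.1 he
  simp only [Finset.mem_insert, Finset.mem_singleton, not_or] at hne
  exact ⟨a, ha, hne⟩

theorem reach_step {n k : ℕ} (H : SimpleGraph (Fin n)) (P : Fin n → Fin k)
    (F : Fin k → Fin k → Prop) (hF : Symmetric F)
    (hH : ∀ u v : Fin n, u ≠ v →
      (H.Adj u v ↔ Xor' ((SimpleGraph.pathGraph n).Adj u v) (F (P u) (P v))))
    (u v : Fin n) (huv : u.val + 1 = v.val)
    (hu : 4 < (Finset.univ.filter (fun w => P w = P u)).card)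
    (hv : 4 < (Finset.univ.filter (fun w => P w = P v)).card) :
    H.Reachable u v := by
  have key : ∀ a b : Fin n, a.val ≠ b.val → a.val + 1 ≠ b.val → b.val + 1 ≠ a.val →
      F (P a) (P b) → H.Reachable a b := by
    intro a b h0 h1 h2 hf
    refine SimpleGraph.Adj.reachable ((hH a b (fun h => h0 (by rw [h]))).2 (Or.inr ⟨hf, ?_⟩))
    rw [SimpleGraph.pathGraph_adj]
    omega
  by_cases hf : F (P u) (P v)
  · by_cases hp : P u = P v
    · obtain ⟨a, ha, h1, h2, h3, h4⟩ := exists_avoid _ hu u.val v.val (u.val - 1) (v.val + 1)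
      have hpa : P a = P u := (Finset.mem_filter.1 ha).2
      refine (key u a (by omega) (by omega) (by omega) ?_).trans
        (key a v (by omega) (by omega) (by omega) ?_)
      · rw [hpa]; rw [← hp] at hf; exact hf
      · rw [hpa]; exact hf
    · obtain ⟨b, hb, h1, h2, -, -⟩ := exists_avoid _ hv v.val (u.val - 1) 0 0
      have hpb : P b = P v := (Finset.mem_filter.1 hb).2
      obtain ⟨a, ha, g1, g2, g3, g4⟩ :=
        exists_avoid _ hu u.val (v.val + 1) (b.val - 1) (b.val + 1)
      have hpa : P a = P u := (Finset.mem_filter.1 ha).2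
      have ne : ∀ c d : Fin n, P c = P u → P d = P v → c.val ≠ d.val := by
        intro c d hc hd h
        exact hp (by rw [← hc, ← hd, Fin.ext h])
      have n1 := ne u b rfl hpb
      have n2 := ne a b hpa hpb
      have n3 := ne a v hpa rfl
      refine ((key u b (by omega) (by omega) (by omega) ?_).trans
        (key a b (by omega) (by omega) (by omega) ?_).symm).trans
        (key a v (by omega) (by omega) (by omega) ?_)
      · rw [hpb]; exact hf
      · rw [hpa, hpb]; exact hf
      · rw [hpa]; exact hf
  · refine SimpleGraph.Adj.reachable ((hH u v (fun h => ?_)).2 (Or.inl ⟨?_, hf⟩))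
    · rw [h] at huv; omega
    · rw [SimpleGraph.pathGraph_adj]; exact Or.inl huv

/-- For every `k ≥ 1`, every `k`-flip of a finite path graph has at most
`8k + 1` connected components. -/
theorem kFlip_of_path_components (k n : ℕ) (hk : 1 ≤ k) (H : SimpleGraph (Fin n))
    (hH : IsKFlip k (SimpleGraph.pathGraph n) H) :
    Nat.card H.ConnectedComponent ≤ 8 * k + 1 := by
  classical
  obtain ⟨P, F, hF, hH⟩ := hH
  let S : Finset (Fin n) := Finset.univ.filter
    (fun v => (Finset.univ.filter (fun w => P w = P v)).card ≤ 4)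
  have hS : S.card ≤ 4 * k := by
    have := Finset.card_le_mul_card_image_of_maps_to (s := S) (t := Finset.univ) (f := P)
      (fun _ _ => Finset.mem_univ _) 4 (by
        intro p _
        by_cases he : (S.filter (fun v => P v = p)).Nonempty
        · obtain ⟨v, hv⟩ := he
          obtain ⟨hv1, hv2⟩ := Finset.mem_filter.1 hv
          have h4 := (Finset.mem_filter.1 hv1).2
          rw [hv2] at h4
          exact (Finset.card_le_card
            (Finset.filter_subset_filter _ (Finset.subset_univ S))).trans h4
        · rw [Finset.not_nonempty_iff_eq_empty] at he
          rw [he]; simp)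
    simpa using this
  let T : Finset ℕ := {0} ∪ (S.image Fin.val ∪ S.image (fun v => v.val + 1))
  have hT : T.card ≤ 8 * k + 1 := by
    have a1 : T.card ≤ _ := Finset.card_union_le _ _
    have a2 := Finset.card_union_le (S.image Fin.val) (S.image (fun v => v.val + 1))
    have a3 : (S.image Fin.val).card ≤ _ := Finset.card_image_le
    have a4 : (S.image (fun v : Fin n => v.val + 1)).card ≤ _ := Finset.card_image_le
    have a5 : ({0} : Finset ℕ).card = 1 := Finset.card_singleton 0
    omega
  have main : ∀ m : ℕ, ∀ hm : m < n, ∃ j : Fin n, j.val ∈ T ∧ H.Reachable j ⟨m, hm⟩ := by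
    intro m
    induction m with
    | zero => exact fun hm => ⟨⟨0, hm⟩, by simp [T], SimpleGraph.Reachable.refl _⟩
    | succ m ih =>
      intro hm
      by_cases h1 : (⟨m, by omega⟩ : Fin n) ∈ S
      · refine ⟨⟨m + 1, hm⟩, ?_, SimpleGraph.Reachable.refl _⟩
        exact Finset.mem_union_right _ (Finset.mem_union_right _
          (Finset.mem_image.2 ⟨_, h1, rfl⟩))
      by_cases h2 : (⟨m + 1, hm⟩ : Fin n) ∈ S
      · refine ⟨⟨m + 1, hm⟩, ?_, SimpleGraph.Reachable.refl _⟩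
        exact Finset.mem_union_right _ (Finset.mem_union_left _
          (Finset.mem_image.2 ⟨_, h2, rfl⟩))
      obtain ⟨j, hj, hr⟩ := ih (by omega)
      refine ⟨j, hj, hr.trans (reach_step H P F hF hH _ _ rfl ?_ ?_)⟩
      · by_contra h
        exact h1 (Finset.mem_filter.2 ⟨Finset.mem_univ _, not_lt.1 h⟩)
      · by_contra h
        exact h2 (Finset.mem_filter.2 ⟨Finset.mem_univ _, not_lt.1 h⟩)
  have hex : ∀ c : H.ConnectedComponent, ∃ j : Fin n, j.val ∈ T ∧
      H.connectedComponentMk j = c := by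
    intro c
    induction c using SimpleGraph.ConnectedComponent.ind with
    | h v =>
      obtain ⟨j, hj, hr⟩ := main v.val v.isLt
      exact ⟨j, hj, SimpleGraph.ConnectedComponent.sound hr⟩
  choose f hf1 hf2 using hex
  have hinj : Function.Injective (fun c => (⟨(f c).val, hf1 c⟩ : T)) := by
    intro c d h
    have : f c = f d := Fin.ext (by simpa using h)
    rw [← hf2 c, ← hf2 d, this]
  have := Nat.card_le_card_of_injective _ hinj
  rw [Nat.card_eq_fintype_card (α := T), Fintype.card_coe] at this
  omega
end

section
/- Fix k, n, m ≥ 1 and a symbol S ∈ {≤, =}, and let H := H^S_{n,m} be the bipartite graph with sides L = [n] and R = [n]×[m]. For every k-flip H' of H there exist a set X ⊆ L with |X| ≥ n − k and an injective function f : X → L such that for every v ∈ X, the neighborhood of v in H' intersects Ñ(f(v)) in at least m/2 vertices, i.e., |N^{H'}(v) ∩ Ñ(f(v))| ≥ m/2. -/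
set_option autoImplicit false

/-- The bipartite graph `H^S_{n,m}` with sides `L = Fin n` and `R = Fin n × Fin m`, where
`i ∈ L` and `(i', j) ∈ R` are adjacent if and only if `S i i'` holds. -/
def bipHalf (n m : ℕ) (S : Fin n → Fin n → Prop) : SimpleGraph (Fin n ⊕ Fin n × Fin m) :=
  SimpleGraph.fromRel fun u v =>
    match u, v with
    | Sum.inl i, Sum.inr p => S i p.1
    | _, _ => False

/-- Fix `k, n, m ≥ 1` and a symbol `S ∈ {≤, =}`, and let `H := H^S_{n,m}`.
For every `k`-flip `H'` of `H` there exist `X ⊆ L` with `|X| ≥ n − k` and an injective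
`f : X → L` such that every `v ∈ X` has at least `m / 2` neighbors in `H'` inside
`Ñ(f v) = {(i', j) : i' ≤ f v}`. -/
theorem halfGraph_flip_large_neighborhoods (k n m : ℕ) (hk : 1 ≤ k) (hn : 1 ≤ n)
    (hm : 1 ≤ m) (S : Fin n → Fin n → Prop)
    (hS : (∀ a b : Fin n, S a b ↔ a ≤ b) ∨ (∀ a b : Fin n, S a b ↔ a = b))
    (H' : SimpleGraph (Fin n ⊕ Fin n × Fin m)) (hflip : IsKFlip k (bipHalf n m S) H') :
    ∃ X : Finset (Fin n), n - k ≤ X.card ∧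
      ∃ f : Fin n → Fin n, Set.InjOn f ↑X ∧
        ∀ v ∈ X, m ≤ 2 * Set.ncard {p : Fin n × Fin m |
          H'.Adj (Sum.inl v) (Sum.inr p) ∧ p.1 ≤ f v} := by
  classical
  obtain ⟨P, F, -, hF⟩ := hflip
  have hadj : ∀ (v : Fin n) (p : Fin n × Fin m), H'.Adj (Sum.inl v) (Sum.inr p) ↔
      Xor' (S v p.1) (F (P (Sum.inl v)) (P (Sum.inr p))) := by
    intro v p
    rw [hF _ _ (by simp)]
    simp [bipHalf, SimpleGraph.fromRel_adj]
  have key : ∀ a b : Fin n, a < b → P (Sum.inl a) = P (Sum.inl b) →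
      m ≤ Set.ncard {p : Fin n × Fin m | H'.Adj (Sum.inl a) (Sum.inr p) ∧ p.1 ≤ a} +
        Set.ncard {p : Fin n × Fin m | H'.Adj (Sum.inl b) (Sum.inr p) ∧ p.1 ≤ b} := by
    intro a b hab hP
    refine le_trans ?_ (Set.ncard_union_le _ _)
    have h1 : Set.ncard (Set.range fun j : Fin m => (a, j)) = m := by
      rw [← Set.image_univ, Set.ncard_image_of_injective _ (Prod.mk_right_injective a)]
      simp
    conv_lhs => rw [← h1]
    refine Set.ncard_le_ncard ?_ (Set.toFinite _)
    rintro _ ⟨j, rfl⟩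
    have haa : S a a := by
      rcases hS with h | h <;> simp [h]
    have hba : ¬ S b a := by
      rcases hS with h | h
      · simp [h, hab]
      · simp [h, hab.ne']
    simp only [Set.mem_union, Set.mem_setOf_eq, hadj, hP, le_refl, hab.le, and_true, Xor', haa, hba]
    simp only [Xor]
    tauto
  let good : Fin n → Prop := fun v => m ≤ 2 * Set.ncard {p : Fin n × Fin m |
          H'.Adj (Sum.inl v) (Sum.inr p) ∧ p.1 ≤ v}
  refine ⟨Finset.univ.filter good, ?_, id, Function.injective_id.injOn, ?_⟩
  · have hc : (Finset.univ.filter fun v => ¬ good v).card ≤ k := by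
      have := Finset.card_le_card_of_injOn (s := Finset.univ.filter fun v => ¬ good v)
        (t := (Finset.univ : Finset (Fin k))) (fun v => P (Sum.inl v)) (by simp) (by
          intro a ha b hb hP
          simp only [Finset.coe_filter, Finset.mem_univ, true_and, Set.mem_setOf_eq, good] at ha hb
          by_contra hne
          rcases lt_or_gt_of_ne hne with h | h
          · have := key a b h hP
            omega
          · have := key b a h hP.symm
            omega)
      simpa using this
    have := Finset.card_filter_add_card_filter_not (s := (Finset.univ : Finset (Fin n))) good
    simp only [Finset.card_univ, Fintype.card_fin] at this
    omega
  · intro v hv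
    exact (Finset.mem_filter.mp hv).2
end

section
/- Fix k, r, ℓ ≥ 1 and let G_{r,ℓ} be the disjoint union of ℓ paths, each of length r (with r+1 vertices), where in each path one endpoint is designated as its source and the other as its target. If G' is a k-flip of G_{r,ℓ}, then at least ℓ − rk of the ℓ target vertices are joined in G' to some source vertex by a path of length r. -/
set_option autoImplicit false

/-- The disjoint union `G_{r,l}` of `l` paths, each of length `r` (with `r + 1` vertices):
vertex `(i, t)` is the `t`-th vertex of the `i`-th path; `(i, 0)` is its source and
`(i, Fin.last r)` is its target. -/
def pathsUnion (r l : ℕ) : SimpleGraph (Fin l × Fin (r + 1)) :=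
  SimpleGraph.fromRel fun u v => u.1 = v.1 ∧ (v.2 : ℕ) = (u.2 : ℕ) + 1

theorem pathsUnion_layers (k r l : ℕ) (G' : SimpleGraph (Fin l × Fin (r + 1)))
    (hflip : IsKFlip k (pathsUnion r l) G') (t : ℕ) : ∀ ht : t < r + 1,
    ∃ S : Finset (Fin l), l ≤ S.card + t * k ∧ ∀ i ∈ S,
      ∃ (j : Fin l) (p : G'.Walk (i, ⟨t, ht⟩) (j, 0)), p.IsPath ∧ p.length = t ∧
        ∀ v ∈ p.support, (v.2 : ℕ) ≤ t := by
  classical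
  induction t with
  | zero =>
    intro ht
    refine ⟨Finset.univ, by simp, fun i _ => ⟨i, SimpleGraph.Walk.nil, by simp, by simp, ?_⟩⟩
    intro v hv
    simp at hv
    simp [hv]
  | succ t ih =>
    intro ht
    have ht' : t < r + 1 := by omega
    obtain ⟨S, hS, hp⟩ := ih ht'
    obtain ⟨P, F, -, hF⟩ := hflip
    have hne : ∀ a b : Fin l, ((a, ⟨t + 1, ht⟩) : Fin l × Fin (r + 1)) ≠ (b, ⟨t, ht'⟩) := by
      intro a b h
      simp at h
    have hadj : ∀ a b : Fin l, G'.Adj (a, ⟨t + 1, ht⟩) (b, ⟨t, ht'⟩) ↔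
        Xor' (a = b) (F (P (a, ⟨t + 1, ht⟩)) (P (b, ⟨t, ht'⟩))) := by
      intro a b
      rw [hF _ _ (hne a b)]
      have : (pathsUnion r l).Adj (a, ⟨t + 1, ht⟩) (b, ⟨t, ht'⟩) ↔ a = b := by
        simp only [pathsUnion, SimpleGraph.fromRel_adj]
        constructor
        · rintro ⟨-, h | h⟩
          · exact h.1
          · exact h.1.symm
        · intro h
          exact ⟨hne a b, Or.inr ⟨h.symm, by simp⟩⟩
      rw [this]
    let S' : Finset (Fin l) :=
      Finset.univ.filter fun a => ∃ b ∈ S, G'.Adj (a, ⟨t + 1, ht⟩) (b, ⟨t, ht'⟩)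
    refine ⟨S', ?_, ?_⟩
    · have h1 : (S \ S').card ≤ k := by
        have := Finset.card_le_card_of_injOn (s := S \ S') (t := (Finset.univ : Finset (Fin k)))
          (fun a => P (a, ⟨t + 1, ht⟩)) (fun _ _ => by simp) ?_
        · simpa using this
        · intro a ha b hb hab
          simp only [S', Finset.coe_sdiff, Set.mem_sdiff, Finset.mem_coe, Finset.mem_filter,
            Finset.mem_univ, true_and, not_exists, not_and] at ha hb
          by_contra hn
          have h2 := ha.2 a ha.1
          have h3 := hb.2 a ha.1
          rw [hadj] at h2 h3
          simp only at hab
          rw [← hab] at h3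
          simp only [Xor', Xor] at h2 h3
          have hn' : ¬ b = a := fun h => hn h.symm
          tauto
      have h2 : S.card ≤ (S \ S').card + S'.card := by
        have := Finset.card_le_card_sdiff_add_card (s := S) (t := S')
        omega
      have : (t + 1) * k = t * k + k := by ring
      omega
    · intro a ha
      simp only [S', Finset.mem_filter, Finset.mem_univ, true_and] at ha
      obtain ⟨b, hb, hab⟩ := ha
      obtain ⟨j, p, hpath, hlen, hsup⟩ := hp b hb
      refine ⟨j, SimpleGraph.Walk.cons hab p, ?_, by simp [hlen], ?_⟩
      · rw [SimpleGraph.Walk.cons_isPath_iff]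
        refine ⟨hpath, fun h => ?_⟩
        have := hsup _ h
        simp at this
      · intro v hv
        rw [SimpleGraph.Walk.support_cons, List.mem_cons] at hv
        rcases hv with rfl | hv
        · simp
        · have := hsup v hv
          omega

/-- Fix `k, r, l ≥ 1`.  If `G'` is a `k`-flip of `G_{r,l}`, then at least
`l − r·k` of the `l` target vertices are joined in `G'` to some source vertex by a path of
length `r`. -/
theorem flip_of_paths_targets_reach_sources (k r l : ℕ) (hk : 1 ≤ k) (hr : 1 ≤ r)
    (hl : 1 ≤ l) (G' : SimpleGraph (Fin l × Fin (r + 1)))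
    (hflip : IsKFlip k (pathsUnion r l) G') :
    l - r * k ≤ Set.ncard {i : Fin l |
      ∃ (j : Fin l) (p : G'.Walk (i, Fin.last r) (j, 0)), p.IsPath ∧ p.length = r} := by
  obtain ⟨S, hS, hp⟩ := pathsUnion_layers k r l G' hflip r (Nat.lt_succ_self r)
  have h : S.card ≤ Set.ncard {i : Fin l |
      ∃ (j : Fin l) (p : G'.Walk (i, Fin.last r) (j, 0)), p.IsPath ∧ p.length = r} := by
    rw [← Set.ncard_coe_finset]
    refine Set.ncard_le_ncard (fun i hi => ?_) (Set.toFinite _)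
    obtain ⟨j, p, h1, h2, -⟩ := hp i hi
    exact ⟨j, p, h1, h2⟩
  omega
end

section
/- For all r, n ≥ 1, every flipped star r-crossing of order n, every flipped clique r-crossing of order n, and every flipped half-graph r-crossing of order n has twin-width at least n^(1/(r+1)) − 2. -/
set_option autoImplicit false

/-- The vertex set of an `r`-crossing of order `n`: roots `a_1, …, a_n` (left summand),
path vertices `p_{i,j,t}` for `i, j ∈ [n]`, `t ∈ [r]` (middle summand), and
roots `b_1, …, b_n` (right summand). -/
abbrev CrossVert (n r : ℕ) : Type := Fin n ⊕ ((Fin n × Fin n × Fin r) ⊕ Fin n)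

/-- The layer of a vertex of an `r`-crossing: the `a`-roots form layer `0`, the `t`-th
vertices of the paths form layer `t`, and the `b`-roots form layer `r + 1`. -/
def layer {n r : ℕ} : CrossVert n r → Fin (r + 2)
  | Sum.inl _ => 0
  | Sum.inr (Sum.inl (_, _, t)) => t.succ.castSucc
  | Sum.inr (Sum.inr _) => Fin.last (r + 1)

/-- The star `r`-crossing of order `n`: the `r`-subdivision of `K_{n,n}`.  Each root `a_i`
is adjacent to the first vertices of the paths `π_{i,j}`, the paths are induced paths with
`r` vertices, and each root `b_j` is adjacent to the last vertices of the paths `π_{i,j}`. -/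
def starCross (n r : ℕ) : SimpleGraph (CrossVert n r) :=
  SimpleGraph.fromRel fun u v =>
    match u, v with
    | Sum.inl i, Sum.inr (Sum.inl (i', _, t)) => i = i' ∧ (t : ℕ) = 0
    | Sum.inr (Sum.inr j), Sum.inr (Sum.inl (_, j', t)) => j = j' ∧ (t : ℕ) + 1 = r
    | Sum.inr (Sum.inl (i, j, t)), Sum.inr (Sum.inl (i', j', t')) =>
        i = i' ∧ j = j' ∧ (t' : ℕ) = (t : ℕ) + 1
    | _, _ => False

/-- The clique `r`-crossing of order `n`: obtained from the star `r`-crossing by turning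
the neighborhood of each root into a clique. -/
def cliqueCross (n r : ℕ) : SimpleGraph (CrossVert n r) :=
  SimpleGraph.fromRel fun u v =>
    match u, v with
    | Sum.inl i, Sum.inr (Sum.inl (i', _, t)) => i = i' ∧ (t : ℕ) = 0
    | Sum.inr (Sum.inr j), Sum.inr (Sum.inl (_, j', t)) => j = j' ∧ (t : ℕ) + 1 = r
    | Sum.inr (Sum.inl (i, j, t)), Sum.inr (Sum.inl (i', j', t')) =>
        (i = i' ∧ j = j' ∧ (t' : ℕ) = (t : ℕ) + 1) ∨
        (i = i' ∧ (t : ℕ) = 0 ∧ (t' : ℕ) = 0 ∧ j ≠ j') ∨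
        (j = j' ∧ (t : ℕ) + 1 = r ∧ (t' : ℕ) + 1 = r ∧ i ≠ i')
    | _, _ => False

/-- The half-graph `r`-crossing of order `n`: as the star `r`-crossing, except that `a_i`
is adjacent to the first vertices of the paths `π_{i',j}` with `i ≤ i'`, and `b_j` is
adjacent to the last vertices of the paths `π_{i,j'}` with `j ≤ j'`. -/
def halfCross (n r : ℕ) : SimpleGraph (CrossVert n r) :=
  SimpleGraph.fromRel fun u v =>
    match u, v with
    | Sum.inl i, Sum.inr (Sum.inl (i', _, t)) => i ≤ i' ∧ (t : ℕ) = 0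
    | Sum.inr (Sum.inr j), Sum.inr (Sum.inl (_, j', t)) => j ≤ j' ∧ (t : ℕ) + 1 = r
    | Sum.inr (Sum.inl (i, j, t)), Sum.inr (Sum.inl (i', j', t')) =>
        i = i' ∧ j = j' ∧ (t' : ℕ) = (t : ℕ) + 1
    | _, _ => False

/-- `H` is obtained from the `r`-crossing `G` by a flip whose parts are the `r + 2` layers. -/
def IsLayerFlip {n r : ℕ} (G H : SimpleGraph (CrossVert n r)) : Prop :=
  ∃ F : Fin (r + 2) → Fin (r + 2) → Prop, Symmetric F ∧
    ∀ u v : CrossVert n r, u ≠ v →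
      (H.Adj u v ↔ Xor' (G.Adj u v) (F (layer u) (layer v)))

/-- Two vertex sets are homogeneously connected in `G`:
either complete or anticomplete to each other. -/
def Homog {V : Type} (G : SimpleGraph V) (A B : Finset V) : Prop :=
  (∀ u ∈ A, ∀ v ∈ B, G.Adj u v) ∨ (∀ u ∈ A, ∀ v ∈ B, ¬ G.Adj u v)

/-- The partition `P` has red degree at most `d` with respect to `G`: every part is
inhomogeneously connected to at most `d` other parts. -/
def RedDegLE {V : Type} [Fintype V] [DecidableEq V] (G : SimpleGraph V)
    (P : Finpartition (Finset.univ : Finset V)) (d : ℕ) : Prop :=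
  ∀ A ∈ P.parts,
    Set.ncard {B : Finset V | B ∈ P.parts ∧ B ≠ A ∧ ¬ Homog G A B} ≤ d

/-- `G` has twin-width at most `d`: there is a contraction sequence `P 0, …, P (|V| - 1)`
(starting with singletons, ending with one part, each step merging two parts) all of whose
partitions have red degree at most `d`. -/
def TwwLE {V : Type} [Fintype V] [DecidableEq V] (G : SimpleGraph V) (d : ℕ) : Prop :=
  ∃ P : ℕ → Finpartition (Finset.univ : Finset V),
    (∀ A ∈ (P 0).parts, A.card = 1) ∧
    (1 ≤ Fintype.card V → (P (Fintype.card V - 1)).parts = {Finset.univ}) ∧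
    (∀ i : ℕ, i + 1 < Fintype.card V →
      ∃ A ∈ (P i).parts, ∃ B ∈ (P i).parts, A ≠ B ∧
        (P (i + 1)).parts = insert (A ∪ B) ((((P i).parts).erase A).erase B)) ∧
    (∀ i : ℕ, i < Fintype.card V → RedDegLE G (P i) d)

lemma flip_dist {n r : ℕ} {G H : SimpleGraph (CrossVert n r)} (h : IsLayerFlip G H)
    {u u' v : CrossVert n r} (hl : layer u = layer u') (hu : u ≠ v) (hu' : u' ≠ v)
    (h1 : G.Adj u v) (h2 : ¬ G.Adj u' v) : ¬ (H.Adj u v ↔ H.Adj u' v) := by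
  obtain ⟨F, -, hF⟩ := h
  rw [hF u v hu, hF u' v hu', hl]
  unfold Xor' Xor
  tauto

/-- The vertices `g j`, each split by two vertices of the part `A`, lie in few parts. -/
lemma card_parts_le {V : Type} [Fintype V] [DecidableEq V] {H : SimpleGraph V}
    {P : Finpartition (Finset.univ : Finset V)} {d n : ℕ} (hP : RedDegLE H P d)
    {A : Finset V} (hA : A ∈ P.parts) (S : Finset (Fin n)) (g : Fin n → V)
    (hS : ∀ j ∈ S, ∃ x ∈ A, ∃ y ∈ A, ¬ (H.Adj x (g j) ↔ H.Adj y (g j))) :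
    (S.image (fun j => P.part (g j))).card ≤ d + 1 := by
  have h1 := hP A hA
  have hsub : ((S.image (fun j => P.part (g j))).erase A : Set (Finset V)) ⊆
      {B : Finset V | B ∈ P.parts ∧ B ≠ A ∧ ¬ Homog H A B} := by
    intro B hB
    simp only [Finset.coe_erase, Finset.coe_image, Set.mem_sdiff, Set.mem_image,
      Finset.mem_coe, Set.mem_singleton_iff] at hB
    obtain ⟨⟨j, hj, rfl⟩, hne⟩ := hB
    refine ⟨P.part_mem.2 (Finset.mem_univ _), hne, ?_⟩
    obtain ⟨x, hx, y, hy, hxy⟩ := hS j hj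
    have hg : g j ∈ P.part (g j) := P.mem_part (Finset.mem_univ _)
    rintro (hh | hh)
    · exact hxy ⟨fun _ => hh y hy _ hg, fun _ => hh x hx _ hg⟩
    · exact hxy ⟨fun q => absurd q (hh x hx _ hg), fun q => absurd q (hh y hy _ hg)⟩
  have h2 := Set.ncard_le_ncard hsub (Set.toFinite _)
  rw [Set.ncard_coe_finset] at h2
  have h3 := Finset.pred_card_le_card_erase (s := S.image (fun j => P.part (g j))) (a := A)
  omega

lemma step {V : Type} [Fintype V] [DecidableEq V] {H : SimpleGraph V}
    {P : Finpartition (Finset.univ : Finset V)} {d n : ℕ} (hP : RedDegLE H P d)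
    {A : Finset V} (hA : A ∈ P.parts) (S : Finset (Fin n)) (hne : S.Nonempty) (g : Fin n → V)
    (hS : ∀ j ∈ S, ∃ x ∈ A, ∃ y ∈ A, ¬ (H.Adj x (g j) ↔ H.Adj y (g j))) :
    ∃ B ∈ P.parts, ∃ J ⊆ S, (∀ j ∈ J, g j ∈ B) ∧ S.card ≤ (d + 1) * J.card := by
  have h1 := card_parts_le hP hA S g hS
  by_contra hcon
  push Not at hcon
  have hlt : ∀ B ∈ S.image (fun j => P.part (g j)),
      (d + 1) * (S.filter (fun j => P.part (g j) = B)).card < S.card := by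
    intro B hB
    obtain ⟨j, hj, rfl⟩ := Finset.mem_image.1 hB
    refine hcon (P.part (g j)) (P.part_mem.2 (Finset.mem_univ _)) _ (Finset.filter_subset _ _) ?_
    intro k hk
    rw [← (Finset.mem_filter.1 hk).2]
    exact P.mem_part (Finset.mem_univ _)
  have hcard := Finset.card_eq_sum_card_image (fun j => P.part (g j)) S
  have hsum := Finset.sum_lt_sum_of_nonempty (hne.image (fun j => P.part (g j))) hlt
  rw [← Finset.mul_sum, ← hcard, Finset.sum_const, smul_eq_mul] at hsum
  have := Nat.mul_le_mul_right S.card h1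
  omega

lemma core {V : Type} [Fintype V] [DecidableEq V] {H : SimpleGraph V}
    {P : Finpartition (Finset.univ : Finset V)} {d n r : ℕ} (hP : RedDegLE H P d)
    (hn : 1 ≤ n) (hr : 1 ≤ r)
    {A : Finset V} (hA : A ∈ P.parts) (x y : V) (hx : x ∈ A) (hy : y ∈ A)
    (f : Fin r → Fin n → V) (b : Fin n → V)
    (h0 : ∀ j, ¬ (H.Adj x (f ⟨0, hr⟩ j) ↔ H.Adj y (f ⟨0, hr⟩ j)))
    (hs : ∀ (t : ℕ) (ht : t + 1 < r) (j j' : Fin n), j ≠ j' →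
      ¬ (H.Adj (f ⟨t, by omega⟩ j) (f ⟨t + 1, ht⟩ j) ↔
         H.Adj (f ⟨t, by omega⟩ j') (f ⟨t + 1, ht⟩ j)))
    (hl : ∀ j j' : Fin n, j' < j →
      ¬ (H.Adj (f ⟨r - 1, by omega⟩ j) (b j) ↔ H.Adj (f ⟨r - 1, by omega⟩ j') (b j)))
    (j1 : Fin n) (hj1 : ∀ C ∈ P.parts, ∀ j j' : Fin n, j ≠ j1 → j' ≠ j1 →
      b j ∈ C → b j' ∈ C → j = j') :
    n ≤ (d + 2) ^ (r + 1) := by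
  have arith : ∀ t, t < r → (d + 1) ^ (t + 1) * (d + 3) ≤ (d + 2) ^ (r + 1) := by
    intro t ht
    calc (d + 1) ^ (t + 1) * (d + 3) = (d + 1) ^ t * ((d + 1) * (d + 3)) := by ring
      _ ≤ (d + 2) ^ t * (d + 2) ^ 2 :=
          Nat.mul_le_mul (Nat.pow_le_pow_left (by omega) _) (by nlinarith)
      _ = (d + 2) ^ (t + 2) := by ring
      _ ≤ (d + 2) ^ (r + 1) := Nat.pow_le_pow_right (by omega) (by omega)
  by_contra hcon
  push Not at hcon
  have main : ∀ (t : ℕ) (ht : t < r), ∃ B ∈ P.parts, ∃ J : Finset (Fin n),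
      (∀ j ∈ J, f ⟨t, ht⟩ j ∈ B) ∧ n ≤ (d + 1) ^ (t + 1) * J.card := by
    intro t
    induction t with
    | zero =>
      intro ht
      have : Nonempty (Fin n) := ⟨⟨0, hn⟩⟩
      obtain ⟨B, hB, J, -, hJ, hc⟩ := step hP hA Finset.univ Finset.univ_nonempty
        (f ⟨0, hr⟩) (fun j _ => ⟨x, hx, y, hy, h0 j⟩)
      refine ⟨B, hB, J, hJ, ?_⟩
      simpa using hc
    | succ t ih =>
      intro ht
      obtain ⟨B, hB, J, hJ, hc⟩ := ih (by omega)
      have h2 : 1 < J.card := by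
        by_contra h
        have : (d + 1) ^ (t + 1) * J.card ≤ (d + 1) ^ (t + 1) * (d + 3) :=
          Nat.mul_le_mul_left _ (by omega)
        have := arith t (by omega)
        omega
      obtain ⟨C, hC, K, -, hK, hc'⟩ := step hP hB J (Finset.card_pos.1 (by omega))
        (f ⟨t + 1, ht⟩) (by
          intro j hj
          obtain ⟨j', hj', hne⟩ := Finset.exists_mem_ne h2 j
          exact ⟨_, hJ j hj, _, hJ j' hj', hs t ht j j' hne.symm⟩)
      refine ⟨C, hC, K, hK, hc.trans ?_⟩
      calc _ ≤ (d + 1) ^ (t + 1) * ((d + 1) * K.card) := Nat.mul_le_mul_left _ hc'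
        _ = _ := by ring
  obtain ⟨B, hB, J, hJ, hc⟩ := main (r - 1) (by omega)
  have hJd : J.card ≤ d + 3 := by
    by_contra hbig
    have hne : J.Nonempty := Finset.card_pos.1 (by omega)
    have h1 := card_parts_le hP hB (J.erase (J.min' hne)) b (by
      intro j hj
      exact ⟨_, hJ j (Finset.mem_of_mem_erase hj), _, hJ _ (J.min'_mem hne),
        hl j _ (Finset.min'_lt_of_mem_erase_min' J hne hj)⟩)
    have h2 : ((J.erase (J.min' hne)).erase j1).card ≤
        ((J.erase (J.min' hne)).image (fun j => P.part (b j))).card := by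
      apply Finset.card_le_card_of_injOn (fun j => P.part (b j))
      · intro j hj
        exact Finset.mem_coe.2 (Finset.mem_image_of_mem _ (Finset.mem_of_mem_erase hj))
      · intro j hj j' hj' he
        have he' : P.part (b j) = P.part (b j') := he
        refine hj1 _ (P.part_mem.2 (Finset.mem_univ (b j))) j j' (Finset.ne_of_mem_erase hj)
          (Finset.ne_of_mem_erase hj') (P.mem_part (Finset.mem_univ _)) ?_
        rw [he']
        exact P.mem_part (Finset.mem_univ _)
    have h3 := Finset.pred_card_le_card_erase (s := J.erase (J.min' hne)) (a := j1)
    have h4 := Finset.pred_card_le_card_erase (s := J) (a := J.min' hne)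
    omega
  have h5 := arith (r - 1) (by omega)
  have h6 := Nat.mul_le_mul_left ((d + 1) ^ (r - 1 + 1)) hJd
  omega

/-- Roots and path vertices. -/
abbrev va {n : ℕ} (r : ℕ) (i : Fin n) : CrossVert n r := Sum.inl i
abbrev vb {n : ℕ} (r : ℕ) (i : Fin n) : CrossVert n r := Sum.inr (Sum.inr i)
abbrev vp {n r : ℕ} (i j : Fin n) (t : Fin r) : CrossVert n r := Sum.inr (Sum.inl (i, j, t))

/-- The common properties of the three crossings. -/
structure Good {n r : ℕ} (G : SimpleGraph (CrossVert n r)) : Prop where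
  a_adj : ∀ i j t, t.val = 0 → G.Adj (va r i) (vp i j t)
  a_nadj : ∀ i i' j t, i < i' → t.val = 0 → ¬ G.Adj (va r i') (vp i j t)
  b_adj : ∀ i j t, t.val + 1 = r → G.Adj (vb r j) (vp i j t)
  b_nadj : ∀ i j j' t, j < j' → t.val + 1 = r → ¬ G.Adj (vb r j') (vp i j t)
  p_adj : ∀ i j (t t' : Fin r), t'.val = t.val + 1 → G.Adj (vp i j t) (vp i j t')
  p_nadj : ∀ i j i' j' (t t' : Fin r), t'.val = t.val + 1 → (i, j) ≠ (i', j') →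
    ¬ G.Adj (vp i j t) (vp i' j' t')

lemma good_star (n r : ℕ) : Good (starCross n r) := by
  constructor <;> intros <;> simp_all [starCross, SimpleGraph.fromRel_adj] <;> grind

lemma good_half (n r : ℕ) : Good (halfCross n r) := by
  constructor <;> intros <;> simp_all [halfCross, SimpleGraph.fromRel_adj] <;> grind

lemma good_clique (n r : ℕ) : Good (cliqueCross n r) := by
  constructor <;> intros <;> simp_all [cliqueCross, SimpleGraph.fromRel_adj] <;> grind

/-- In a merge step at most one index has to be removed. -/
lemma merge_inj {V : Type} [Fintype V] [DecidableEq V] {n : ℕ} (hn : 1 ≤ n)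
    {P Q : Finpartition (Finset.univ : Finset V)} {A B : Finset V}
    (hA : A ∈ P.parts) (hB : B ∈ P.parts)
    (hQ : Q.parts = insert (A ∪ B) ((P.parts.erase A).erase B)) (b : Fin n → V)
    (hP : ∀ C ∈ P.parts, ∀ j j', b j ∈ C → b j' ∈ C → j = j') :
    ∃ j1 : Fin n, ∀ C ∈ Q.parts, ∀ j j' : Fin n, j ≠ j1 → j' ≠ j1 →
      b j ∈ C → b j' ∈ C → j = j' := by
  have key : ∃ j1 : Fin n, ∀ j, b j ∈ A → j = j1 := by
    by_cases h : ∃ j, b j ∈ A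
    · obtain ⟨j, hj⟩ := h
      exact ⟨j, fun k hk => hP A hA _ _ hk hj⟩
    · push Not at h
      exact ⟨⟨0, hn⟩, fun k hk => absurd hk (h k)⟩
  obtain ⟨j1, h1⟩ := key
  refine ⟨j1, fun C hC j j' hj hj' hjC hjC' => ?_⟩
  rw [hQ] at hC
  rcases Finset.mem_insert.1 hC with rfl | hC
  · refine hP B hB j j' ?_ ?_
    · exact (Finset.mem_union.1 hjC).resolve_left (fun h => hj (h1 _ h))
    · exact (Finset.mem_union.1 hjC').resolve_left (fun h => hj' (h1 _ h))
  · exact hP C (Finset.mem_of_mem_erase (Finset.mem_of_mem_erase hC)) j j' hjC hjC'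

lemma nat_bound {n r d : ℕ} (hr : 1 ≤ r) (hn : 1 ≤ n) {G H : SimpleGraph (CrossVert n r)}
    (hG : Good G) (hF : IsLayerFlip G H) (hd : TwwLE H d) : n ≤ (d + 2) ^ (r + 1) := by
  classical
  obtain ⟨P, hP0, hPl, hPs, hPr⟩ := hd
  rcases Nat.lt_or_ge n 2 with h2 | h2
  · have : 0 < (d + 2) ^ (r + 1) := by positivity
    omega
  let N := Fintype.card (CrossVert n r)
  have hN : 1 ≤ N := Fintype.card_pos_iff.2 ⟨va r ⟨0, hn⟩⟩
  let Ok : ℕ → (Fin n → CrossVert n r) → Prop := fun k b =>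
    ∀ C ∈ (P k).parts, ∀ j j', b j ∈ C → b j' ∈ C → j = j'
  have hex : ∃ k, k < N ∧ ¬ (Ok k (va r) ∧ Ok k (vb r)) := by
    refine ⟨N - 1, by omega, fun h => ?_⟩
    have := h.1 Finset.univ (by rw [hPl hN]; simp) ⟨0, by omega⟩ ⟨1, by omega⟩
      (Finset.mem_univ _) (Finset.mem_univ _)
    simp at this
  have hspec := Nat.find_spec hex
  have hmin := fun m => Nat.find_min hex (m := m)
  generalize Nat.find hex = k at hspec hmin
  obtain ⟨hkN, hbad⟩ := hspec
  have ok0 : ∀ b : Fin n → CrossVert n r, Function.Injective b → Ok 0 b := by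
    intro b hb C hC j j' hj hj'
    obtain ⟨c, rfl⟩ := Finset.card_eq_one.1 (hP0 C hC)
    rw [Finset.mem_singleton] at hj hj'
    exact hb (hj.trans hj'.symm)
  rcases k with _ | k
  · exact absurd ⟨ok0 _ (fun _ _ h => by simpa using h), ok0 _ (fun _ _ h => by simpa using h)⟩ hbad
  have hprev : Ok k (va r) ∧ Ok k (vb r) := by
    by_contra h
    exact hmin k (by omega) ⟨by omega, h⟩
  obtain ⟨A, hA, B, hB, -, hQ⟩ := hPs k hkN
  have hred := hPr (k + 1) hkN
  obtain ⟨ja, hja⟩ := merge_inj hn hA hB hQ (va r) hprev.1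
  obtain ⟨jb, hjb⟩ := merge_inj hn hA hB hQ (vb r) hprev.2
  have getpair : ∀ b : Fin n → CrossVert n r, ¬ Ok (k + 1) b →
      ∃ C ∈ (P (k + 1)).parts, ∃ i i', i < i' ∧ b i ∈ C ∧ b i' ∈ C := by
    intro b h
    simp only [Ok] at h
    push Not at h
    obtain ⟨C, hC, j, j', h1, h2, h3⟩ := h
    rcases lt_or_gt_of_ne h3 with h | h
    · exact ⟨C, hC, j, j', h, h1, h2⟩
    · exact ⟨C, hC, j', j, h, h2, h1⟩
  by_cases hca : Ok (k + 1) (va r)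
  · obtain ⟨C, hC, i, i', hlt, hi, hi'⟩ := getpair _ (fun h => hbad ⟨hca, h⟩)
    refine core hred hn hr hC _ _ hi hi'
      (fun t j => vp j i ⟨r - 1 - t.val, by have := t.2; omega⟩) (va r) ?_ ?_ ?_ ja hja
    · intro j
      exact flip_dist hF rfl (by simp) (by simp) (hG.b_adj _ _ _ (by simp; omega))
        (hG.b_nadj _ _ _ _ hlt (by simp; omega))
    · intro t ht j j' hne
      refine flip_dist hF rfl (by simp; omega) (by simp; omega)
        (hG.p_adj _ _ _ _ (by simp; omega)).symm (fun h => ?_)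
      exact hG.p_nadj _ _ _ _ _ _ (by simp; omega) (by simpa using hne) h.symm
    · intro j j' hlt
      refine flip_dist hF rfl (by simp) (by simp) (hG.a_adj _ _ _ (by simp)).symm (fun h => ?_)
      exact hG.a_nadj _ _ _ _ hlt (by simp) h.symm
  · obtain ⟨C, hC, i, i', hlt, hi, hi'⟩ := getpair _ hca
    refine core hred hn hr hC _ _ hi hi' (fun t j => vp i j t) (vb r) ?_ ?_ ?_ jb hjb
    · intro j
      exact flip_dist hF rfl (by simp) (by simp) (hG.a_adj _ _ _ rfl)
        (hG.a_nadj _ _ _ _ hlt rfl)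
    · intro t ht j j' hne
      exact flip_dist hF rfl (by simp) (by simp) (hG.p_adj _ _ _ _ rfl)
        (hG.p_nadj _ _ _ _ _ _ rfl (by simpa using hne.symm))
    · intro j j' hlt
      refine flip_dist hF rfl (by simp) (by simp)
        (hG.b_adj _ _ _ (by simp; omega)).symm (fun h => ?_)
      exact hG.b_nadj _ _ _ _ hlt (by simp; omega) h.symm

/-- For all `r, n ≥ 1`, every flipped star `r`-crossing of order `n`,
every flipped clique `r`-crossing of order `n`, and every flipped half-graph `r`-crossing of
order `n` has twin-width at least `n^(1/(r+1)) − 2`. -/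
theorem flipped_crossing_twinWidth_lower_bound (r n : ℕ) (hr : 1 ≤ r) (hn : 1 ≤ n)
    (H : SimpleGraph (CrossVert n r))
    (hH : IsLayerFlip (starCross n r) H ∨ IsLayerFlip (cliqueCross n r) H ∨
          IsLayerFlip (halfCross n r) H)
    (d : ℕ) (hd : TwwLE H d) :
    (n : ℝ) ^ ((1 : ℝ) / ((r : ℝ) + 1)) - 2 ≤ (d : ℝ) := by
  have hb : n ≤ (d + 2) ^ (r + 1) := by
    rcases hH with h | h | h
    · exact nat_bound hr hn (good_star n r) h hd
    · exact nat_bound hr hn (good_clique n r) h hd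
    · exact nat_bound hr hn (good_half n r) h hd
  have hb' : (n : ℝ) ≤ ((d : ℝ) + 2) ^ (r + 1) := by exact_mod_cast hb
  have h1 := Real.rpow_le_rpow (z := (1 : ℝ) / ((r : ℝ) + 1)) (by positivity) hb' (by positivity)
  have h2 : (((d : ℝ) + 2) ^ (r + 1)) ^ ((1 : ℝ) / ((r : ℝ) + 1)) = (d : ℝ) + 2 := by
    have := Real.pow_rpow_inv_natCast (x := (d : ℝ) + 2) (n := r + 1) (by positivity) (by omega)
    rw [one_div]
    exact_mod_cast this
  rw [h2] at h1
  linarith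
end

section
/- For every n ≥ 1, the comparability grid of order n+1 has twin-width at least n^(1/2) − 2. -/
set_option autoImplicit false

/-- The comparability grid of order `n`: vertices `a_{i,j}` for `i, j ∈ [n]`, where distinct
`a_{i,j}` and `a_{i',j'}` are adjacent iff `i = i'`, or `j = j'`, or (`i < i' ⟺ j < j'`). -/
def compGrid (n : ℕ) : SimpleGraph (Fin n × Fin n) :=
  SimpleGraph.fromRel fun u v =>
    u.1 = v.1 ∨ u.2 = v.2 ∨ (u.1 < v.1 ↔ u.2 < v.2)

theorem compGrid_adj_iff (N : ℕ) (u v : Fin N × Fin N) :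
    (compGrid N).Adj u v ↔ u ≠ v ∧
      ((u.1.val ≤ v.1.val ∧ u.2.val ≤ v.2.val) ∨ (v.1.val ≤ u.1.val ∧ v.2.val ≤ u.2.val)) := by
  obtain ⟨a, b⟩ := u
  obtain ⟨c, e⟩ := v
  simp only [compGrid, SimpleGraph.fromRel_adj, ne_eq, Prod.mk.injEq, Fin.lt_def, Fin.ext_iff]
  omega

/-- The explicit set of vertices distinguishing two vertices. -/
def distSet (N : ℕ) (i i' lo hi : Fin N) : Finset (Fin N × Fin N) :=
  (Finset.Iio i ×ˢ Finset.Ioc lo hi ∪ Finset.Ioi i' ×ˢ Finset.Ico lo hi) ∪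
    (Finset.Ioc i i' ×ˢ Finset.Iio lo ∪ Finset.Ico i i' ×ˢ Finset.Ioi hi)

theorem distSet_card (n : ℕ) (i i' lo hi : Fin (n + 1)) (h1 : i ≤ i') (h2 : lo ≤ hi) :
    (distSet (n + 1) i i' lo hi).card =
      (i.val * (hi.val - lo.val) + (n - i'.val) * (hi.val - lo.val)) +
      ((i'.val - i.val) * lo.val + (i'.val - i.val) * (n - hi.val)) := by
  rw [Fin.le_def] at h1 h2
  unfold distSet
  rw [Finset.card_union_of_disjoint, Finset.card_union_of_disjoint,
    Finset.card_union_of_disjoint]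
  · simp [Finset.card_product]
  all_goals
    rw [Finset.disjoint_left]
    rintro ⟨x, y⟩
    simp only [Finset.mem_union, Finset.mem_product, Finset.mem_Iio, Finset.mem_Ioi,
      Finset.mem_Ioc, Finset.mem_Ico, Fin.lt_def, Fin.le_def]
    omega

theorem arith_large (n g p k q : ℕ) (f1 : n = g + p) (f2 : n = k + q)
    (h1 : 1 ≤ p ∨ 1 ≤ q) (h2 : 1 ≤ g ∨ 1 ≤ k) : n ≤ g * q + p * k := by
  rcases Nat.eq_zero_or_pos p with hp | hp
  · have e : n = g := by omega
    have hq : 0 < q := by omega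
    have := Nat.le_mul_of_pos_right g hq
    omega
  rcases Nat.eq_zero_or_pos q with hq | hq
  · have e : n = k := by omega
    have := Nat.le_mul_of_pos_left k hp
    omega
  rcases Nat.eq_zero_or_pos g with hg | hg
  · have e : n = p := by omega
    have hk : 0 < k := by omega
    have := Nat.le_mul_of_pos_right p hk
    omega
  rcases Nat.eq_zero_or_pos k with hk | hk
  · have e : n = q := by omega
    have := Nat.le_mul_of_pos_left q hg
    omega
  have t1 : g + q ≤ g * q + 1 := by
    obtain ⟨x, rfl⟩ := Nat.exists_eq_add_of_le hg
    obtain ⟨y, rfl⟩ := Nat.exists_eq_add_of_le hq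
    have := Nat.zero_le (x * y)
    ring_nf
    omega
  have t2 : p + k ≤ p * k + 1 := by
    obtain ⟨x, rfl⟩ := Nat.exists_eq_add_of_le hp
    obtain ⟨y, rfl⟩ := Nat.exists_eq_add_of_le hk
    have := Nat.zero_le (x * y)
    ring_nf
    omega
  omega

theorem distSet_large (n : ℕ) (i i' lo hi : Fin (n + 1)) (h1 : i ≤ i') (h2 : lo ≤ hi)
    (hne : i ≠ i' ∨ lo ≠ hi)
    (hc : ¬ (i.val = 0 ∧ i'.val = n ∧ lo.val = 0 ∧ hi.val = n)) :
    n ≤ (distSet (n + 1) i i' lo hi).card := by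
  rw [distSet_card n i i' lo hi h1 h2]
  rw [Fin.le_def] at h1 h2
  have hi1 := i'.isLt
  have hh1 := hi.isLt
  simp only [ne_eq, Fin.ext_iff] at hne
  generalize i.val = a at *
  generalize i'.val = a' at *
  generalize lo.val = b at *
  generalize hi.val = b' at *
  obtain ⟨p, rfl⟩ := Nat.exists_eq_add_of_le h1
  obtain ⟨q, rfl⟩ := Nat.exists_eq_add_of_le h2
  obtain ⟨r, hr⟩ := Nat.exists_eq_add_of_le (Nat.lt_succ_iff.mp hi1)
  obtain ⟨s, hs⟩ := Nat.exists_eq_add_of_le (Nat.lt_succ_iff.mp hh1)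
  have e1 : n - (a + p) = r := by omega
  have e2 : n - (b + q) = s := by omega
  have e3 : a + p - a = p := by omega
  have e4 : b + q - b = q := by omega
  rw [e1, e2, e3, e4]
  have key : a * q + r * q + (p * b + p * s) = (a + r) * q + p * (b + s) := by ring
  rw [key]
  obtain ⟨g, hg⟩ : ∃ g, a + r = g := ⟨_, rfl⟩
  obtain ⟨k, hk⟩ : ∃ k, b + s = k := ⟨_, rfl⟩
  rw [hg, hk]
  have f1 : n = g + p := by omega
  have f2 : n = k + q := by omega
  exact arith_large n g p k q f1 f2 (by omega) (by omega)

/-- Two vertices are opposite corners of the grid. -/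
def OppCorner (n : ℕ) (u v : Fin (n + 1) × Fin (n + 1)) : Prop :=
  (min u.1 v.1).val = 0 ∧ (max u.1 v.1).val = n ∧ (min u.2 v.2).val = 0 ∧ (max u.2 v.2).val = n

theorem distinguish (n : ℕ) (u v : Fin (n + 1) × Fin (n + 1)) (w : Fin (n + 1) × Fin (n + 1))
    (hw : w ∈ distSet (n + 1) (min u.1 v.1) (max u.1 v.1) (min u.2 v.2) (max u.2 v.2)) :
    ¬ ((compGrid (n + 1)).Adj u w ↔ (compGrid (n + 1)).Adj v w) := by
  obtain ⟨a, b⟩ := u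
  obtain ⟨c, e⟩ := v
  obtain ⟨x, y⟩ := w
  rw [compGrid_adj_iff, compGrid_adj_iff]
  simp only [distSet, Finset.mem_union, Finset.mem_product, Finset.mem_Iio, Finset.mem_Ioi,
      Finset.mem_Ioc, Finset.mem_Ico, Fin.lt_def, Fin.le_def, ne_eq, Prod.mk.injEq, Fin.ext_iff,
      Fin.coe_min, Fin.coe_max] at *
  omega

theorem exists_good_pair (n : ℕ) (hn : 1 ≤ n) (A : Finset (Fin (n + 1) × Fin (n + 1)))
    (hA : 2 < A.card) : ∃ u ∈ A, ∃ v ∈ A, u ≠ v ∧ ¬ OppCorner n u v := by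
  obtain ⟨x, y, z, hx, hy, hz, hxy, hxz, hyz⟩ := Finset.two_lt_card_iff.mp hA
  by_cases h : OppCorner n x y
  · refine ⟨x, hx, z, hz, hxz, fun h' => hyz ?_⟩
    obtain ⟨a, b⟩ := x
    obtain ⟨c, e⟩ := y
    obtain ⟨f, g⟩ := z
    simp only [OppCorner, Fin.coe_min, Fin.coe_max, Prod.mk.injEq, Fin.ext_iff] at *
    omega
  · exact ⟨x, hx, y, hy, hxy, h⟩

theorem bound_of_partition (n d : ℕ) (hn : 1 ≤ n)
    (P : Finpartition (Finset.univ : Finset (Fin (n + 1) × Fin (n + 1))))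
    (hR : RedDegLE (compGrid (n + 1)) P d)
    (A : Finset (Fin (n + 1) × Fin (n + 1))) (hA : A ∈ P.parts) (hA2 : 2 < A.card)
    (h4 : ∀ B ∈ P.parts, B.card ≤ 4) : n ≤ (d + 1) * 4 := by
  classical
  obtain ⟨u, hu, v, hv, huv, hc⟩ := exists_good_pair n hn A hA2
  have hlarge := distSet_large n (min u.1 v.1) (max u.1 v.1) (min u.2 v.2) (max u.2 v.2)
    min_le_max min_le_max (by
      by_contra hcon
      push Not at hcon
      apply huv
      exact Prod.ext (inf_eq_sup.mp hcon.1) (inf_eq_sup.mp hcon.2)) hc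
  have hRA := hR A hA
  set R : Finset (Finset (Fin (n + 1) × Fin (n + 1))) :=
    P.parts.filter (fun B => B ≠ A ∧ ¬ Homog (compGrid (n + 1)) A B) with hRdef
  have hset : {B : Finset (Fin (n + 1) × Fin (n + 1)) |
      B ∈ P.parts ∧ B ≠ A ∧ ¬ Homog (compGrid (n + 1)) A B} = (R : Set _) := by
    ext B
    simp [hRdef]
  rw [hset, Set.ncard_coe_finset] at hRA
  have hsub : distSet (n + 1) (min u.1 v.1) (max u.1 v.1) (min u.2 v.2) (max u.2 v.2) ⊆
      (insert A R).biUnion id := by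
    intro w hw
    have hd := distinguish n u v w hw
    obtain ⟨B, hB, hwB⟩ := P.exists_mem (Finset.mem_univ w)
    rw [Finset.mem_biUnion]
    refine ⟨B, ?_, hwB⟩
    rw [Finset.mem_insert]
    by_cases hBA : B = A
    · exact Or.inl hBA
    · right
      rw [hRdef, Finset.mem_filter]
      refine ⟨hB, hBA, ?_⟩
      rintro (h | h)
      · exact hd (iff_of_true (h u hu w hwB) (h v hv w hwB))
      · exact hd (iff_of_false (h u hu w hwB) (h v hv w hwB))
  calc n ≤ _ := hlarge
    _ ≤ _ := Finset.card_le_card hsub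
    _ ≤ (insert A R).card * 4 := by
        apply Finset.card_biUnion_le_card_mul
        intro B hB
        apply h4
        rw [Finset.mem_insert] at hB
        rcases hB with rfl | hB
        · exact hA
        · exact (Finset.mem_filter.mp hB).1
    _ ≤ (d + 1) * 4 := by
        apply Nat.mul_le_mul_right
        exact (Finset.card_insert_le _ _).trans (by omega)

theorem compGrid_bound_nat (n : ℕ) (hn : 1 ≤ n) (d : ℕ)
    (hd : TwwLE (compGrid (n + 1)) d) : n ≤ (d + 1) * 4 := by
  classical
  obtain ⟨P, h0, hlast, hstep, hred⟩ := hd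
  have hcard : Fintype.card (Fin (n + 1) × Fin (n + 1)) = (n + 1) * (n + 1) := by simp
  have hc4 : 4 ≤ Fintype.card (Fin (n + 1) × Fin (n + 1)) := by rw [hcard]; nlinarith
  have hex : ∃ i, ∃ A ∈ (P i).parts, 2 < A.card := by
    refine ⟨Fintype.card (Fin (n + 1) × Fin (n + 1)) - 1, Finset.univ, ?_, ?_⟩
    · rw [hlast (by omega)]
      simp
    · rw [Finset.card_univ]
      omega
  have hle : Nat.find hex ≤ Fintype.card (Fin (n + 1) × Fin (n + 1)) - 1 := by
    apply Nat.find_min'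
    refine ⟨Finset.univ, ?_, ?_⟩
    · rw [hlast (by omega)]
      simp
    · rw [Finset.card_univ]
      omega
  obtain ⟨A, hA, hA2⟩ := Nat.find_spec hex
  have hmin := fun m => @Nat.find_min _ _ hex m
  generalize Nat.find hex = i at *
  refine bound_of_partition n d hn (P i) (hred i (by omega)) A hA hA2 ?_
  cases i with
  | zero =>
    intro B hB
    rw [h0 B hB]
    norm_num
  | succ k =>
    have hk : ∀ B ∈ (P k).parts, B.card ≤ 2 := by
      intro B hB
      by_contra hlt
      exact hmin k (by omega) ⟨B, hB, by omega⟩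
    obtain ⟨X, hX, Y, hY, -, hXY⟩ := hstep k (by omega)
    intro B hB
    rw [hXY, Finset.mem_insert] at hB
    rcases hB with rfl | hB
    · have := Finset.card_union_le X Y
      have := hk X hX
      have := hk Y hY
      omega
    · have := hk B (Finset.mem_of_mem_erase (Finset.mem_of_mem_erase hB))
      omega

/-- For every `n ≥ 1`, the comparability grid of order `n + 1` has
twin-width at least `n^(1/2) − 2`. -/
theorem compGrid_twinWidth_lower_bound (n : ℕ) (hn : 1 ≤ n) (d : ℕ)
    (hd : TwwLE (compGrid (n + 1)) d) :
    (n : ℝ) ^ ((1 : ℝ) / 2) - 2 ≤ (d : ℝ) := by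
  have h := compGrid_bound_nat n hn d hd
  have h' : (n : ℝ) ≤ ((d : ℝ) + 1) * 4 := by exact_mod_cast h
  rw [← Real.sqrt_eq_rpow]
  have h2 : Real.sqrt (n : ℝ) ≤ (d : ℝ) + 2 := by
    apply Real.sqrt_le_iff.mpr
    constructor
    · positivity
    · nlinarith [sq_nonneg (d : ℝ)]
  linarith
end
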